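/- arXiv:0909.0717 — 2 statements merged into one kernel-verified Lean document; each statement's English description precedes it below -/
import Mathlib

section
/- There is an absolute constant C > 0 with the following property. For every nonempty finite set P of points in ℝ² and all parameters 0 < ε < 1 and 0 < p < 1, there exists a nonempty subset Z ⊆ P with |Z| ≤ C·(1/(ε^{4/3}·p))·log^{4/3}(2/(ε·p)) such that Z is a relative (p,ε)-approximation for P with respect to closed halfplane ranges. -/
/-- The measure of a set `h` in a finite planar point set `Z`: `|Z ∩ h| / |Z|`. -/
noncomputable def meas2 (h : Set (ℝ × ℝ)) (Z : Finset (ℝ × ℝ)) : ℝ :=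
  (((↑Z : Set (ℝ × ℝ)) ∩ h).ncard : ℝ) / (Z.card : ℝ)

open Finset in
/-- Sauer-Shelah: a family of subsets of `V` shattering no set of more than `d` elements has at
most `(|V| + 1) ^ d` members. -/
theorem card_le_pow_of_shatters {β : Type*} [DecidableEq β] (𝒜 : Finset (Finset β)) (V : Finset β)
    (d : ℕ) (hV : ∀ S ∈ 𝒜, S ⊆ V) (hd : ∀ t, 𝒜.Shatters t → t.card ≤ d) :
    𝒜.card ≤ (V.card + 1) ^ d := by
  have h1 : 𝒜.shatterer ⊆ (range (d + 1)).biUnion fun k => V.powersetCard k := by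
    intro t ht
    rw [mem_shatterer] at ht
    obtain ⟨S, hS, hts⟩ := ht.exists_superset
    have := hd t ht
    exact mem_biUnion.2 ⟨t.card, mem_range.2 (by omega),
      mem_powersetCard.2 ⟨hts.trans (hV S hS), rfl⟩⟩
  calc 𝒜.card ≤ 𝒜.shatterer.card := card_le_card_shatterer 𝒜
    _ ≤ ∑ k ∈ range (d + 1), (V.powersetCard k).card := (card_le_card h1).trans card_biUnion_le
    _ ≤ ∑ k ∈ range (d + 1), V.card ^ k * 1 ^ (d - k) * d.choose k := by
        refine sum_le_sum fun k hk => ?_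
        rw [card_powersetCard, one_pow, mul_one]
        have : 0 < d.choose k := Nat.choose_pos (by rw [mem_range] at hk; omega)
        calc V.card.choose k ≤ V.card ^ k := Nat.choose_le_pow _ _
          _ ≤ V.card ^ k * d.choose k := Nat.le_mul_of_pos_right _ this
    _ = (V.card + 1) ^ d := (add_pow _ _ _).symm

open Finset in
/-- The weighted one-inclusion graph of a family shattering no `D`-element set has
edge weight at most `D` times its vertex weight. -/
theorem sum_min_insert_le {β : Type*} [DecidableEq β] (E : Finset β) : ∀ (D : ℕ) (Q : Finset β → ℕ),
    (∀ t ⊆ E, (∀ T ⊆ t, ∃ S ⊆ E, Q S ≠ 0 ∧ t ∩ S = T) → t.card < D) →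
    ∑ S ∈ E.powerset, ∑ i ∈ E \ S, min (Q S) (Q (insert i S)) ≤ D * ∑ S ∈ E.powerset, Q S := by
  induction E using Finset.induction_on with
  | empty => intro D Q _; simp
  | insert e E he ih =>
    intro D Q hQ
    have hzero : (∀ S ⊆ insert e E, Q S = 0) →
        ∑ S ∈ (insert e E).powerset, ∑ i ∈ insert e E \ S, min (Q S) (Q (insert i S)) = 0 := by
      intro h
      refine sum_eq_zero fun S hS => sum_eq_zero fun i _ => ?_
      rw [h S (mem_powerset.1 hS), Nat.zero_min]
    rcases D with _ | D
    · rw [hzero]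
      · exact Nat.zero_le _
      · intro S hS
        by_contra h
        have := hQ ∅ (empty_subset _) fun T hT => ⟨S, hS, h, by
          rw [empty_inter, subset_empty.1 hT]⟩
        omega
    · have hmax := ih (D + 1) (fun S => max (Q S) (Q (insert e S))) (by
        intro t ht hsh
        refine hQ t (ht.trans (subset_insert _ _)) fun T hT => ?_
        obtain ⟨S, hS, hne, hST⟩ := hsh T hT
        by_cases h0 : Q S = 0
        · refine ⟨insert e S, insert_subset_insert _ hS, ?_, ?_⟩
          · intro h1; apply hne; simp [h0, h1]
          · rw [inter_insert_of_notMem fun h => he (ht h), hST]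
        · exact ⟨S, hS.trans (subset_insert _ _), h0, hST⟩)
      have hmin := ih D (fun S => min (Q S) (Q (insert e S))) (by
        intro t ht hsh
        have het : e ∉ t := fun h => he (ht h)
        have := hQ (insert e t) (insert_subset_insert _ ht) fun T hT => ?_
        · rw [card_insert_of_notMem het] at this; omega
        obtain ⟨S, hS, hne, hST⟩ := hsh (T.erase e) (by
          intro x hx
          rw [mem_erase] at hx
          exact (mem_insert.1 (hT hx.2)).resolve_left hx.1)
        have heS : e ∉ S := fun h => he (hS h)
        by_cases heT : e ∈ T
        · refine ⟨insert e S, insert_subset_insert _ hS, ?_, ?_⟩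
          · intro h; apply hne; simp [h]
          · rw [← insert_inter_distrib, hST, insert_erase heT]
        · refine ⟨S, hS.trans (subset_insert _ _), ?_, ?_⟩
          · intro h; apply hne; simp [h]
          · rw [insert_inter_of_notMem heS, hST, erase_eq_of_notMem heT])
      rw [sum_powerset_insert he, sum_powerset_insert he, ← sum_add_distrib, ← sum_add_distrib]
      have hle : ∑ S ∈ E.powerset,
          (∑ i ∈ insert e E \ S, min (Q S) (Q (insert i S)) +
            ∑ i ∈ insert e E \ insert e S, min (Q (insert e S)) (Q (insert i (insert e S)))) ≤
          ∑ S ∈ E.powerset, (min (Q S) (Q (insert e S)) +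
            (∑ i ∈ E \ S, min (max (Q S) (Q (insert e S)))
              (max (Q (insert i S)) (Q (insert e (insert i S)))) +
            ∑ i ∈ E \ S, min (min (Q S) (Q (insert e S)))
              (min (Q (insert i S)) (Q (insert e (insert i S)))))) := by
        refine sum_le_sum fun S hS => ?_
        have heS : e ∉ S := fun h => he (mem_powerset.1 hS h)
        have h1 : insert e E \ S = insert e (E \ S) := insert_sdiff_of_notMem _ heS
        have h2 : insert e E \ insert e S = E \ S := by
          ext x
          simp only [mem_sdiff, mem_insert]
          constructor
          · rintro ⟨h, h'⟩; push Not at h'; exact ⟨h.resolve_left h'.1, h'.2⟩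
          · rintro ⟨h, h'⟩
            refine ⟨Or.inr h, ?_⟩
            rintro (rfl | h3)
            · exact he h
            · exact h' h3
        rw [h1, h2, sum_insert (by simp [he]), add_assoc, ← sum_add_distrib, ← sum_add_distrib]
        refine Nat.add_le_add_left (sum_le_sum fun i _ => ?_) _
        rw [insert_comm i e S]
        omega
      refine hle.trans ?_
      rw [sum_add_distrib, sum_add_distrib]
      have hsplit : ∑ S ∈ E.powerset, (Q S + Q (insert e S)) =
          ∑ S ∈ E.powerset, max (Q S) (Q (insert e S)) +
          ∑ S ∈ E.powerset, min (Q S) (Q (insert e S)) := by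
        rw [← sum_add_distrib]
        exact sum_congr rfl fun S _ => by omega
      rw [hsplit]
      nlinarith [hmax, hmin]

/-- The set `h` separates the two entries of the pair `q`. -/
def Separates {α : Type*} (h : Set α) (q : α × α) : Prop := ¬ (q.1 ∈ h ↔ q.2 ∈ h)

noncomputable instance {α : Type*} (h : Set α) : DecidablePred (Separates h) :=
  fun _ => Classical.propDecidable _

open Finset in
open Classical in
theorem half_mul_card_sub_one_le {α ι : Type*} [Fintype ι] (R : ι → Set α) (w : ι → ℝ)
    (hw : ∀ i, 0 ≤ w i) (C : Finset α) (hC : C.Nonempty) (δ : ℝ)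
    (hδ : ∀ u ∈ C, ∀ v ∈ C, u ≠ v → δ ≤ ∑ i with Separates (R i) (u, v), w i) :
    δ / 2 * ((C.card : ℝ) - 1) ≤
      ∑ i, w i * (min (C.filter (fun v => v ∉ R i)).card (C.filter (fun v => v ∈ R i)).card : ℕ) := by
  have hpos : (0 : ℝ) < C.card := by exact_mod_cast hC.card_pos
  have h1 : ∀ i, (C.card : ℝ) *
      (min (C.filter (fun v => v ∉ R i)).card (C.filter (fun v => v ∈ R i)).card : ℕ) ≥
      (1 / 2) * ∑ u ∈ C, ∑ v ∈ C, if Separates (R i) (u, v) then (1 : ℝ) else 0 := by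
    intro i
    have e1 : ∑ u ∈ C, ∑ v ∈ C, (if Separates (R i) (u, v) then (1 : ℝ) else 0) =
        2 * ((C.filter (fun v => v ∉ R i)).card * (C.filter (fun v => v ∈ R i)).card) := by
      have e2 : ∀ u v, (if Separates (R i) (u, v) then (1 : ℝ) else 0) =
          (if u ∉ R i then 1 else 0) * (if v ∈ R i then 1 else 0) +
          (if u ∈ R i then 1 else 0) * (if v ∉ R i then 1 else 0) := by
        intro u v
        by_cases hu : u ∈ R i <;> by_cases hv : v ∈ R i <;> simp [Separates, hu, hv]
      simp_rw [e2, sum_add_distrib, ← mul_sum, ← sum_mul, sum_boole]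
      ring
    have e3 : C.card = (C.filter (fun v => v ∉ R i)).card + (C.filter (fun v => v ∈ R i)).card := by
      rw [add_comm]; exact (card_filter_add_card_filter_not _).symm
    rw [e1, e3]
    have e4 : ∀ a b : ℕ, a * b ≤ (a + b) * min a b := by
      intro a b
      rcases le_total a b with h | h
      · rw [min_eq_left h]; nlinarith
      · rw [min_eq_right h]; nlinarith
    have := e4 (C.filter (fun v => v ∉ R i)).card (C.filter (fun v => v ∈ R i)).card
    have h5 : ((C.filter (fun v => v ∉ R i)).card : ℝ) * (C.filter (fun v => v ∈ R i)).card ≤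
      ((C.filter (fun v => v ∉ R i)).card + (C.filter (fun v => v ∈ R i)).card : ℕ) *
      (min (C.filter (fun v => v ∉ R i)).card (C.filter (fun v => v ∈ R i)).card : ℕ) := by
      exact_mod_cast this
    linarith
  have h2 : ∑ i, w i * ∑ u ∈ C, ∑ v ∈ C, (if Separates (R i) (u, v) then (1 : ℝ) else 0) =
      ∑ u ∈ C, ∑ v ∈ C, ∑ i with Separates (R i) (u, v), w i := by
    simp_rw [mul_sum]
    rw [sum_comm]
    refine sum_congr rfl fun u _ => ?_
    rw [sum_comm]
    refine sum_congr rfl fun v _ => ?_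
    rw [sum_filter]
    refine sum_congr rfl fun i _ => ?_
    split_ifs <;> simp
  have h3 : ∑ u ∈ C, ∑ v ∈ C, ∑ i with Separates (R i) (u, v), w i ≥
      C.card * ((C.card - 1) * δ) := by
    have : ∀ u ∈ C, ((C.card : ℝ) - 1) * δ ≤
        ∑ v ∈ C, ∑ i with Separates (R i) (u, v), w i := by
      intro u hu
      rw [← add_sum_erase _ _ hu]
      have h0 : 0 ≤ ∑ i with Separates (R i) (u, u), w i := sum_nonneg fun i _ => hw i
      have h4 := card_nsmul_le_sum (C.erase u)
        (fun v => ∑ i with Separates (R i) (u, v), w i) δ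
        (fun v hv => hδ u hu v (mem_of_mem_erase hv) (ne_of_mem_erase hv).symm)
      rw [card_erase_of_mem hu, nsmul_eq_mul, Nat.cast_sub hC.card_pos, Nat.cast_one] at h4
      linarith
    have h5 := card_nsmul_le_sum C _ _ this
    rwa [nsmul_eq_mul] at h5
  have h6 : (C.card : ℝ) * ∑ i, w i *
      (min (C.filter (fun v => v ∉ R i)).card (C.filter (fun v => v ∈ R i)).card : ℕ) ≥
      (1 / 2) * ∑ i, w i * ∑ u ∈ C, ∑ v ∈ C, (if Separates (R i) (u, v) then (1 : ℝ) else 0) := by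
    rw [mul_sum, mul_sum]
    refine sum_le_sum fun i _ => ?_
    have := mul_le_mul_of_nonneg_left (h1 i) (hw i)
    linarith
  rw [h2] at h6
  have h7 : (C.card : ℝ) * (δ / 2 * (C.card - 1)) ≤ (C.card : ℝ) * ∑ i, w i *
      (min (C.filter (fun v => v ∉ R i)).card (C.filter (fun v => v ∈ R i)).card : ℕ) := by
    linarith
  exact le_of_mul_le_mul_left h7 hpos

/-- The indices of the sampled ranges containing `v`. -/
noncomputable def sampleClass {α ι : Type*} (R : ι → Set α) {s : ℕ} (a : Fin s → ι) (v : α) :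
    Finset (Fin s) := by
  classical exact Finset.univ.filter fun j => v ∈ R (a j)

theorem mem_sampleClass {α ι : Type*} (R : ι → Set α) {s : ℕ} (a : Fin s → ι) (v : α)
    (j : Fin s) : j ∈ sampleClass R a v ↔ v ∈ R (a j) := by
  simp [sampleClass]

/-- No three of the ranges `R i` cut `V` into all eight possible classes. -/
def DualDimLeTwo {α ι : Type*} (R : ι → Set α) (V : Set α) : Prop :=
  ∀ f : Fin 3 → ι, ∃ T : Set (Fin 3), ∀ v ∈ V, ∃ i, ¬ (v ∈ R (f i) ↔ i ∈ T)

open Finset in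
open Classical in
theorem card_lt_three_of_shatters {α ι : Type*} (R : ι → Set α) (V : Finset α)
    (hR : DualDimLeTwo R (V : Set α)) {s : ℕ} (a : Fin s → ι) (t : Finset (Fin s))
    (ht : ∀ T ⊆ t, ∃ v ∈ V, t ∩ sampleClass R a v = T) : t.card < 3 := by
  by_contra hcard
  obtain ⟨u, hut, hu⟩ := exists_subset_card_eq (not_lt.1 hcard)
  let e := u.equivFinOfCardEq hu
  obtain ⟨T, hT⟩ := hR (fun i => a (e.symm i))
  obtain ⟨v, hv, hvT⟩ := ht ((univ.filter (fun i => i ∈ T)).image fun i => (e.symm i : Fin s)) (by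
    intro x hx
    obtain ⟨i, _, rfl⟩ := mem_image.1 hx
    exact hut (e.symm i).2)
  obtain ⟨i, hi⟩ := hT v hv
  apply hi
  rw [← mem_sampleClass R a v]
  have h1 : (e.symm i : Fin s) ∈ t := hut (e.symm i).2
  constructor
  · intro h
    have := hvT ▸ mem_inter.2 ⟨h1, h⟩
    obtain ⟨j, hj, hji⟩ := mem_image.1 this
    have : j = i := e.symm.injective (Subtype.ext hji)
    exact this ▸ (mem_filter.1 hj).2
  · intro h
    have : (e.symm i : Fin s) ∈ t ∩ sampleClass R a v := by
      rw [hvT]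
      exact mem_image.2 ⟨i, mem_filter.2 ⟨mem_univ _, h⟩, rfl⟩
    exact (mem_inter.1 this).2

open Finset in
open Classical in
theorem card_image_sampleClass_le {α ι : Type*} (R : ι → Set α) (V : Finset α)
    (hR : DualDimLeTwo R (V : Set α)) {s : ℕ} (a : Fin s → ι) :
    (V.image (sampleClass R a)).card ≤ (s + 1) ^ 2 := by
  have := card_le_pow_of_shatters (V.image (sampleClass R a)) univ 2 (fun _ _ => subset_univ _) (by
    intro t ht
    have := card_lt_three_of_shatters R V hR a t fun T hT => by
      obtain ⟨u, hu, h⟩ := ht hT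
      obtain ⟨v, hv, rfl⟩ := mem_image.1 hu
      exact ⟨v, hv, h⟩
    omega)
  simpa using this

theorem sampleClass_update {α ι : Type*} (R : ι → Set α) {s : ℕ} (a : Fin s → ι) (i : Fin s)
    (η : ι) (v : α) [Decidable (v ∈ R η)] : sampleClass R (Function.update a i η) v =
      if v ∈ R η then insert i ((sampleClass R a v).erase i) else (sampleClass R a v).erase i := by
  ext j
  rw [mem_sampleClass]
  by_cases hj : j = i
  · subst hj; split_ifs with h <;> simp [h]
  · split_ifs with h <;> simp [hj, mem_sampleClass]

open Finset in
open Classical in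
/-- The number of points of `V` in the class `S` of the sample `a`. -/
noncomputable def classSize {α ι : Type*} (R : ι → Set α) (V : Finset α) {s : ℕ} (a : Fin s → ι)
    (S : Finset (Fin s)) : ℕ := (V.filter fun v => sampleClass R a v = S).card

open Finset in
theorem sum_min_classSize_le {α ι : Type*} (R : ι → Set α) (V : Finset α)
    (hR : DualDimLeTwo R (V : Set α)) {s : ℕ} (a : Fin s → ι) :
    ∑ i : Fin s, ∑ S with i ∉ S, min (classSize R V a S) (classSize R V a (insert i S)) ≤
      3 * V.card := by
  classical
  have h := sum_min_insert_le univ 3 (classSize R V a) (by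
    intro t _ ht
    refine card_lt_three_of_shatters R V hR a t fun T hT => ?_
    obtain ⟨S, _, hS, h⟩ := ht T hT
    obtain ⟨v, hv⟩ := card_pos.1 (Nat.pos_of_ne_zero hS)
    rw [mem_filter] at hv
    exact ⟨v, hv.1, by rw [hv.2, h]⟩)
  rw [powerset_univ] at h
  have h1 : ∑ S, classSize R V a S = V.card :=
    (card_eq_sum_card_fiberwise fun v _ => mem_univ (sampleClass R a v)).symm
  rw [h1] at h
  refine le_of_eq_of_le ?_ h
  exact sum_comm' (by intro i S; simp)

open Finset in
theorem half_mul_card_sub_le_sum_update {α ι : Type*} [Fintype ι] (R : ι → Set α) (V : Finset α)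
    (hR : DualDimLeTwo R (V : Set α)) (w : ι → ℝ) (hw : ∀ i, 0 ≤ w i) (δ : ℝ) (hδ0 : 0 ≤ δ)
    (hδ : ∀ u ∈ V, ∀ v ∈ V, u ≠ v →
      δ ≤ ∑ i with Separates (R i) (u, v), w i)
    {s : ℕ} (a : Fin s → ι) (i : Fin s) :
    δ / 2 * ((V.card : ℝ) - (s + 1) ^ 2) ≤ ∑ η, w η * ((∑ S with i ∉ S,
      min (classSize R V (Function.update a i η) S)
        (classSize R V (Function.update a i η) (insert i S)) : ℕ) : ℝ) := by
  classical
  set c : α → Finset (Fin s) := fun v => (sampleClass R a v).erase i with hc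
  have hmem : ∀ v, i ∉ c v := fun v => notMem_erase _ _
  have hQ0 : ∀ η S, i ∉ S → classSize R V (Function.update a i η) S =
      ((V.filter fun v => c v = S).filter fun v => v ∉ R η).card := by
    intro η S hS
    rw [classSize, filter_filter]
    congr 1
    ext v
    simp only [mem_filter, sampleClass_update]
    refine and_congr_right fun _ => ?_
    by_cases hv : v ∈ R η
    · simp only [hv, if_true, not_true, and_false, iff_false]
      rintro rfl
      exact hS (mem_insert_self _ _)
    · simp [hv, hc]
  have hQ1 : ∀ η S, i ∉ S → classSize R V (Function.update a i η) (insert i S) =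
      ((V.filter fun v => c v = S).filter fun v => v ∈ R η).card := by
    intro η S hS
    rw [classSize, filter_filter]
    congr 1
    ext v
    simp only [mem_filter, sampleClass_update]
    refine and_congr_right fun _ => ?_
    by_cases hv : v ∈ R η
    · simp only [hv, if_true, and_true]
      constructor
      · intro h
        have := congrArg (fun X => X.erase i) h
        simpa [erase_insert hS] using this
      · intro h
        rw [← h]
    · simp only [hv, if_false, and_false, iff_false]
      intro h
      exact notMem_erase i (sampleClass R a v) (h ▸ mem_insert_self _ _)
  have h1 : ∑ η, w η * ((∑ S with i ∉ S, min (classSize R V (Function.update a i η) S)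
        (classSize R V (Function.update a i η) (insert i S)) : ℕ) : ℝ) =
      ∑ S with i ∉ S, ∑ η, w η *
        (min ((V.filter fun v => c v = S).filter fun v => v ∉ R η).card
          ((V.filter fun v => c v = S).filter fun v => v ∈ R η).card : ℕ) := by
    rw [sum_comm]
    refine sum_congr rfl fun η _ => ?_
    rw [Nat.cast_sum, mul_sum]
    refine sum_congr rfl fun S hS => ?_
    rw [hQ0 η S (mem_filter.1 hS).2, hQ1 η S (mem_filter.1 hS).2]
  rw [h1]
  have h2 : V.image c ⊆ univ.filter fun S => i ∉ S := by
    intro S hS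
    obtain ⟨v, _, rfl⟩ := mem_image.1 hS
    exact mem_filter.2 ⟨mem_univ _, hmem v⟩
  refine le_trans ?_ (sum_le_sum_of_subset_of_nonneg h2 fun S _ _ =>
    sum_nonneg fun η _ => mul_nonneg (hw η) (Nat.cast_nonneg _))
  have h3 : ∑ S ∈ V.image c, δ / 2 * (((V.filter fun v => c v = S).card : ℝ) - 1) ≤
      ∑ S ∈ V.image c, ∑ η, w η *
        (min ((V.filter fun v => c v = S).filter fun v => v ∉ R η).card
          ((V.filter fun v => c v = S).filter fun v => v ∈ R η).card : ℕ) := by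
    refine sum_le_sum fun S hS => half_mul_card_sub_one_le R w hw _ ?_ δ ?_
    · obtain ⟨v, hv, rfl⟩ := mem_image.1 hS
      exact ⟨v, mem_filter.2 ⟨hv, rfl⟩⟩
    · intro u hu v hv huv
      convert hδ u (mem_filter.1 hu).1 v (mem_filter.1 hv).1 huv
  refine le_trans ?_ h3
  rw [← mul_sum, sum_sub_distrib, ← Nat.cast_sum, ← card_eq_sum_card_image, sum_const,
    nsmul_eq_mul, mul_one]
  have h4 : (V.image c).card ≤ (s + 1) ^ 2 := by
    have : V.image c = (V.image (sampleClass R a)).image fun S => S.erase i := by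
      rw [image_image]; rfl
    rw [this]
    exact card_image_le.trans (card_image_sampleClass_le R V hR a)
  have h5 : ((V.image c).card : ℝ) ≤ (s + 1) ^ 2 := by exact_mod_cast h4
  exact mul_le_mul_of_nonneg_left (by linarith) (by linarith)

open Finset in
/-- Resampling one coordinate does not change a weighted average over all samples. -/
theorem sum_resample {ι : Type*} [Fintype ι] (w : ι → ℝ) {s : ℕ} (i : Fin s)
    (F : (Fin s → ι) → ℝ) :
    ∑ a : Fin s → ι, (∏ j, w (a j)) * ∑ η, w η * F (Function.update a i η) =
      (∑ η, w η) * ∑ a : Fin s → ι, (∏ j, w (a j)) * F a := by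
  classical
  let e : (Fin s → ι) × ι ≃ (Fin s → ι) × ι :=
    { toFun := fun q => (Function.update q.1 i q.2, q.1 i)
      invFun := fun q => (Function.update q.1 i q.2, q.1 i)
      left_inv := fun q => by simp
      right_inv := fun q => by simp }
  have h1 : ∀ (a : Fin s → ι) (η : ι),
      (∏ j, w (Function.update a i η j)) * w (a i) = (∏ j, w (a j)) * w η := by
    intro a η
    rw [← mul_prod_erase univ (fun j => w (a j)) (mem_univ i),
      ← mul_prod_erase univ (fun j => w (Function.update a i η j)) (mem_univ i)]
    have : ∏ j ∈ univ.erase i, w (Function.update a i η j) = ∏ j ∈ univ.erase i, w (a j) :=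
      prod_congr rfl fun j hj => by rw [Function.update_of_ne (ne_of_mem_erase hj)]
    rw [this, Function.update_self]
    ring
  calc ∑ a : Fin s → ι, (∏ j, w (a j)) * ∑ η, w η * F (Function.update a i η)
      = ∑ q : (Fin s → ι) × ι, (∏ j, w (q.1 j)) * w q.2 * F (Function.update q.1 i q.2) := by
        rw [Fintype.sum_prod_type]
        simp_rw [mul_sum, mul_assoc]
    _ = ∑ q : (Fin s → ι) × ι, (∏ j, w (q.1 j)) * w q.2 * F q.1 := by
        refine Fintype.sum_equiv e _ _ fun q => ?_
        simp only [e, Equiv.coe_fn_mk]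
        rw [h1]
    _ = (∑ η, w η) * ∑ a : Fin s → ι, (∏ j, w (a j)) * F a := by
        rw [Fintype.sum_prod_type, mul_sum]
        refine sum_congr rfl fun a _ => ?_
        rw [sum_mul]
        exact sum_congr rfl fun η _ => by ring

open Finset in
theorem packing {α ι : Type*} [Fintype ι] (R : ι → Set α) (V : Finset α)
    (hR : DualDimLeTwo R (V : Set α)) (w : ι → ℝ) (hw : ∀ i, 0 ≤ w i) (hw1 : 0 < ∑ i, w i)
    (δ : ℝ) (hδ0 : 0 ≤ δ)
    (hδ : ∀ u ∈ V, ∀ v ∈ V, u ≠ v → δ ≤ ∑ i with Separates (R i) (u, v), w i) (s : ℕ) :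
    s * (δ / 2 * ((V.card : ℝ) - (s + 1) ^ 2)) ≤ 3 * V.card * ∑ i, w i := by
  classical
  set F : (Fin s → ι) → Fin s → ℝ := fun a i => ((∑ S with i ∉ S,
    min (classSize R V a S) (classSize R V a (insert i S)) : ℕ) : ℝ) with hF
  set Ω := ∑ i, w i with hΩ
  set A := ∑ a : Fin s → ι, ∏ j, w (a j) with hA
  have hA0 : 0 < A := by
    have : A = Ω ^ s := by
      rw [hA, hΩ, Fintype.sum_pow]
    rw [this]; positivity
  have hp : ∀ a : Fin s → ι, 0 ≤ ∏ j, w (a j) := fun a => prod_nonneg fun j _ => hw _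
  have hup : ∑ a : Fin s → ι, (∏ j, w (a j)) * ∑ i, F a i ≤ A * (3 * V.card) := by
    rw [hA, sum_mul]
    refine sum_le_sum fun a _ => mul_le_mul_of_nonneg_left ?_ (hp a)
    have := sum_min_classSize_le R V hR a
    simp only [hF]
    exact_mod_cast this
  have hlow : ∀ i : Fin s, A * (δ / 2 * ((V.card : ℝ) - (s + 1) ^ 2)) ≤
      Ω * ∑ a : Fin s → ι, (∏ j, w (a j)) * F a i := by
    intro i
    rw [← sum_resample w i (fun a => F a i), hA, sum_mul]
    refine sum_le_sum fun a _ => mul_le_mul_of_nonneg_left ?_ (hp a)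
    exact half_mul_card_sub_le_sum_update R V hR w hw δ hδ0
      (fun u hu v hv huv => by convert hδ u hu v hv huv) a i
  have h1 : A * (s * (δ / 2 * ((V.card : ℝ) - (s + 1) ^ 2))) ≤ A * (3 * V.card * Ω) := by
    calc A * (s * (δ / 2 * ((V.card : ℝ) - (s + 1) ^ 2)))
        = ∑ i : Fin s, A * (δ / 2 * ((V.card : ℝ) - (s + 1) ^ 2)) := by
          rw [sum_const, card_univ, Fintype.card_fin, nsmul_eq_mul]; ring
      _ ≤ ∑ i : Fin s, Ω * ∑ a : Fin s → ι, (∏ j, w (a j)) * F a i := sum_le_sum fun i _ => hlow i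
      _ = Ω * ∑ a : Fin s → ι, (∏ j, w (a j)) * ∑ i, F a i := by
          rw [← mul_sum, sum_comm]; simp_rw [mul_sum]
      _ ≤ Ω * (A * (3 * V.card)) := mul_le_mul_of_nonneg_left hup hw1.le
      _ = A * (3 * V.card * Ω) := by ring
  exact le_of_mul_le_mul_left h1 hA0

open Finset in
/-- Among `N ≥ 2` points some two are separated by ranges of weight `O(1 / √N)` of the total. -/
theorem exists_short_pair {α ι : Type*} [Fintype ι] (R : ι → Set α) (V : Finset α)
    (hR : DualDimLeTwo R (V : Set α)) (w : ι → ℝ) (hw : ∀ i, 0 ≤ w i) (hV : 2 ≤ V.card) :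
    ∃ u ∈ V, ∃ v ∈ V, u ≠ v ∧
      (∑ i with Separates (R i) (u, v), w i) * √V.card ≤ 96 * ∑ i, w i := by
  have htriv : ∀ q, ∑ i with Separates (R i) q, w i ≤ ∑ i, w i := fun q =>
    sum_le_sum_of_subset_of_nonneg (filter_subset _ _) fun i _ _ => hw i
  have hΩ0 : 0 ≤ ∑ i, w i := sum_nonneg fun i _ => hw i
  by_contra! hcon
  obtain ⟨u₀, hu₀, v₀, hv₀, huv₀⟩ := one_lt_card.1 (show 1 < V.card by omega)
  have h₀ := hcon u₀ hu₀ v₀ hv₀ huv₀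
  have hsq : 0 ≤ √(V.card : ℝ) := Real.sqrt_nonneg _
  have hΩ : 0 < ∑ i, w i := by
    rcases hΩ0.eq_or_lt with h | h
    · have h1 := mul_le_mul_of_nonneg_right (htriv (u₀, v₀)) hsq
      rw [← h] at h1 h₀
      linarith
    · exact h
  have h16 : 16 ≤ V.card := by
    by_contra! h
    have h1 : √(V.card : ℝ) ≤ 4 := by
      rw [Real.sqrt_le_left (by norm_num)]
      have : (V.card : ℝ) ≤ 16 := by exact_mod_cast h.le
      linarith
    have h2 := mul_le_mul (htriv (u₀, v₀)) h1 hsq hΩ0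
    linarith
  have hN : (0 : ℝ) < V.card := by exact_mod_cast (by omega : 0 < V.card)
  have hsq' : 0 < √(V.card : ℝ) := Real.sqrt_pos.2 hN
  set r := Nat.sqrt V.card with hr
  have hr4 : 4 ≤ r := Nat.le_sqrt.2 (by omega)
  have hrN : r * r ≤ V.card := Nat.sqrt_le _
  set s := r / 4 with hs
  have hs2 : 2 * (s + 1) ^ 2 ≤ V.card := by
    have : 2 * (s + 1) ≤ r := by omega
    nlinarith
  have hs3 : √(V.card : ℝ) < 8 * s := by
    have h1 : √(V.card : ℝ) < r + 1 := Real.real_sqrt_lt_nat_sqrt_succ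
    have h2 : r + 1 ≤ 8 * s := by omega
    have : ((r : ℝ) + 1) ≤ 8 * s := by exact_mod_cast h2
    linarith
  have hp := packing R V hR w hw hΩ (96 * (∑ i, w i) / √V.card) (by positivity)
    (fun u hu v hv huv => by
      rw [div_le_iff₀ hsq']
      exact (hcon u hu v hv huv).le) s
  have hs2' : 2 * ((s : ℝ) + 1) ^ 2 ≤ V.card := by exact_mod_cast hs2
  have h3 : (s : ℝ) * (96 * (∑ i, w i) / √V.card / 2 * (V.card / 2)) ≤ 3 * V.card * ∑ i, w i := by
    refine le_trans (mul_le_mul_of_nonneg_left (mul_le_mul_of_nonneg_left ?_ (by positivity))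
      (Nat.cast_nonneg _)) hp
    linarith
  have h4 : (s : ℝ) * (96 * (∑ i, w i) / √V.card / 2 * (V.card / 2)) =
      (8 * s / √V.card) * (3 * V.card * ∑ i, w i) := by ring
  rw [h4] at h3
  have h5 : 1 < 8 * (s : ℝ) / √V.card := by rwa [lt_div_iff₀ hsq', one_mul]
  have h6 : 0 < 3 * (V.card : ℝ) * ∑ i, w i := by positivity
  nlinarith

/-- `M` is a family of pairs which together with the leftovers `L` partitions `X`. -/
def IsPairing {α : Type*} (M : Multiset (α × α)) (L X : Multiset α) : Prop :=
  M.map Prod.fst + M.map Prod.snd + L = X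

/-- The number of pairs of `M` separated by `h`. -/
noncomputable def crossing {α : Type*} (h : Set α) (M : Multiset (α × α)) : ℕ :=
  M.countP (Separates h)

theorem crossing_add {α : Type*} (h : Set α) (M N : Multiset (α × α)) :
    crossing h (M + N) = crossing h M + crossing h N := Multiset.countP_add _ _ _

theorem crossing_zero {α : Type*} (h : Set α) : crossing h 0 = 0 := Multiset.countP_zero _

theorem crossing_cons {α : Type*} (h : Set α) (q : α × α) (M : Multiset (α × α)) :
    crossing h (q ::ₘ M) = crossing h M + if Separates h q then 1 else 0 :=
  Multiset.countP_cons _ _ _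

theorem IsPairing.add {α : Type*} {M N : Multiset (α × α)} {L K X Y : Multiset α}
    (h : IsPairing M L X) (h' : IsPairing N K Y) : IsPairing (M + N) (L + K) (X + Y) := by
  rw [IsPairing, ← h, ← h', Multiset.map_add, Multiset.map_add]
  abel

theorem IsPairing.trans {α : Type*} {M N : Multiset (α × α)} {L K X : Multiset α}
    (h : IsPairing M L X) (h' : IsPairing N K L) : IsPairing (M + N) K X := by
  rw [IsPairing, ← h, ← h', Multiset.map_add, Multiset.map_add]
  abel

theorem IsPairing.mem {α : Type*} {M : Multiset (α × α)} {L X : Multiset α}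
    (h : IsPairing M L X) {q : α × α} (hq : q ∈ M) : q.1 ∈ X ∧ q.2 ∈ X := by
  rw [← h]
  simp only [Multiset.mem_add]
  exact ⟨Or.inl (Or.inl (Multiset.mem_map_of_mem _ hq)),
    Or.inl (Or.inr (Multiset.mem_map_of_mem _ hq))⟩

theorem IsPairing.le {α : Type*} {M : Multiset (α × α)} {L X : Multiset α}
    (h : IsPairing M L X) : L ≤ X := by
  rw [← h]; exact Multiset.le_add_left _ _

theorem sqrt_sub_two_add_inv_le {x : ℝ} (hx : 2 ≤ x) : √(x - 2) + 1 / √x ≤ √x := by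
  have h1 : 0 < √x := Real.sqrt_pos.2 (by linarith)
  have h2 := Real.sq_sqrt (show 0 ≤ x by linarith)
  have h3 := Real.sq_sqrt (show 0 ≤ x - 2 by linarith)
  have h4 := Real.sqrt_nonneg (x - 2)
  have h5 : √(x - 2) * √x + 1 ≤ √x * √x := by nlinarith [sq_nonneg (√(x - 2) - √x)]
  have : √(x - 2) + 1 / √x = (√(x - 2) * √x + 1) / √x := by field_simp
  rw [this, div_le_iff₀ h1]
  exact h5

open Finset in
/-- Iterated reweighting: a pairing whose exponential crossing weight is controlled. -/
theorem exists_pairing_sum_le {α ι : Type*} [Fintype ι] (R : ι → Set α) (n : ℕ) :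
    ∀ V : Finset α, V.card = n → DualDimLeTwo R (V : Set α) → ∀ w : ι → ℝ, (∀ i, 0 ≤ w i) →
    ∃ M L, IsPairing M L V.val ∧ L.card ≤ 1 ∧
      ∑ i, w i * 2 ^ crossing (R i) M ≤ (∑ i, w i) * Real.exp (96 * √n) := by
  classical
  induction n using Nat.strong_induction_on with
  | _ n ih =>
  intro V hn hR w hw
  by_cases h2 : n < 2
  · refine ⟨0, V.val, by simp [IsPairing], by change V.card ≤ 1; omega, ?_⟩
    simp only [crossing_zero, pow_zero, mul_one]
    refine le_mul_of_one_le_right (sum_nonneg fun i _ => hw i) (Real.one_le_exp (by positivity))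
  push Not at h2
  obtain ⟨u, hu, v, hv, huv, hsep⟩ := exists_short_pair R V hR w hw (by omega)
  have hvu : v ∈ V.erase u := mem_erase.2 ⟨huv.symm, hv⟩
  have hcard : ((V.erase u).erase v).card = n - 2 := by
    rw [card_erase_of_mem hvu, card_erase_of_mem hu, hn]; omega
  set w' : ι → ℝ := fun i => w i * 2 ^ (if Separates (R i) (u, v) then 1 else 0) with hw'
  obtain ⟨M, L, hML, hL, hM⟩ := ih (n - 2) (by omega) ((V.erase u).erase v) hcard
    (fun f => (hR f).imp fun T hT v hv => hT v (by
      simp only [coe_erase, Set.mem_sdiff] at hv; exact hv.1.1)) w'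
    (fun i => mul_nonneg (hw i) (by positivity))
  refine ⟨(u, v) ::ₘ M, L, ?_, hL, ?_⟩
  · have h1 : u ::ₘ (v ::ₘ ((V.erase u).erase v).val) = V.val := by
      rw [← insert_val_of_notMem (notMem_erase v _), insert_erase hvu,
        ← insert_val_of_notMem (notMem_erase u _), insert_erase hu]
    rw [IsPairing, ← h1, ← hML]
    simp only [Multiset.map_cons, Multiset.cons_add, Multiset.add_cons]
    exact Multiset.cons_swap _ _ _
  · have h1 : ∑ i, w i * 2 ^ crossing (R i) ((u, v) ::ₘ M) = ∑ i, w' i * 2 ^ crossing (R i) M := by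
      refine sum_congr rfl fun i _ => ?_
      rw [crossing_cons, pow_add, hw']
      ring
    have h2' : ∑ i, w' i = ∑ i, w i + ∑ i with Separates (R i) (u, v), w i := by
      rw [sum_filter, ← sum_add_distrib]
      refine sum_congr rfl fun i _ => ?_
      rw [hw']
      dsimp only
      split_ifs <;> ring
    have hn0 : (0 : ℝ) < √n := Real.sqrt_pos.2 (by exact_mod_cast (by omega : 0 < n))
    rw [hn] at hsep
    have hΩ0 : 0 ≤ ∑ i, w i := sum_nonneg fun i _ => hw i
    have h3 : ∑ i, w' i ≤ (∑ i, w i) * Real.exp (96 * (1 / √n)) := by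
      have e1 : ∑ i with Separates (R i) (u, v), w i ≤ (∑ i, w i) * (96 * (1 / √n)) := by
        rw [← le_div_iff₀ hn0] at hsep
        refine hsep.trans_eq (by ring)
      have e2 := Real.add_one_le_exp (96 * (1 / √(n : ℝ)))
      have e3 := mul_le_mul_of_nonneg_left e2 hΩ0
      rw [h2']
      linarith
    have h4 := sqrt_sub_two_add_inv_le (x := n) (by exact_mod_cast h2)
    rw [h1]
    calc ∑ i, w' i * 2 ^ crossing (R i) M
        ≤ (∑ i, w' i) * Real.exp (96 * √(n - 2 : ℕ)) := hM
      _ ≤ (∑ i, w i) * Real.exp (96 * (1 / √n)) * Real.exp (96 * √(n - 2 : ℕ)) :=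
        mul_le_mul_of_nonneg_right h3 (Real.exp_pos _).le
      _ = (∑ i, w i) * Real.exp (96 * (√(n - 2 : ℕ) + 1 / √n)) := by
        rw [mul_assoc, ← Real.exp_add]; ring_nf
      _ ≤ (∑ i, w i) * Real.exp (96 * √n) := by
        refine mul_le_mul_of_nonneg_left (Real.exp_le_exp.2 ?_) hΩ0
        rw [Nat.cast_sub h2]
        push_cast
        linarith

/-- The closed half-plane `0 ≤ a x + b y + c`, for `t = (a, b, c)`. -/
def halfPlane (t : ℝ × ℝ × ℝ) : Set (ℝ × ℝ) := {x | 0 ≤ t.1 * x.1 + t.2.1 * x.2 + t.2.2}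

theorem mem_halfPlane {t : ℝ × ℝ × ℝ} {x : ℝ × ℝ} :
    x ∈ halfPlane t ↔ 0 ≤ t.1 * x.1 + t.2.1 * x.2 + t.2.2 := Iff.rfl

open Finset in
theorem exists_finset_traces (V : Finset (ℝ × ℝ)) :
    ∃ F : Finset (ℝ × ℝ × ℝ), F.card ≤ (V.card + 1) ^ 3 ∧
      ∀ t, ∃ f ∈ F, ∀ x ∈ V, x ∈ halfPlane t ↔ x ∈ halfPlane f := by
  classical
  set 𝒜 := V.powerset.filter fun S => ∃ t, ∀ x ∈ V, x ∈ S ↔ x ∈ halfPlane t with h𝒜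
  have hex : ∀ S : Finset (ℝ × ℝ), ∃ t, S ∈ 𝒜 → ∀ x ∈ V, x ∈ S ↔ x ∈ halfPlane t := by
    intro S
    by_cases hS : S ∈ 𝒜
    · obtain ⟨t, ht⟩ := (mem_filter.1 hS).2
      exact ⟨t, fun _ => ht⟩
    · exact ⟨0, fun h => absurd h hS⟩
  choose g hg using hex
  refine ⟨𝒜.image g, card_image_le.trans (card_le_pow_of_shatters 𝒜 V 3
    (fun S hS => mem_powerset.1 (mem_filter.1 hS).1) ?_), ?_⟩
  · intro t ht
    by_contra! hcard
    have htV : t ⊆ V := by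
      obtain ⟨S, hS, hts⟩ := ht.exists_superset
      exact hts.trans (mem_powerset.1 (mem_filter.1 hS).1)
    obtain ⟨c, hc1, hc0, y, hy, hcy⟩ :=
      Module.exists_nontrivial_relation_sum_zero_of_finrank_succ_lt_card (R := ℝ) (t := t) (by
        rw [Module.finrank_prod, Module.finrank_self]; omega)
    obtain ⟨S, hS, hSt⟩ := ht (filter_subset (fun x => 0 < c x) t)
    obtain ⟨f, hf⟩ := (mem_filter.1 hS).2
    have hiff : ∀ x ∈ t, 0 < c x ↔ x ∈ halfPlane f := by
      intro x hx
      rw [← hf x (htV hx)]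
      constructor
      · intro h
        exact (mem_inter.1 (hSt ▸ mem_filter.2 ⟨hx, h⟩ : x ∈ t ∩ S)).2
      · intro h
        exact (mem_filter.1 (hSt ▸ mem_inter.2 ⟨hx, h⟩ : x ∈ t.filter fun x => 0 < c x)).2
    obtain ⟨z, hz, hcz⟩ : ∃ z ∈ t, c z < 0 := by
      by_contra! hall
      exact hcy ((sum_eq_zero_iff_of_nonneg hall).1 hc0 y hy)
    have hsum : ∑ x ∈ t, c x * (f.1 * x.1 + f.2.1 * x.2 + f.2.2) = 0 := by
      have h1 := congrArg Prod.fst hc1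
      have h2 := congrArg Prod.snd hc1
      simp only [Prod.fst_sum, Prod.snd_sum, Prod.smul_fst, Prod.smul_snd, smul_eq_mul,
        Prod.fst_zero, Prod.snd_zero] at h1 h2
      calc ∑ x ∈ t, c x * (f.1 * x.1 + f.2.1 * x.2 + f.2.2)
          = f.1 * ∑ x ∈ t, c x * x.1 + f.2.1 * ∑ x ∈ t, c x * x.2 + f.2.2 * ∑ x ∈ t, c x := by
            rw [mul_sum, mul_sum, mul_sum, ← sum_add_distrib, ← sum_add_distrib]
            exact sum_congr rfl fun x _ => by ring
        _ = 0 := by rw [h1, h2, hc0]; ring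
    have hpos : 0 < ∑ x ∈ t, c x * (f.1 * x.1 + f.2.1 * x.2 + f.2.2) := by
      have hneg : ∀ x ∈ t, ¬ 0 < c x → f.1 * x.1 + f.2.1 * x.2 + f.2.2 < 0 := fun x hx h =>
        not_le.1 fun h' => h ((hiff x hx).2 h')
      refine sum_pos' (fun x hx => ?_) ⟨z, hz, ?_⟩
      · by_cases h : 0 < c x
        · exact mul_nonneg h.le ((hiff x hx).1 h)
        · exact mul_nonneg_of_nonpos_of_nonpos (not_lt.1 h) (hneg x hx h).le
      · exact mul_pos_of_neg_of_neg hcz (hneg z hz (not_lt.2 hcz.le))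
    linarith
  · intro t
    have hmem : V.filter (fun x => x ∈ halfPlane t) ∈ 𝒜 :=
      mem_filter.2 ⟨mem_powerset.2 (filter_subset _ _), t, fun x hx => by simp [hx]⟩
    refine ⟨_, mem_image_of_mem g hmem, fun x hx => ?_⟩
    rw [← hg _ hmem x hx, mem_filter, and_iff_right hx]

theorem dualDimLeTwo_halfPlane {ι : Type*} (t : ι → ℝ × ℝ × ℝ) (V : Set (ℝ × ℝ)) :
    DualDimLeTwo (fun i => halfPlane (t i)) V := by
  intro f
  have hdep : ¬ LinearIndependent ℝ fun i : Fin 3 => ((t (f i)).1, (t (f i)).2.1) := fun h => by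
    have := h.fintype_card_le_finrank
    rw [Module.finrank_prod, Module.finrank_self, Fintype.card_fin] at this
    omega
  obtain ⟨c, hc, j, hj⟩ := Fintype.not_linearIndependent_iff.1 hdep
  have h1 := congrArg Prod.fst hc
  have h2 := congrArg Prod.snd hc
  simp only [Prod.fst_sum, Prod.snd_sum, Prod.smul_fst, Prod.smul_snd, smul_eq_mul,
    Prod.fst_zero, Prod.snd_zero] at h1 h2
  set K := ∑ i, c i * (t (f i)).2.2 with hK
  set φ : Fin 3 → ℝ × ℝ → ℝ := fun i x =>
    (t (f i)).1 * x.1 + (t (f i)).2.1 * x.2 + (t (f i)).2.2 with hφ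
  have hsum : ∀ x : ℝ × ℝ, ∑ i, c i * φ i x = K := by
    intro x
    calc ∑ i, c i * φ i x
        = (∑ i, c i * (t (f i)).1) * x.1 + (∑ i, c i * (t (f i)).2.1) * x.2 + K := by
          rw [hK, Finset.sum_mul, Finset.sum_mul, ← Finset.sum_add_distrib,
            ← Finset.sum_add_distrib]
          exact Finset.sum_congr rfl fun i _ => by simp only [hφ]; ring
      _ = K := by rw [h1, h2]; ring
  by_cases hcase : K < 0 ∨ (K = 0 ∧ ∃ i, c i < 0)
  · refine ⟨{i | 0 ≤ c i}, fun v _ => ?_⟩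
    by_contra! hall
    have hterm : ∀ i, 0 ≤ c i * φ i v ∧ (c i < 0 → 0 < c i * φ i v) := by
      intro i
      by_cases h : 0 ≤ c i
      · exact ⟨mul_nonneg h ((hall i).2 h), fun h' => absurd h (not_le.2 h')⟩
      · have : φ i v < 0 := not_le.1 fun h' => h ((hall i).1 h')
        exact ⟨(mul_pos_of_neg_of_neg (not_le.1 h) this).le,
          fun h' => mul_pos_of_neg_of_neg h' this⟩
    have hs0 := Finset.sum_nonneg fun i (_ : i ∈ Finset.univ) => (hterm i).1
    rw [hsum] at hs0
    rcases hcase with h | ⟨h, i, hi⟩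
    · linarith
    · have := Finset.sum_pos' (fun i (_ : i ∈ Finset.univ) => (hterm i).1)
        ⟨i, Finset.mem_univ _, (hterm i).2 hi⟩
      rw [hsum] at this
      linarith
  · push Not at hcase
    refine ⟨{i | c i < 0}, fun v _ => ?_⟩
    by_contra! hall
    have hterm : ∀ i, c i * φ i v ≤ 0 ∧ (0 < c i → c i * φ i v < 0) := by
      intro i
      by_cases h : c i < 0
      · exact ⟨mul_nonpos_of_nonpos_of_nonneg h.le ((hall i).2 h),
          fun h' => absurd h (not_lt.2 h'.le)⟩
      · have : φ i v < 0 := not_le.1 fun h' => h ((hall i).1 h')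
        exact ⟨mul_nonpos_of_nonneg_of_nonpos (not_lt.1 h) this.le,
          fun h' => mul_neg_of_pos_of_neg h' this⟩
    have hs0 := Finset.sum_nonpos fun i (_ : i ∈ Finset.univ) => (hterm i).1
    rw [hsum] at hs0
    have hK0 : K = 0 := le_antisymm hs0 hcase.1
    have hjpos : 0 < c j := lt_of_le_of_ne (hcase.2 hK0 j) (Ne.symm hj)
    have := Finset.sum_lt_sum (fun i (_ : i ∈ Finset.univ) => (hterm i).1)
      ⟨j, Finset.mem_univ _, (hterm j).2 hjpos⟩
    rw [hsum, Finset.sum_const_zero] at this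
    linarith

theorem crossing_congr {α : Type*} {h h' : Set α} {M : Multiset (α × α)} {L X : Multiset α}
    (hM : IsPairing M L X) (hh : ∀ x ∈ X, x ∈ h ↔ x ∈ h') : crossing h M = crossing h' M := by
  refine Multiset.countP_congr rfl fun q hq => ?_
  rw [Separates, Separates, hh _ (hM.mem hq).1, hh _ (hM.mem hq).2]

theorem log_one_add_le_two_mul_sqrt {x : ℝ} (hx : 0 ≤ x) : Real.log (x + 1) ≤ 2 * √x := by
  have h1 : x + 1 ≤ (√x + 1) ^ 2 := by nlinarith [Real.sq_sqrt hx, Real.sqrt_nonneg x]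
  calc Real.log (x + 1) ≤ Real.log ((√x + 1) ^ 2) := Real.log_le_log (by linarith) h1
    _ = 2 * Real.log (√x + 1) := by rw [Real.log_pow]; norm_num
    _ ≤ 2 * √x := by
      have := Real.log_le_sub_one_of_pos (show 0 < √x + 1 by positivity)
      linarith

/-- Chazelle-Welzl: a pairing of `G` crossed `O(√|G|)` times by every half-plane. -/
theorem exists_pairing_crossing_le_sqrt (G : Finset (ℝ × ℝ)) :
    ∃ M L, IsPairing M L G.val ∧ L.card ≤ 1 ∧
      ∀ t, (crossing (halfPlane t) M : ℝ) ≤ 204 * √G.card := by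
  obtain ⟨F, hF, hFt⟩ := exists_finset_traces G
  obtain ⟨M, L, hML, hL, hM⟩ := exists_pairing_sum_le (fun i : F => halfPlane i) G.card G rfl
    (dualDimLeTwo_halfPlane (fun i : F => (i : ℝ × ℝ × ℝ)) _) (fun _ => 1) fun _ => zero_le_one
  refine ⟨M, L, hML, hL, fun t => ?_⟩
  obtain ⟨f, hf, htf⟩ := hFt t
  rw [crossing_congr hML htf]
  simp only [one_mul, Finset.sum_const, Finset.card_univ, Fintype.card_coe, nsmul_eq_mul,
    mul_one] at hM
  have h1 : (2 : ℝ) ^ crossing (halfPlane f) M ≤ ((G.card : ℝ) + 1) ^ 3 * Real.exp (96 * √G.card) := by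
    have := Finset.single_le_sum (f := fun i : F => (2 : ℝ) ^ crossing (halfPlane i) M)
      (fun _ _ => by positivity) (Finset.mem_univ ⟨f, hf⟩)
    refine this.trans (hM.trans (mul_le_mul_of_nonneg_right ?_ (Real.exp_pos _).le))
    exact_mod_cast hF
  have h2 := Real.log_le_log (by positivity) h1
  rw [Real.log_pow, Real.log_mul (by positivity) (Real.exp_pos _).ne', Real.log_exp,
    Real.log_pow] at h2
  have h3 := log_one_add_le_two_mul_sqrt (Nat.cast_nonneg (α := ℝ) G.card)
  have h4 := Real.log_two_gt_d9
  have h5 : (crossing (halfPlane f) M : ℝ) * (1 / 2) ≤ crossing (halfPlane f) M * Real.log 2 :=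
    mul_le_mul_of_nonneg_left (by linarith) (Nat.cast_nonneg _)
  push_cast at h2
  linarith

/-- The point `p` satisfies `m x + c ≤ s y`, for `g = (m, c)`. -/
def IsAbove (s : ℝ) (g p : ℝ × ℝ) : Prop := g.1 * p.1 + g.2 ≤ s * p.2

/-- At abscissa `x`, the amount by which the boundary line of `halfPlane t` satisfies the
inequality of `IsAbove s g`. -/
noncomputable def lineGap (s : ℝ) (t : ℝ × ℝ × ℝ) (g : ℝ × ℝ) (x : ℝ) : ℝ :=
  s * (-(t.1 * x + t.2.2) / t.2.1) - (g.1 * x + g.2)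

/-- At abscissa `x` the boundary line of `halfPlane t` lies strictly below all of `𝒢`. -/
def IsBelowAll (s : ℝ) (𝒢 : Finset (ℝ × ℝ)) (t : ℝ × ℝ × ℝ) (x : ℝ) : Prop :=
  ∀ g ∈ 𝒢, lineGap s t g x < 0

theorem lineGap_eq (s : ℝ) (t : ℝ × ℝ × ℝ) (g : ℝ × ℝ) (x y : ℝ) :
    lineGap s t g y = lineGap s t g x + (y - x) * (s * (-t.1 / t.2.1) - g.1) := by
  simp only [lineGap]; ring

theorem lineGap_nonneg_or {s : ℝ} {t : ℝ × ℝ × ℝ} {g : ℝ × ℝ} {x : ℝ} (h : 0 ≤ lineGap s t g x) :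
    (∀ y, y ≤ x → 0 ≤ lineGap s t g y) ∨ (∀ y, x ≤ y → 0 ≤ lineGap s t g y) := by
  rcases le_total (s * (-t.1 / t.2.1) - g.1) 0 with hs | hs
  · refine Or.inl fun y hy => ?_
    rw [lineGap_eq s t g x y]
    have := mul_nonneg_of_nonpos_of_nonpos (sub_nonpos.2 hy) hs
    linarith
  · refine Or.inr fun y hy => ?_
    rw [lineGap_eq s t g x y]
    have := mul_nonneg (sub_nonneg.2 hy) hs
    linarith

theorem IsBelowAll.of_mem_Icc {s : ℝ} {𝒢 : Finset (ℝ × ℝ)} {t : ℝ × ℝ × ℝ} {x y z : ℝ}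
    (hx : IsBelowAll s 𝒢 t x) (hy : IsBelowAll s 𝒢 t y) (hxz : x ≤ z) (hzy : z ≤ y) :
    IsBelowAll s 𝒢 t z := by
  intro g hg
  by_contra! h
  rcases lineGap_nonneg_or h with h' | h'
  · exact absurd (hx g hg) (not_lt.2 (h' x hxz))
  · exact absurd (hy g hg) (not_lt.2 (h' y hzy))

theorem mem_halfPlane_iff_of_ne {t : ℝ × ℝ × ℝ} (ht : t.2.1 ≠ 0) (p : ℝ × ℝ) :
    p ∈ halfPlane t ↔ 0 ≤ t.2.1 * (p.2 - -(t.1 * p.1 + t.2.2) / t.2.1) := by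
  rw [mem_halfPlane]
  have : t.2.1 * (p.2 - -(t.1 * p.1 + t.2.2) / t.2.1) = t.1 * p.1 + t.2.1 * p.2 + t.2.2 := by
    field_simp; ring
  rw [this]

theorem not_separates_of_mul_pos {s : ℝ} {t : ℝ × ℝ × ℝ} (ht : t.2.1 ≠ 0) {p q : ℝ × ℝ}
    (h : 0 < (s * (p.2 - -(t.1 * p.1 + t.2.2) / t.2.1)) *
      (s * (q.2 - -(t.1 * q.1 + t.2.2) / t.2.1))) : ¬ Separates (halfPlane t) (p, q) := by
  rw [Separates, not_not]
  simp only [mem_halfPlane_iff_of_ne ht]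
  set u := p.2 - -(t.1 * p.1 + t.2.2) / t.2.1
  set v := q.2 - -(t.1 * q.1 + t.2.2) / t.2.1
  have huv : 0 < u * v := by
    by_contra! h'
    nlinarith [mul_nonneg (sq_nonneg s) (neg_nonneg.2 h')]
  rcases lt_or_gt_of_ne ht with hb | hb
  · rcases pos_and_pos_or_neg_and_neg_of_mul_pos huv with ⟨h1, h2⟩ | ⟨h1, h2⟩
    · exact iff_of_false (not_le.2 (mul_neg_of_neg_of_pos hb h1))
        (not_le.2 (mul_neg_of_neg_of_pos hb h2))
    · exact iff_of_true (mul_pos_of_neg_of_neg hb h1).le (mul_pos_of_neg_of_neg hb h2).le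
  · rcases pos_and_pos_or_neg_and_neg_of_mul_pos huv with ⟨h1, h2⟩ | ⟨h1, h2⟩
    · exact iff_of_true (mul_pos hb h1).le (mul_pos hb h2).le
    · exact iff_of_false (not_le.2 (mul_neg_of_pos_of_neg hb h1))
        (not_le.2 (mul_neg_of_pos_of_neg hb h2))

theorem not_separates_of_isBelowAll {s : ℝ} {𝒢 : Finset (ℝ × ℝ)} {t : ℝ × ℝ × ℝ} (ht : t.2.1 ≠ 0)
    {p q : ℝ × ℝ} (hp : IsBelowAll s 𝒢 t p.1) (hq : IsBelowAll s 𝒢 t q.1)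
    (hp' : ∃ g ∈ 𝒢, IsAbove s g p) (hq' : ∃ g ∈ 𝒢, IsAbove s g q) :
    ¬ Separates (halfPlane t) (p, q) := by
  obtain ⟨g, hg, hgp⟩ := hp'
  obtain ⟨k, hk, hkq⟩ := hq'
  have h1 := hp g hg
  have h2 := hq k hk
  rw [lineGap] at h1 h2
  rw [IsAbove] at hgp hkq
  refine not_separates_of_mul_pos (s := s) ht (mul_pos ?_ ?_) <;> rw [mul_sub] <;> linarith

theorem not_separates_of_lineGap_nonneg {s : ℝ} {t : ℝ × ℝ × ℝ} (ht : t.2.1 ≠ 0) {g p q : ℝ × ℝ}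
    (hp : 0 ≤ lineGap s t g p.1) (hq : 0 ≤ lineGap s t g q.1)
    (hp' : ¬ IsAbove s g p) (hq' : ¬ IsAbove s g q) : ¬ Separates (halfPlane t) (p, q) := by
  rw [lineGap] at hp hq
  rw [IsAbove, not_le] at hp' hq'
  refine not_separates_of_mul_pos (s := s) ht (mul_pos_of_neg_of_neg ?_ ?_) <;> rw [mul_sub] <;>
    linarith

theorem crossing_eq_zero {α : Type*} {h : Set α} {M : Multiset (α × α)}
    (hM : ∀ q ∈ M, ¬ Separates h q) : crossing h M = 0 :=
  Multiset.countP_eq_zero.2 hM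

open Finset in
theorem exists_median (X : Finset (ℝ × ℝ)) (hX : X.Nonempty) (m : ℕ) (hm : 0 < m)
    (hcard : X.card < 2 * m) :
    ∃ p ∈ X, (X.filter fun x => x.1 < p.1).card < m ∧ (X.filter fun x => p.1 < x.1).card < m := by
  obtain ⟨p₀, hp₀, hmin₀⟩ := exists_min_image X Prod.fst hX
  obtain ⟨p, hp, hmax⟩ := exists_max_image
    (X.filter fun q => (X.filter fun x => x.1 < q.1).card < m) Prod.fst
    ⟨p₀, mem_filter.2 ⟨hp₀, by
      rw [filter_eq_empty_iff.2 fun x hx => not_lt.2 (hmin₀ x hx)]; exact hm⟩⟩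
  rw [mem_filter] at hp
  refine ⟨p, hp.1, hp.2, ?_⟩
  rcases (X.filter fun x => p.1 < x.1).eq_empty_or_nonempty with h | h
  · rw [h]; exact hm
  obtain ⟨q, hq, hmin⟩ := exists_min_image _ Prod.fst h
  rw [mem_filter] at hq
  have h1 : m ≤ (X.filter fun x => x.1 < q.1).card := by
    by_contra! h'
    exact absurd (hmax q (mem_filter.2 ⟨hq.1, h'⟩)) (not_le.2 hq.2)
  have h2 : (X.filter fun x => p.1 < x.1) ⊆ X.filter fun x => ¬ x.1 < q.1 := by
    intro x hx
    exact mem_filter.2 ⟨(mem_filter.1 hx).1, not_lt.2 (hmin x hx)⟩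
  have h3 := card_filter_add_card_filter_not (s := X) fun x => x.1 < q.1
  have h4 := card_le_card h2
  omega

open Finset in
/-- Pairing a point set covered by shallow half-planes `IsAbove s g`, `g ∈ 𝒢`. -/
theorem exists_pairing_of_shallow (s : ℝ) (𝒢 : Finset (ℝ × ℝ)) (D : ℕ) (B : ℝ)
    (hB0 : 0 ≤ B) (hB : ∀ G : Finset (ℝ × ℝ), G.card ≤ D + 2 → ∃ M L, IsPairing M L G.val ∧
      L.card ≤ 1 ∧ ∀ t, (crossing (halfPlane t) M : ℝ) ≤ B) (N : ℕ) :
    ∀ X : Finset (ℝ × ℝ), X.card < 2 ^ N → (∀ p ∈ X, ∃ g ∈ 𝒢, IsAbove s g p) →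
    (∀ g ∈ 𝒢, ∀ Y ⊆ X, (∀ p ∈ Y, IsAbove s g p) → Y.card ≤ D) →
    ∃ M L, IsPairing M L X.val ∧ L.card ≤ 1 ∧ ∀ t : ℝ × ℝ × ℝ, t.2.1 ≠ 0 →
      (crossing (halfPlane t) M : ℝ) ≤ 2 * N * B ∧
      ((∃ e, IsBelowAll s 𝒢 t e ∧ ∀ p ∈ X, p.1 < e) → (crossing (halfPlane t) M : ℝ) ≤ N * B) ∧
      ((∃ e, IsBelowAll s 𝒢 t e ∧ ∀ p ∈ X, e < p.1) → (crossing (halfPlane t) M : ℝ) ≤ N * B) := by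
  classical
  induction N with
  | zero =>
    intro X hX _ _
    have : X = ∅ := card_eq_zero.1 (by simpa using hX)
    subst this
    exact ⟨0, 0, by simp [IsPairing], by simp, fun t _ => by simp [crossing_zero]⟩
  | succ N ih =>
    intro X hX hcov hD
    rcases X.eq_empty_or_nonempty with rfl | hne
    · refine ⟨0, 0, by simp [IsPairing], by simp, fun t _ => ?_⟩
      have : 0 ≤ ((N + 1 : ℕ) : ℝ) * B := by positivity
      simp only [crossing_zero, Nat.cast_zero]
      exact ⟨by linarith, fun _ => this, fun _ => this⟩
    obtain ⟨o, ho, hl, hr⟩ := exists_median X hne (2 ^ N) (by positivity)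
      (by rw [pow_succ] at hX; omega)
    obtain ⟨g₁, hg₁, _⟩ := hcov o ho
    obtain ⟨g, hg, hgmin⟩ := exists_min_image 𝒢 (fun k => k.1 * o.1 + k.2) ⟨g₁, hg₁⟩
    set A := X.filter fun p => IsAbove s g p with hA
    set K := X.filter fun p => ¬ IsAbove s g p with hK
    set Xl := K.filter fun p => p.1 < o.1 with hXl
    set Xr := K.filter fun p => ¬ p.1 < o.1 with hXr
    have hKX : K ⊆ X := filter_subset _ _
    have hlK : Xl ⊆ K := filter_subset _ _
    have hrK : Xr ⊆ K := filter_subset _ _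
    have hlo : ∀ p ∈ Xl, p.1 < o.1 := fun p hp => (mem_filter.1 hp).2
    have hna : ∀ p ∈ K, ¬ IsAbove s g p := fun p hp => (mem_filter.1 hp).2
    have hro : ∀ p ∈ Xr, o.1 < p.1 := by
      intro p hp
      refine lt_of_le_of_ne (not_lt.1 (mem_filter.1 hp).2) fun heq => hna p (hrK hp) ?_
      obtain ⟨k, hk, hkp⟩ := hcov p (hKX (hrK hp))
      have := hgmin k hk
      rw [IsAbove] at hkp ⊢
      rw [← heq] at hkp ⊢
      linarith
    obtain ⟨Ml, Ll, hMl, hLl, hcl⟩ := ih Xl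
      ((card_le_card (filter_subset_filter _ hKX)).trans_lt hl)
      (fun p hp => hcov p (hKX (hlK hp)))
      (fun k hk Y hY => hD k hk Y (hY.trans (hlK.trans hKX)))
    obtain ⟨Mr, Lr, hMr, hLr, hcr⟩ := ih Xr
      ((card_le_card fun p hp => mem_filter.2 ⟨hKX (hrK hp), hro p hp⟩).trans_lt hr)
      (fun p hp => hcov p (hKX (hrK hp)))
      (fun k hk Y hY => hD k hk Y (hY.trans (hrK.trans hKX)))
    have hpart : A.val + (Xl.val + Xr.val) = X.val := by
      have h1 : Xl.val + Xr.val = K.val := Multiset.filter_add_not _ _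
      have h2 : A.val + K.val = X.val := Multiset.filter_add_not _ _
      rw [h1, h2]
    have hle : A.val + (Ll + Lr) ≤ X.val := by
      rw [← hpart]
      exact add_le_add le_rfl (add_le_add hMl.le hMr.le)
    obtain ⟨Mg, Lg, hMg, hLg, hcg⟩ := hB ⟨A.val + (Ll + Lr), Multiset.nodup_of_le hle X.nodup⟩ (by
      have h1 : A.card ≤ D := hD g hg A (filter_subset _ _) fun p hp => (mem_filter.1 hp).2
      change (A.val + (Ll + Lr)).card ≤ D + 2
      rw [Multiset.card_add, Multiset.card_add]
      change A.card + _ ≤ _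
      omega)
    refine ⟨Ml + Mr + Mg, Lg, ?_, hLg, fun t ht => ?_⟩
    · refine IsPairing.trans (L := A.val + (Ll + Lr)) ?_ hMg
      have h0 : IsPairing 0 A.val A.val := by simp [IsPairing]
      have := h0.add (hMl.add hMr)
      rwa [zero_add, hpart] at this
    have hsum : (crossing (halfPlane t) (Ml + Mr + Mg) : ℝ) = crossing (halfPlane t) Ml +
        crossing (halfPlane t) Mr + crossing (halfPlane t) Mg := by
      rw [crossing_add, crossing_add]; push_cast; ring
    have hgt := hcg t
    obtain ⟨hl1, hl2, hl3⟩ := hcl t ht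
    obtain ⟨hr1, hr2, hr3⟩ := hcr t ht
    have hNB : 0 ≤ (N : ℝ) * B := by positivity
    have hl0 : (∀ y, y ≤ o.1 → 0 ≤ lineGap s t g y) → (crossing (halfPlane t) Ml : ℝ) = 0 := by
      intro h
      rw [crossing_eq_zero, Nat.cast_zero]
      intro q hq
      have hq1 := hMl.mem hq
      exact not_separates_of_lineGap_nonneg ht (h _ (hlo _ hq1.1).le) (h _ (hlo _ hq1.2).le)
        (hna _ (hlK hq1.1)) (hna _ (hlK hq1.2))
    have hr0 : (∀ y, o.1 ≤ y → 0 ≤ lineGap s t g y) → (crossing (halfPlane t) Mr : ℝ) = 0 := by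
      intro h
      rw [crossing_eq_zero, Nat.cast_zero]
      intro q hq
      have hq1 := hMr.mem hq
      exact not_separates_of_lineGap_nonneg ht (h _ (hro _ hq1.1).le) (h _ (hro _ hq1.2).le)
        (hna _ (hrK hq1.1)) (hna _ (hrK hq1.2))
    have hall : lineGap s t g o.1 < 0 → IsBelowAll s 𝒢 t o.1 := by
      intro h k hk
      have := hgmin k hk
      rw [lineGap] at h ⊢
      linarith
    have hbtw : ∀ {M : Multiset ((ℝ × ℝ) × ℝ × ℝ)} {L : Multiset (ℝ × ℝ)} {Y : Finset (ℝ × ℝ)}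
        {e e' : ℝ}, IsPairing M L Y.val → Y ⊆ X → IsBelowAll s 𝒢 t e → IsBelowAll s 𝒢 t e' →
        (∀ p ∈ Y, e < p.1) → (∀ p ∈ Y, p.1 < e') → (crossing (halfPlane t) M : ℝ) = 0 := by
      intro M L Y e e' hM hY he he' h1 h2
      rw [crossing_eq_zero, Nat.cast_zero]
      intro q hq
      have hq1 := hM.mem hq
      exact not_separates_of_isBelowAll ht (he.of_mem_Icc he' (h1 _ hq1.1).le (h2 _ hq1.1).le)
        (he.of_mem_Icc he' (h1 _ hq1.2).le (h2 _ hq1.2).le) (hcov _ (hY hq1.1)) (hcov _ (hY hq1.2))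
    push_cast
    rw [hsum]
    refine ⟨?_, ?_, ?_⟩
    · rcases lt_or_ge (lineGap s t g o.1) 0 with h | h
      · have h1 := hl2 ⟨_, hall h, hlo⟩
        have h2 := hr3 ⟨_, hall h, hro⟩
        linarith
      · rcases lineGap_nonneg_or h with h' | h'
        · have := hl0 h'
          linarith
        · have := hr0 h'
          linarith
    · rintro ⟨e, he, heX⟩
      rcases lt_or_ge (lineGap s t g o.1) 0 with h | h
      · have h1 := hl2 ⟨_, hall h, hlo⟩
        have h2 := hbtw hMr (hrK.trans hKX) (hall h) he hro
          fun p hp => heX p (hKX (hrK hp))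
        linarith
      · rcases lineGap_nonneg_or h with h' | h'
        · have h1 := hl0 h'
          have h2 := hr2 ⟨e, he, fun p hp => heX p (hKX (hrK hp))⟩
          linarith
        · exact absurd (he g hg) (not_lt.2 (h' e (heX o ho).le))
    · rintro ⟨e, he, heX⟩
      rcases lt_or_ge (lineGap s t g o.1) 0 with h | h
      · have h1 := hr3 ⟨_, hall h, hro⟩
        have h2 := hbtw hMl (hlK.trans hKX) he (hall h)
          (fun p hp => heX p (hKX (hlK hp))) hlo
        linarith
      · rcases lineGap_nonneg_or h with h' | h'
        · exact absurd (he g hg) (not_lt.2 (h' e (heX o ho).le))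
        · have h1 := hr0 h'
          have h2 := hl3 ⟨e, he, fun p hp => heX p (hKX (hlK hp))⟩
          linarith

/-- The number of points of `P` in `h`. -/
noncomputable def countIn {α : Type*} (P : Finset α) (h : Set α) : ℕ :=
  ((P : Set α) ∩ h).ncard

theorem countIn_eq_card_filter {α : Type*} (P : Finset α) (h : Set α)
    [DecidablePred (· ∈ h)] : countIn P h = (P.filter (· ∈ h)).card := by
  rw [countIn, ← Set.ncard_coe_finset]
  congr 1
  ext x
  simp

theorem card_le_countIn {α : Type*} {P Y : Finset α} {h : Set α} (hYP : Y ⊆ P)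
    (hY : ∀ p ∈ Y, p ∈ h) : Y.card ≤ countIn P h := by
  classical
  rw [countIn_eq_card_filter]
  exact Finset.card_le_card fun p hp => Finset.mem_filter.2 ⟨hYP hp, hY p hp⟩

theorem countIn_le_card {α : Type*} (P : Finset α) (h : Set α) : countIn P h ≤ P.card := by
  classical
  rw [countIn_eq_card_filter]
  exact Finset.card_le_card (Finset.filter_subset _ _)

theorem exists_isAbove_iff (t : ℝ × ℝ × ℝ) (ht : t.2.1 ≠ 0) : ∃ s : ℝ, (s = 1 ∨ s = -1) ∧
    ∃ g, ∀ p, p ∈ halfPlane t ↔ IsAbove s g p := by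
  rcases lt_or_gt_of_ne ht with hb | hb
  · refine ⟨-1, Or.inr rfl, (t.1 / t.2.1, t.2.2 / t.2.1), fun p => ?_⟩
    have hneg : ∀ u, 0 ≤ t.2.1 * u ↔ u ≤ 0 := fun u =>
      ⟨fun h => not_lt.1 fun h' => absurd h (not_le.2 (mul_neg_of_neg_of_pos hb h')),
        mul_nonneg_of_nonpos_of_nonpos hb.le⟩
    rw [mem_halfPlane_iff_of_ne ht, hneg, IsAbove]
    have : -(t.1 * p.1 + t.2.2) / t.2.1 = -(t.1 / t.2.1 * p.1 + t.2.2 / t.2.1) := by ring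
    rw [this]
    constructor <;> intro h <;> linarith
  · refine ⟨1, Or.inl rfl, (-t.1 / t.2.1, -t.2.2 / t.2.1), fun p => ?_⟩
    rw [mem_halfPlane_iff_of_ne ht, mul_nonneg_iff_of_pos_left hb, IsAbove]
    have : -(t.1 * p.1 + t.2.2) / t.2.1 = -t.1 / t.2.1 * p.1 + -t.2.2 / t.2.1 := by ring
    rw [this]
    constructor <;> intro h <;> linarith

/-- Some line with fewer than `m` points of `P` on its side `s` has `p` on that side. -/
def IsShallow (P : Finset (ℝ × ℝ)) (s : ℝ) (m : ℕ) (p : ℝ × ℝ) : Prop :=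
  ∃ g, IsAbove s g p ∧ countIn P {q | IsAbove s g q} < m

theorem IsShallow.mono {P : Finset (ℝ × ℝ)} {s : ℝ} {m m' : ℕ} {p : ℝ × ℝ}
    (h : IsShallow P s m p) (hm : m ≤ m') : IsShallow P s m' p :=
  h.imp fun _ hg => ⟨hg.1, hg.2.trans_le hm⟩

open Finset in
theorem exists_pairing_layer (P X : Finset (ℝ × ℝ)) (hXP : X ⊆ P) (s : ℝ) (j N : ℕ)
    (hN : P.card < 2 ^ N) (hX : ∀ p ∈ X, IsShallow P s (2 ^ (j + 1)) p) :
    ∃ M L, IsPairing M L X.val ∧ L.card ≤ 1 ∧ ∀ t : ℝ × ℝ × ℝ, t.2.1 ≠ 0 →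
      (crossing (halfPlane t) M : ℝ) ≤ 816 * N * √(2 ^ j) := by
  classical
  choose! g hg1 hg2 using hX
  obtain ⟨M, L, hM, hL, hc⟩ := exists_pairing_of_shallow s (X.image g) (2 ^ (j + 1))
    (408 * √(2 ^ j)) (by positivity) (fun G hG => by
      obtain ⟨M, L, hM, hL, hc⟩ := exists_pairing_crossing_le_sqrt G
      refine ⟨M, L, hM, hL, fun t => (hc t).trans ?_⟩
      have h1 : (G.card : ℝ) ≤ 2 ^ 2 * 2 ^ j := by
        have h2 : 1 ≤ 2 ^ j := Nat.one_le_two_pow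
        have : G.card ≤ 2 ^ 2 * 2 ^ j := by rw [pow_succ] at hG; omega
        exact_mod_cast this
      have h2 : √(G.card : ℝ) ≤ 2 * √(2 ^ j) := by
        refine (Real.sqrt_le_sqrt h1).trans_eq ?_
        rw [Real.sqrt_mul (by positivity), Real.sqrt_sq (by norm_num)]
      linarith) N X ((card_le_card hXP).trans_lt hN)
    (fun p hp => ⟨g p, mem_image_of_mem g hp, hg1 p hp⟩) (by
      intro k hk Y hY hYk
      obtain ⟨p, hp, rfl⟩ := mem_image.1 hk
      exact (card_le_countIn (hY.trans hXP) hYk).trans (hg2 p hp).le)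
  refine ⟨M, L, hM, hL, fun t ht => (hc t ht).1.trans_eq (by ring)⟩

open Finset in
open Classical in
/-- The points of `P` lying in a non-vertical half-plane with fewer than `2 ^ j` points. -/
noncomputable def shallowPart (P : Finset (ℝ × ℝ)) (j : ℕ) : Finset (ℝ × ℝ) :=
  P.filter fun p => IsShallow P 1 (2 ^ j) p ∨ IsShallow P (-1) (2 ^ j) p

theorem mem_shallowPart {P : Finset (ℝ × ℝ)} {j : ℕ} {p : ℝ × ℝ} : p ∈ shallowPart P j ↔
    p ∈ P ∧ (IsShallow P 1 (2 ^ j) p ∨ IsShallow P (-1) (2 ^ j) p) := by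
  simp [shallowPart]

theorem mem_shallowPart_of_mem_halfPlane {P : Finset (ℝ × ℝ)} {j : ℕ} {p : ℝ × ℝ}
    {t : ℝ × ℝ × ℝ} (ht : t.2.1 ≠ 0) (hp : p ∈ P) (hpt : p ∈ halfPlane t)
    (hcount : countIn P (halfPlane t) < 2 ^ j) : p ∈ shallowPart P j := by
  refine mem_shallowPart.2 ⟨hp, ?_⟩
  obtain ⟨s, hs, g, hg⟩ := exists_isAbove_iff t ht
  have h1 : IsShallow P s (2 ^ j) p := by
    refine ⟨g, (hg p).1 hpt, ?_⟩
    have : {q | IsAbove s g q} = halfPlane t := Set.ext fun q => (hg q).symm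
    rwa [this]
  rcases hs with rfl | rfl
  · exact Or.inl h1
  · exact Or.inr h1

theorem shallowPart_subset (P : Finset (ℝ × ℝ)) (j : ℕ) : shallowPart P j ⊆ P :=
  fun _ hp => (mem_shallowPart.1 hp).1

theorem shallowPart_zero (P : Finset (ℝ × ℝ)) : shallowPart P 0 = ∅ := by
  have h : ∀ s p, p ∈ P → ¬ IsShallow P s (2 ^ 0) p := by
    rintro s p hp ⟨g, hg, hc⟩
    have := card_le_countIn (P := P) (Y := {p}) (h := {q | IsAbove s g q})
      (Finset.singleton_subset_iff.2 hp) (by simpa using hg)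
    rw [Finset.card_singleton] at this
    omega
  refine Finset.eq_empty_of_forall_notMem fun p hp => ?_
  obtain ⟨h1, h2⟩ := mem_shallowPart.1 hp
  exact h2.elim (h 1 p h1) (h (-1) p h1)

theorem shallowPart_mono (P : Finset (ℝ × ℝ)) (j : ℕ) :
    shallowPart P j ⊆ shallowPart P (j + 1) := by
  intro p hp
  rw [mem_shallowPart] at hp ⊢
  have : 2 ^ j ≤ 2 ^ (j + 1) := Nat.pow_le_pow_right (by norm_num) (by omega)
  exact ⟨hp.1, hp.2.imp (fun h => h.mono this) fun h => h.mono this⟩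

theorem shallowPart_eq (P : Finset (ℝ × ℝ)) (j : ℕ) (hj : P.card < 2 ^ j) :
    shallowPart P j = P := by
  refine (shallowPart_subset P j).antisymm fun p hp => ?_
  refine mem_shallowPart_of_mem_halfPlane (t := (0, 1, -p.2)) (by norm_num) hp ?_
    ((countIn_le_card _ _).trans_lt hj)
  simp [mem_halfPlane]

open Finset in
theorem exists_pairing_shallowPart (P : Finset (ℝ × ℝ)) (N : ℕ) (hN : P.card < 2 ^ N) (j : ℕ) :
    ∃ M L, IsPairing M L (shallowPart P j).val ∧ L.card ≤ 2 * j ∧ ∀ t : ℝ × ℝ × ℝ, t.2.1 ≠ 0 →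
      (crossing (halfPlane t) M : ℝ) ≤
        4080 * N * √(min (2 ^ j) (2 * countIn P (halfPlane t))) := by
  classical
  induction j with
  | zero =>
    refine ⟨0, 0, by simp [IsPairing, shallowPart_zero], by simp, fun t _ => ?_⟩
    rw [crossing_zero, Nat.cast_zero]
    positivity
  | succ j ih =>
    obtain ⟨M, L, hM, hL, hc⟩ := ih
    set X := shallowPart P (j + 1) \ shallowPart P j with hX
    have hXP : X ⊆ P := sdiff_subset.trans (shallowPart_subset _ _)
    set X1 := X.filter fun p => IsShallow P 1 (2 ^ (j + 1)) p with hX1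
    set X2 := X.filter fun p => ¬ IsShallow P 1 (2 ^ (j + 1)) p with hX2
    have hX1X : X1 ⊆ X := filter_subset _ _
    have hX2X : X2 ⊆ X := filter_subset _ _
    obtain ⟨M1, L1, hM1, hL1, hc1⟩ := exists_pairing_layer P X1 (hX1X.trans hXP) 1 j N hN
      fun p hp => (mem_filter.1 hp).2
    obtain ⟨M2, L2, hM2, hL2, hc2⟩ := exists_pairing_layer P X2 (hX2X.trans hXP) (-1) j N hN (by
      intro p hp
      rw [hX2, mem_filter, hX, mem_sdiff, mem_shallowPart] at hp
      exact hp.1.1.2.resolve_left hp.2)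
    have hpart : (shallowPart P j).val + (X1.val + X2.val) = (shallowPart P (j + 1)).val := by
      have h1 : X1.val + X2.val = X.val := Multiset.filter_add_not _ _
      have h2 : Disjoint (shallowPart P j) X := disjoint_sdiff
      rw [h1, ← disjUnion_val _ _ h2, disjUnion_eq_union, hX,
        union_sdiff_of_subset (shallowPart_mono P j)]
    refine ⟨M + (M1 + M2), L + (L1 + L2), hpart ▸ hM.add (hM1.add hM2), ?_, fun t ht => ?_⟩
    · rw [Multiset.card_add, Multiset.card_add]; omega
    rw [crossing_add, crossing_add]
    push_cast
    have h0 := hc t ht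
    set k := countIn P (halfPlane t) with hk
    rcases lt_or_ge k (2 ^ j) with hkj | hkj
    · have hnot : ∀ p ∈ X, p ∉ halfPlane t := fun p hp hpt =>
        (mem_sdiff.1 hp).2 (mem_shallowPart_of_mem_halfPlane ht (hXP hp) hpt hkj)
      rw [crossing_eq_zero (M := M1) fun q hq => by
          have := hM1.mem hq
          simp [Separates, hnot _ (hX1X this.1), hnot _ (hX1X this.2)],
        crossing_eq_zero (M := M2) fun q hq => by
          have := hM2.mem hq
          simp [Separates, hnot _ (hX2X this.1), hnot _ (hX2X this.2)]]
      rw [Nat.cast_zero, add_zero, add_zero]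
      refine h0.trans (mul_le_mul_of_nonneg_left (Real.sqrt_le_sqrt ?_) (by positivity))
      exact min_le_min (pow_le_pow_right₀ (by norm_num) (by omega)) le_rfl
    · have hkj' : (2 : ℝ) ^ j ≤ k := by exact_mod_cast hkj
      have h2 : √(min (2 ^ (j + 1)) (2 * (k : ℝ))) = √2 * √(2 ^ j) := by
        rw [← Real.sqrt_mul (by norm_num), min_eq_left, pow_succ, mul_comm]
        rw [pow_succ]; linarith
      have h3 : √(min (2 ^ j) (2 * (k : ℝ))) ≤ √(2 ^ j) := Real.sqrt_le_sqrt (min_le_left _ _)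
      have h4 : (1.4 : ℝ) ≤ √2 := Real.le_sqrt_of_sq_le (by norm_num)
      have h5 := hc1 t ht
      have h6 := hc2 t ht
      have h7 : 4080 * (N : ℝ) * √(min (2 ^ j) (2 * (k : ℝ))) ≤ 4080 * N * √(2 ^ j) :=
        mul_le_mul_of_nonneg_left h3 (by positivity)
      have h8 : 1.4 * (N * √(2 ^ j)) ≤ √2 * (N * √(2 ^ j)) :=
        mul_le_mul_of_nonneg_right h4 (by positivity)
      rw [h2]
      linarith

theorem exists_pairing_multiset {α : Type*} (n : ℕ) : ∀ X : Multiset α, X.card = n →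
    ∃ M L, IsPairing M L X ∧ L.card ≤ 1 := by
  induction n using Nat.strong_induction_on with
  | _ n ih =>
  intro X hX
  by_cases h : n ≤ 1
  · exact ⟨0, X, by simp [IsPairing], hX ▸ h⟩
  obtain ⟨u, hu⟩ := Multiset.card_pos_iff_exists_mem.1 (show 0 < X.card by omega)
  obtain ⟨X', rfl⟩ := Multiset.exists_cons_of_mem hu
  rw [Multiset.card_cons] at hX
  obtain ⟨v, hv⟩ := Multiset.card_pos_iff_exists_mem.1 (show 0 < X'.card by omega)
  obtain ⟨X'', rfl⟩ := Multiset.exists_cons_of_mem hv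
  rw [Multiset.card_cons] at hX
  obtain ⟨M, L, hM, hL⟩ := ih (n - 2) (by omega) X'' (by omega)
  refine ⟨(u, v) ::ₘ M, L, ?_, hL⟩
  rw [IsPairing, ← hM]
  simp only [Multiset.map_cons, Multiset.cons_add, Multiset.add_cons]
  exact Multiset.cons_swap _ _ _

theorem IsPairing.card_eq {α : Type*} {M : Multiset (α × α)} {L X : Multiset α}
    (h : IsPairing M L X) : 2 * M.card + L.card = X.card := by
  rw [← h, Multiset.card_add, Multiset.card_add, Multiset.card_map, Multiset.card_map]
  ring

/-- A pairing of `P` crossed `O(√k log |P|)` times by every non-vertical half-plane with `k`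
points. -/
theorem exists_pairing_sensitive (P : Finset (ℝ × ℝ)) (hP : 2 ≤ P.card) :
    ∃ M L, IsPairing M L P.val ∧ L.card ≤ 1 ∧ ∀ t : ℝ × ℝ × ℝ, t.2.1 ≠ 0 →
      (crossing (halfPlane t) M : ℝ) ≤
        18000 * √(countIn P (halfPlane t)) * Real.log P.card := by
  set J := Nat.log 2 P.card + 1 with hJ
  have hPJ : P.card < 2 ^ J := Nat.lt_pow_succ_log_self (by norm_num) _
  obtain ⟨M, L, hM, hL, hc⟩ := exists_pairing_shallowPart P J hPJ J
  rw [shallowPart_eq P J hPJ] at hM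
  obtain ⟨M', L', hM', hL'⟩ := exists_pairing_multiset _ L rfl
  have hMM := hM.trans hM'
  refine ⟨M + M', L', hMM, hL', fun t ht => ?_⟩
  have hlog2 := Real.log_two_gt_d9
  have hlog : Real.log 2 ≤ Real.log P.card :=
    Real.log_le_log (by norm_num) (by exact_mod_cast hP)
  have hJlog : (J : ℝ) ≤ 3 * Real.log P.card := by
    have h1 : (2 : ℝ) ^ Nat.log 2 P.card ≤ P.card := by
      exact_mod_cast Nat.pow_log_le_self 2 (by omega)
    have h2 := Real.log_le_log (by positivity) h1
    rw [Real.log_pow] at h2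
    have h3 : (Nat.log 2 P.card : ℝ) * (2 / 3) ≤ Nat.log 2 P.card * Real.log 2 :=
      mul_le_mul_of_nonneg_left (by linarith) (Nat.cast_nonneg _)
    rw [hJ]
    push_cast
    linarith
  set k := countIn P (halfPlane t) with hk
  rcases Nat.eq_zero_or_pos k with hk0 | hk0
  · have hnot : ∀ p ∈ P, p ∉ halfPlane t := fun p hp hpt => by
      have := card_le_countIn (P := P) (Y := {p}) (h := halfPlane t)
        (Finset.singleton_subset_iff.2 hp) (by simpa using hpt)
      rw [Finset.card_singleton] at this
      omega
    rw [crossing_eq_zero fun q hq => by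
      have := hMM.mem hq
      simp [Separates, hnot _ this.1, hnot _ this.2]]
    rw [Nat.cast_zero]
    have : 0 ≤ Real.log P.card := by linarith
    positivity
  · have h1 := hc t ht
    have h2 : (crossing (halfPlane t) M' : ℝ) ≤ J := by
      have h3 : crossing (halfPlane t) M' ≤ M'.card := Multiset.countP_le_card _ _
      have h4 := hM'.card_eq
      exact_mod_cast (by omega : crossing (halfPlane t) M' ≤ J)
    have h5 : √(min (2 ^ J) (2 * (k : ℝ))) ≤ 1.45 * √k := by
      refine (Real.sqrt_le_sqrt (min_le_right _ _)).trans ?_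
      rw [Real.sqrt_mul (by norm_num)]
      refine mul_le_mul_of_nonneg_right ?_ (Real.sqrt_nonneg _)
      rw [Real.sqrt_le_left (by norm_num)]
      norm_num
    have h6 : 1 ≤ √(k : ℝ) := Real.one_le_sqrt.2 (by exact_mod_cast hk0)
    rw [crossing_add]
    push_cast
    have h7 : 4080 * (J : ℝ) * √(min (2 ^ J) (2 * (k : ℝ))) ≤ 4080 * J * (1.45 * √k) :=
      mul_le_mul_of_nonneg_left h5 (by positivity)
    have h8 : (J : ℝ) * 1 ≤ J * √k := mul_le_mul_of_nonneg_left h6 (by positivity)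
    have h9 : (J : ℝ) * √k ≤ 3 * Real.log P.card * √k :=
      mul_le_mul_of_nonneg_right hJlog (Real.sqrt_nonneg _)
    linarith

/-- The number of elements of `A` in `h`, with multiplicity, as a real number. -/
noncomputable def mass {α : Type*} (h : Set α) (A : Multiset α) : ℝ :=
  (A.map (h.indicator 1)).sum

theorem mass_add {α : Type*} (h : Set α) (A B : Multiset α) :
    mass h (A + B) = mass h A + mass h B := by simp [mass]

theorem mass_cons {α : Type*} (h : Set α) (x : α) (A : Multiset α) :
    mass h (x ::ₘ A) = h.indicator 1 x + mass h A := by simp [mass]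

theorem mass_val {α : Type*} (h : Set α) (P : Finset α) : mass h P.val = countIn P h := by
  classical
  rw [countIn_eq_card_filter, mass]
  change ∑ x ∈ P, h.indicator 1 x = _
  rw [Finset.card_filter, Nat.cast_sum]
  refine Finset.sum_congr rfl fun x _ => ?_
  by_cases hx : x ∈ h <;> simp [hx]

theorem mass_nonneg {α : Type*} (h : Set α) (A : Multiset α) : 0 ≤ mass h A := by
  refine Multiset.sum_nonneg fun x hx => ?_
  obtain ⟨y, _, rfl⟩ := Multiset.mem_map.1 hx
  exact Set.indicator_nonneg (fun _ _ => zero_le_one) _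

theorem mass_le_card {α : Type*} (h : Set α) (A : Multiset α) : mass h A ≤ A.card := by
  induction A using Multiset.induction_on with
  | empty => simp [mass]
  | cons x A ih =>
    rw [mass_cons, Multiset.card_cons]
    have : h.indicator (1 : α → ℝ) x ≤ 1 := Set.indicator_le_self' (fun _ _ => zero_le_one) x
    push_cast
    linarith

theorem exp_add_mul_exp_le (l d : ℝ) {e : ℝ} (hd : d ^ 2 = e) :
    Real.exp (l * d) + Real.exp (-(l * d)) ≤ 2 * Real.exp (l ^ 2 / 2 * e) := by
  have h := Real.cosh_le_exp_half_sq (l * d)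
  rw [Real.cosh_eq] at h
  have : (l * d) ^ 2 / 2 = l ^ 2 / 2 * e := by rw [← hd]; ring
  rw [this] at h
  linarith

/-- Choosing one point from every pair so that all ranges have small discrepancy. -/
theorem exists_choice_sum_exp_le {α ι : Type*} [Fintype ι] (R : ι → Set α) (l : ι → ℝ)
    (M : Multiset (α × α)) : ∀ u : ι → ℝ, (∀ i, 0 ≤ u i) → ∃ A A' : Multiset α,
      A + A' = M.map Prod.fst + M.map Prod.snd ∧ A.card = M.card ∧
      ∑ i, u i * Real.exp (l i * (mass (R i) A - mass (R i) A')) ≤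
        ∑ i, u i * Real.exp (l i ^ 2 / 2 * crossing (R i) M) := by
  induction M using Multiset.induction_on with
  | empty =>
    intro u _
    exact ⟨0, 0, by simp, by simp, by simp [crossing_zero, mass]⟩
  | cons q M ih =>
    intro u hu
    set e : ι → ℝ := fun i => if Separates (R i) q then 1 else 0 with he
    obtain ⟨A, A', hAA, hA, hsum⟩ := ih (fun i => u i * Real.exp (l i ^ 2 / 2 * e i))
      fun i => mul_nonneg (hu i) (Real.exp_pos _).le
    set d : ι → ℝ := fun i => (R i).indicator 1 q.1 - (R i).indicator 1 q.2 with hd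
    have hde : ∀ i, d i ^ 2 = e i := by
      intro i
      by_cases h1 : q.1 ∈ R i <;> by_cases h2 : q.2 ∈ R i <;> simp [hd, he, Separates, h1, h2]
    set D : ι → ℝ := fun i => mass (R i) A - mass (R i) A' with hD
    have hrhs : ∑ i, u i * Real.exp (l i ^ 2 / 2 * e i) *
        Real.exp (l i ^ 2 / 2 * crossing (R i) M) =
        ∑ i, u i * Real.exp (l i ^ 2 / 2 * crossing (R i) (q ::ₘ M)) := by
      refine Finset.sum_congr rfl fun i _ => ?_
      rw [crossing_cons, mul_assoc, ← Real.exp_add]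
      congr 2
      simp only [he]
      push_cast
      ring
    rw [hrhs] at hsum
    have havg : ∑ i, u i * Real.exp (l i * (D i + d i)) + ∑ i, u i * Real.exp (l i * (D i - d i)) ≤
        2 * ∑ i, u i * Real.exp (l i ^ 2 / 2 * crossing (R i) (q ::ₘ M)) := by
      refine le_trans ?_ (mul_le_mul_of_nonneg_left hsum zero_le_two)
      rw [← Finset.sum_add_distrib, Finset.mul_sum]
      refine Finset.sum_le_sum fun i _ => ?_
      have h1 := exp_add_mul_exp_le (l i) (d i) (hde i)
      have h2 := mul_le_mul_of_nonneg_left h1 (mul_nonneg (hu i) (Real.exp_pos (l i * D i)).le)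
      have e1 : Real.exp (l i * (D i + d i)) = Real.exp (l i * D i) * Real.exp (l i * d i) := by
        rw [← Real.exp_add]; ring_nf
      have e2 : Real.exp (l i * (D i - d i)) = Real.exp (l i * D i) * Real.exp (-(l i * d i)) := by
        rw [← Real.exp_add]; ring_nf
      rw [e1, e2]
      linarith
    by_cases hcase : ∑ i, u i * Real.exp (l i * (D i + d i)) ≤
        ∑ i, u i * Real.exp (l i ^ 2 / 2 * crossing (R i) (q ::ₘ M))
    · refine ⟨q.1 ::ₘ A, q.2 ::ₘ A', ?_, by simp [hA], ?_⟩
      · simp only [Multiset.map_cons, Multiset.cons_add, Multiset.add_cons, hAA]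
      · refine le_of_eq_of_le (Finset.sum_congr rfl fun i _ => ?_) hcase
        rw [mass_cons, mass_cons]
        simp only [hD, hd]
        ring_nf
    · refine ⟨q.2 ::ₘ A, q.1 ::ₘ A', ?_, by simp [hA], ?_⟩
      · simp only [Multiset.map_cons, Multiset.cons_add, Multiset.add_cons, hAA]
        exact Multiset.cons_swap _ _ _
      · refine le_trans (le_of_eq (Finset.sum_congr rfl fun i _ => ?_))
          (show ∑ i, u i * Real.exp (l i * (D i - d i)) ≤ _ by linarith)
        rw [mass_cons, mass_cons]
        simp only [hD, hd]
        ring_nf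

/-- On a finite set every half-plane agrees with a non-vertical one. -/
theorem exists_nonvertical (P : Finset (ℝ × ℝ)) (t : ℝ × ℝ × ℝ) :
    ∃ t' : ℝ × ℝ × ℝ, t'.2.1 ≠ 0 ∧ ∀ x ∈ P, x ∈ halfPlane t ↔ x ∈ halfPlane t' := by
  by_cases ht : t.2.1 = 0
  swap
  · exact ⟨t, ht, fun _ _ => Iff.rfl⟩
  obtain ⟨y₀, hy₀⟩ := (P.image Prod.snd).bddBelow
  have hev : ∀ x ∈ P, ∀ᶠ η in nhdsWithin (0 : ℝ) (Set.Ioi 0),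
      t.1 * x.1 + t.2.2 < 0 → t.1 * x.1 + t.2.2 + η * (x.2 - y₀) < 0 := by
    intro x _
    by_cases hx : t.1 * x.1 + t.2.2 < 0
    · have hcont : Continuous fun η : ℝ => t.1 * x.1 + t.2.2 + η * (x.2 - y₀) := by fun_prop
      have h0 := hcont.continuousAt.eventually_lt (x₀ := 0) (g := fun _ => (0 : ℝ)) continuousAt_const
        (by simpa using hx)
      exact (h0.filter_mono nhdsWithin_le_nhds).mono fun η h _ => h
    · exact Filter.Eventually.of_forall fun η h => absurd h hx
  obtain ⟨η, hη, hη0⟩ := (((Filter.eventually_all_finset P).2 hev).and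
    self_mem_nhdsWithin).exists
  have hη0 : 0 < η := hη0
  refine ⟨(t.1, η, t.2.2 - η * y₀), hη0.ne', fun x hx => ?_⟩
  rw [mem_halfPlane, mem_halfPlane, ht]
  have h1 : t.1 * x.1 + η * x.2 + (t.2.2 - η * y₀) = t.1 * x.1 + t.2.2 + η * (x.2 - y₀) := by ring
  have h2 : 0 ≤ x.2 - y₀ := sub_nonneg.2 (hy₀ (by
    rw [Finset.coe_image]; exact Set.mem_image_of_mem _ hx))
  simp only [h1, zero_mul, add_zero]
  constructor
  · intro h
    have := mul_nonneg hη0.le h2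
    linarith
  · intro h
    by_contra! h'
    exact absurd (hη x hx h') (not_lt.2 h)

theorem countIn_congr {α : Type*} {P Q : Finset α} {h h' : Set α} (hQ : Q ⊆ P)
    (hh : ∀ x ∈ P, x ∈ h ↔ x ∈ h') : countIn Q h = countIn Q h' := by
  classical
  rw [countIn_eq_card_filter, countIn_eq_card_filter]
  exact congrArg _ (Finset.filter_congr fun x hx => hh x (hQ hx))

theorem le_sqrt_of_exp_le {x K m : ℝ} (hK : 0 < K) (hm : 1 < m)
    (h : Real.exp (√(2 * Real.log m / K) * x) ≤
      m * Real.exp (√(2 * Real.log m / K) ^ 2 / 2 * K)) : x ≤ √(2 * K * Real.log m) := by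
  have hlog : 0 < Real.log m := Real.log_pos hm
  have h1 := Real.log_le_log (Real.exp_pos _) h
  rw [Real.log_exp, Real.log_mul (by positivity) (Real.exp_pos _).ne', Real.log_exp,
    Real.sq_sqrt (by positivity)] at h1
  have h2 : Real.log m + 2 * Real.log m / K / 2 * K =
      √(2 * Real.log m / K) * √(2 * K * Real.log m) := by
    rw [← Real.sqrt_mul (by positivity)]
    have : 2 * Real.log m / K * (2 * K * Real.log m) = (2 * Real.log m) ^ 2 := by
      field_simp
    rw [this, Real.sqrt_sq (by positivity)]
    field_simp; ring
  rw [h2] at h1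
  exact le_of_mul_le_mul_left h1 (Real.sqrt_pos.2 (by positivity))

theorem log_traces_le {n m : ℕ} (hn : 2 ≤ n) (hm : m ≤ (n + 1) ^ 3) (hm0 : 0 < m) :
    Real.log (2 * m) ≤ 7 * Real.log n := by
  have hn' : (2 : ℝ) ≤ n := by exact_mod_cast hn
  have h1 : (2 : ℝ) * m ≤ n ^ 7 := by
    have h2 : n + 1 ≤ n ^ 2 := by nlinarith
    have h3 : 2 * m ≤ n ^ 7 := by
      calc 2 * m ≤ n * (n ^ 2) ^ 3 :=
            Nat.mul_le_mul hn (hm.trans (Nat.pow_le_pow_left h2 3))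
        _ = n ^ 7 := by ring
    exact_mod_cast h3
  have h4 := Real.log_le_log (by positivity) h1
  rwa [Real.log_pow] at h4

open Finset in
/-- A colouring of `P` with discrepancy `O(k^{1/4} log |P|)` for half-planes with `k` points. -/
theorem exists_balanced_choice (P : Finset (ℝ × ℝ)) (hP : 2 ≤ P.card) :
    ∃ A A' L : Multiset (ℝ × ℝ), A + A' + L = P.val ∧ A.card = P.card / 2 ∧ L.card ≤ 1 ∧ ∀ t,
      |mass (halfPlane t) A - mass (halfPlane t) A'| ≤
        502 * √√(countIn P (halfPlane t)) * Real.log P.card := by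
  classical
  obtain ⟨M, L, hML, hL, hc⟩ := exists_pairing_sensitive P hP
  obtain ⟨F, hF, hFt⟩ := exists_finset_traces P
  choose g hg0 hg using exists_nonvertical P
  have hlog : 0 < Real.log P.card := Real.log_pos (by exact_mod_cast hP)
  set K : ℝ × ℝ × ℝ → ℝ := fun f =>
    18000 * √(countIn P (halfPlane (g f))) * Real.log P.card with hK
  have hK0 : ∀ f, 0 ≤ K f := fun f => by simp only [hK]; positivity
  set m := F.card with hm
  have hm0 : 0 < m := card_pos.2 (by obtain ⟨f, hf, _⟩ := hFt 0; exact ⟨f, hf⟩)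
  set l : F × Bool → ℝ := fun i =>
    (if i.2 then 1 else -1) * √(2 * Real.log (2 * m) / K i.1) with hl
  have hl2 : ∀ i, l i ^ 2 = √(2 * Real.log (2 * m) / K i.1) ^ 2 := by
    rintro ⟨f, b⟩
    cases b <;> simp [hl]
  obtain ⟨A, A', hAA, hA, hsum⟩ := exists_choice_sum_exp_le
    (fun i : F × Bool => halfPlane (g i.1)) l M
    (fun i => Real.exp (-(l i ^ 2 / 2 * K i.1))) fun i => (Real.exp_pos _).le
  have hrhs : ∑ i : F × Bool, Real.exp (-(l i ^ 2 / 2 * K i.1)) *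
      Real.exp (l i ^ 2 / 2 * crossing (halfPlane (g i.1)) M) ≤ 2 * m := by
    have h1 : ∀ i ∈ (univ : Finset (F × Bool)), Real.exp (-(l i ^ 2 / 2 * K i.1)) *
        Real.exp (l i ^ 2 / 2 * crossing (halfPlane (g i.1)) M) ≤ 1 := by
      intro i _
      rw [← Real.exp_add, Real.exp_le_one_iff]
      have := mul_le_mul_of_nonneg_left (hc (g i.1) (hg0 _)) (show 0 ≤ l i ^ 2 / 2 by positivity)
      simp only [hK]
      linarith
    have h2 := sum_le_card_nsmul _ _ _ h1
    rw [card_univ, Fintype.card_prod, Fintype.card_coe, Fintype.card_bool, nsmul_eq_mul,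
      mul_one] at h2
    refine h2.trans_eq ?_
    push_cast
    ring
  have hall := hsum.trans hrhs
  have hterm : ∀ i : F × Bool, Real.exp (l i * (mass (halfPlane (g i.1)) A -
      mass (halfPlane (g i.1)) A')) ≤ 2 * m * Real.exp (l i ^ 2 / 2 * K i.1) := by
    intro i
    have h1 := (single_le_sum (f := fun i : F × Bool => Real.exp (-(l i ^ 2 / 2 * K i.1)) *
      Real.exp (l i * (mass (halfPlane (g i.1)) A - mass (halfPlane (g i.1)) A')))
      (fun _ _ => by positivity) (mem_univ i)).trans hall
    rw [Real.exp_neg, inv_mul_le_iff₀ (Real.exp_pos _)] at h1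
    linarith
  have hpart : A + A' + L = P.val := by rw [hAA]; exact hML
  have hmem : ∀ x ∈ A + A', x ∈ P := fun x hx => by
    rw [← mem_val, ← hpart]
    exact Multiset.mem_add.2 (Or.inl hx)
  have hmass : ∀ t t' : ℝ × ℝ × ℝ, (∀ x ∈ P, x ∈ halfPlane t ↔ x ∈ halfPlane t') →
      ∀ B : Multiset (ℝ × ℝ), (∀ x ∈ B, x ∈ P) → mass (halfPlane t) B = mass (halfPlane t') B := by
    intro t t' h B hB
    rw [mass, mass]
    congr 1
    refine Multiset.map_congr rfl fun x hx => ?_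
    by_cases h1 : x ∈ halfPlane t
    · rw [Set.indicator_of_mem h1, Set.indicator_of_mem ((h x (hB x hx)).1 h1)]
    · rw [Set.indicator_of_notMem h1, Set.indicator_of_notMem fun h2 => h1 ((h x (hB x hx)).2 h2)]
  refine ⟨A, A', L, hpart, ?_, hL, fun t => ?_⟩
  · have h1 := hML.card_eq
    rw [card_val] at h1
    omega
  obtain ⟨f, hf, htf⟩ := hFt t
  have htg : ∀ x ∈ P, x ∈ halfPlane t ↔ x ∈ halfPlane (g f) := fun x hx =>
    (htf x hx).trans (hg f x hx)
  rw [hmass t (g f) htg A fun x hx => hmem x (Multiset.mem_add.2 (Or.inl hx)),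
    hmass t (g f) htg A' fun x hx => hmem x (Multiset.mem_add.2 (Or.inr hx)),
    countIn_congr Subset.rfl htg]
  rcases Nat.eq_zero_or_pos (countIn P (halfPlane (g f))) with hk | hk
  · have h1 : mass (halfPlane (g f)) A + mass (halfPlane (g f)) A' + mass (halfPlane (g f)) L = 0 := by
      rw [← mass_add, ← mass_add, hpart, mass_val, hk, Nat.cast_zero]
    have h2 := mass_nonneg (halfPlane (g f)) A
    have h3 := mass_nonneg (halfPlane (g f)) A'
    have h4 := mass_nonneg (halfPlane (g f)) L
    have h5 : mass (halfPlane (g f)) A = 0 := by linarith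
    have h6 : mass (halfPlane (g f)) A' = 0 := by linarith
    rw [h5, h6, sub_zero, abs_zero]
    positivity
  · have hKf : 0 < K f := by
      have : 0 < √(countIn P (halfPlane (g f)) : ℝ) := Real.sqrt_pos.2 (by exact_mod_cast hk)
      simp only [hK]
      positivity
    have h2m : (1 : ℝ) < 2 * m := by
      have : (1 : ℝ) ≤ m := by exact_mod_cast hm0
      linarith
    have hbound : √(2 * K f * Real.log (2 * m)) ≤
        502 * √√(countIn P (halfPlane (g f))) * Real.log P.card := by
      rw [Real.sqrt_le_left (by positivity), mul_pow, mul_pow, Real.sq_sqrt (Real.sqrt_nonneg _)]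
      have h1 := log_traces_le hP hF hm0
      have h2 := mul_le_mul_of_nonneg_left h1 (show 0 ≤ 2 * K f by linarith)
      refine h2.trans ?_
      have h3 : 0 ≤ √(countIn P (halfPlane (g f)) : ℝ) * Real.log P.card ^ 2 := by positivity
      simp only [hK]
      nlinarith
    rw [abs_le]
    constructor
    · have h1 := hterm (⟨f, hf⟩, false)
      rw [hl2] at h1
      simp only [hl] at h1
      have h2 := le_sqrt_of_exp_le (x := mass (halfPlane (g f)) A' - mass (halfPlane (g f)) A)
        hKf h2m (by
          refine le_of_eq_of_le ?_ h1
          congr 1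
          simp
          ring)
      linarith
    · have h1 := hterm (⟨f, hf⟩, true)
      rw [hl2] at h1
      simp only [hl] at h1
      have h2 := le_sqrt_of_exp_le (x := mass (halfPlane (g f)) A - mass (halfPlane (g f)) A')
        hKf h2m (by
          refine le_of_eq_of_le ?_ h1
          congr 1
          simp)
      linarith

/-- Halving a point set, with relative error for half-planes. -/
theorem exists_halving (P : Finset (ℝ × ℝ)) (hP : 2 ≤ P.card) :
    ∃ Q ⊆ P, Q.card = P.card / 2 ∧ ∀ t,
      |(countIn Q (halfPlane t) : ℝ) / Q.card - countIn P (halfPlane t) / P.card| ≤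
        1012 * √√(countIn P (halfPlane t)) * Real.log P.card / P.card := by
  obtain ⟨A, A', L, hpart, hA, hL, hD⟩ := exists_balanced_choice P hP
  have hle : A ≤ P.val := by
    rw [← hpart, add_assoc]; exact Multiset.le_add_right _ _
  refine ⟨⟨A, Multiset.nodup_of_le hle P.nodup⟩, Finset.val_le_iff.1 hle, hA, fun t => ?_⟩
  set Q : Finset (ℝ × ℝ) := ⟨A, Multiset.nodup_of_le hle P.nodup⟩ with hQ
  have hQA : Q.val = A := rfl
  have hQc : Q.card = P.card / 2 := hA
  set k := countIn P (halfPlane t) with hk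
  set a := countIn Q (halfPlane t) with ha
  have hlog : Real.log 2 ≤ Real.log P.card :=
    Real.log_le_log (by norm_num) (by exact_mod_cast hP)
  have hlog2 := Real.log_two_gt_d9
  have hak : a ≤ k := by
    classical
    rw [ha, hk, countIn_eq_card_filter, countIn_eq_card_filter]
    exact Finset.card_le_card (Finset.filter_subset_filter _ (Finset.val_le_iff.1 hle))
  rcases Nat.eq_zero_or_pos k with hk0 | hk0
  · have ha0 : a = 0 := by omega
    rw [ha0, hk0]
    simp
  have hd := hD t
  rw [← hk] at hd
  have hmA : mass (halfPlane t) A = a := by rw [← hQA, mass_val]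
  have hsum : mass (halfPlane t) A + mass (halfPlane t) A' + mass (halfPlane t) L = k := by
    rw [← mass_add, ← mass_add, hpart, mass_val]
  rw [hmA] at hd hsum
  have hL0 := mass_nonneg (halfPlane t) L
  have hL1 : mass (halfPlane t) L ≤ 1 :=
    (mass_le_card _ _).trans (by exact_mod_cast hL)
  have hkn : (k : ℝ) ≤ P.card := by exact_mod_cast countIn_le_card P (halfPlane t)
  have hn : (2 : ℝ) ≤ P.card := by exact_mod_cast hP
  have hq1 : 2 * (Q.card : ℝ) ≤ P.card := by exact_mod_cast (by omega : 2 * Q.card ≤ P.card)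
  have hq2 : (P.card : ℝ) ≤ 2 * Q.card + 1 := by exact_mod_cast (by omega : P.card ≤ 2 * Q.card + 1)
  have hq3 : (P.card : ℝ) ≤ 3 * Q.card := by exact_mod_cast (by omega : P.card ≤ 3 * Q.card)
  have hq4 : (1 : ℝ) ≤ Q.card := by exact_mod_cast (by omega : 1 ≤ Q.card)
  set n := (P.card : ℝ)
  set q := (Q.card : ℝ)
  have hs1 : 1 ≤ √√(k : ℝ) :=
    Real.one_le_sqrt.2 (Real.one_le_sqrt.2 (by exact_mod_cast hk0))
  set σ := √√(k : ℝ)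
  have hσ : (2 : ℝ) / 3 ≤ σ * Real.log n := by nlinarith
  have hn0 : 0 < n := by linarith
  have hq0 : 0 < q := by linarith
  set E := 502 * σ * Real.log n + 2 with hE
  have hkey : |a * n - k * q| ≤ E * n / 2 := by
    rw [abs_le] at hd ⊢
    have h1 : a * n - k * q = (2 * a - k) * (n / 2) + k * (n - 2 * q) / 2 := by ring
    have h2 : 2 * a - k ≤ E - 1 := by linarith
    have h3 : -(E - 1) ≤ 2 * a - k := by linarith
    have h4 := mul_le_mul_of_nonneg_right h2 (show 0 ≤ n / 2 by linarith)
    have h5 := mul_le_mul_of_nonneg_right h3 (show 0 ≤ n / 2 by linarith)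
    have hk1 : (0 : ℝ) ≤ k := Nat.cast_nonneg _
    have h6 : (k : ℝ) * (n - 2 * q) ≤ k * 1 := mul_le_mul_of_nonneg_left (by linarith) hk1
    have h7 : 0 ≤ (k : ℝ) * (n - 2 * q) := mul_nonneg hk1 (by linarith)
    constructor <;> linarith
  have h1 : (a : ℝ) / q - k / n = (a * n - k * q) / (q * n) := by field_simp
  rw [h1, abs_div, abs_of_pos (mul_pos hq0 hn0), div_le_div_iff₀ (mul_pos hq0 hn0) hn0]
  have h2 : E * n / 2 ≤ 1012 * σ * Real.log n * q := by
    have : E * n ≤ E * (3 * q) := mul_le_mul_of_nonneg_left hq3 (by rw [hE]; linarith)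
    have h3 : E * 3 ≤ 1012 * σ * Real.log n * 2 := by rw [hE]; linarith
    nlinarith
  nlinarith

/-- Repeated halving down to size `T`. -/
theorem exists_approx_of_step (P : Finset (ℝ × ℝ)) (T ε p : ℝ) (hT : 3 ≤ T) (hε0 : 0 < ε)
    (hε1 : ε < 1) (hp : 0 < p) (hPT : T ≤ P.card)
    (hstep : ∀ q y : ℝ, T ≤ q → p ≤ y →
      1012 * √√(2 * q * y) * Real.log q / q ≤ ε * y / 5 * √(T / q)) :
    ∃ Z ⊆ P, Z.Nonempty ∧ (Z.card : ℝ) ≤ T ∧ ∀ t y, p ≤ y →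
      (countIn P (halfPlane t) : ℝ) / P.card ≤ y →
      |(countIn Z (halfPlane t) : ℝ) / Z.card - countIn P (halfPlane t) / P.card| ≤ ε * y := by
  have hmain : ∀ m : ℕ, ∀ Q ⊆ P, Q.card = m → T / 3 ≤ m → (∀ t y, p ≤ y →
      (countIn P (halfPlane t) : ℝ) / P.card ≤ y →
      |(countIn Q (halfPlane t) : ℝ) / Q.card - countIn P (halfPlane t) / P.card| ≤
        ε * y / 2 * √(T / m)) →
      ∃ Z ⊆ P, Z.Nonempty ∧ (Z.card : ℝ) ≤ T ∧ ∀ t y, p ≤ y →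
        (countIn P (halfPlane t) : ℝ) / P.card ≤ y →
        |(countIn Z (halfPlane t) : ℝ) / Z.card - countIn P (halfPlane t) / P.card| ≤ ε * y := by
    intro m
    induction m using Nat.strong_induction_on with
    | _ m ih =>
    intro Q hQP hQm hTm hgood
    have hm0 : (0 : ℝ) < m := by linarith
    by_cases hmT : (m : ℝ) ≤ T
    · refine ⟨Q, hQP, Finset.card_pos.1 (by rw [hQm]; exact_mod_cast hm0), by rwa [hQm],
        fun t y hy hPy => (hgood t y hy hPy).trans ?_⟩
      have h1 : √(T / m) ≤ 2 := by
        rw [Real.sqrt_le_left (by norm_num), div_le_iff₀ hm0]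
        linarith
      have : 0 < ε * y := mul_pos hε0 (hp.trans_le hy)
      nlinarith
    push Not at hmT
    have hm3 : 3 < m := by exact_mod_cast hT.trans_lt hmT
    obtain ⟨Q', hQ'Q, hQ'c, hQ'⟩ := exists_halving Q (by omega)
    rw [hQm] at hQ'c
    have hm1 : (m : ℝ) ≤ 3 * (m / 2 : ℕ) := by exact_mod_cast (by omega : m ≤ 3 * (m / 2))
    have hm2 : 2 * ((m / 2 : ℕ) : ℝ) ≤ m := by exact_mod_cast (by omega : 2 * (m / 2) ≤ m)
    refine ih (m / 2) (by omega) Q' (hQ'Q.trans hQP) hQ'c (by linarith) fun t y hy hPy => ?_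
    have hy0 : 0 < y := hp.trans_le hy
    have hεy : 0 < ε * y := mul_pos hε0 hy0
    have h1 := hgood t y hy hPy
    have h2 := hQ' t
    have hs1 : √(T / m) ≤ 1 := by
      rw [Real.sqrt_le_left (by norm_num), div_le_iff₀ hm0]
      linarith
    have hxQ : (countIn Q (halfPlane t) : ℝ) ≤ 2 * m * y := by
      have h3 := (abs_le.1 h1).2
      have h4 : ε * y / 2 * √(T / m) ≤ ε * y / 2 * 1 := mul_le_mul_of_nonneg_left hs1 (by positivity)
      have h5 : ε * y ≤ 1 * y := mul_le_mul_of_nonneg_right hε1.le hy0.le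
      have h6 : (countIn Q (halfPlane t) : ℝ) / Q.card ≤ 2 * y := by linarith
      rw [hQm, div_le_iff₀ hm0] at h6
      linarith
    have h3 := hstep m y hmT.le hy
    have hlog : 0 ≤ Real.log m := Real.log_natCast_nonneg m
    rw [hQm] at h2
    have h4 : 1012 * √√(countIn Q (halfPlane t) : ℝ) * Real.log m / m ≤
        1012 * √√(2 * m * y) * Real.log m / m := by gcongr
    have h5 : 1.4 * √(T / m) ≤ √(T / (m / 2 : ℕ)) := by
      have hm20 : (0 : ℝ) < (m / 2 : ℕ) := by linarith
      have h6 : 2 * (T / m) ≤ T / (m / 2 : ℕ) := by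
        rw [← mul_div_assoc, div_le_div_iff₀ hm0 hm20]
        nlinarith
      have h7 : (1.4 : ℝ) ≤ √2 := Real.le_sqrt_of_sq_le (by norm_num)
      calc 1.4 * √(T / m) ≤ √2 * √(T / m) := by gcongr
        _ = √(2 * (T / m)) := (Real.sqrt_mul (by norm_num) _).symm
        _ ≤ _ := Real.sqrt_le_sqrt h6
    have h6 : ε * y / 2 * (1.4 * √(T / m)) ≤ ε * y / 2 * √(T / (m / 2 : ℕ)) :=
      mul_le_mul_of_nonneg_left h5 (by positivity)
    rw [hQm] at h1
    have h7 := abs_sub_le ((countIn Q' (halfPlane t) : ℝ) / Q'.card)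
      (countIn Q (halfPlane t) / m) (countIn P (halfPlane t) / P.card)
    linarith
  refine hmain P.card P Finset.Subset.rfl rfl (by linarith) fun t y hy _ => ?_
  rw [sub_self, abs_zero]
  have : 0 < y := hp.trans_le hy
  positivity

theorem halving_step_le {ε p r T : ℝ} (hε0 : 0 < ε) (hε1 : ε < 1) (hp0 : 0 < p) (hp1 : p < 1)
    (hr : 0 < r) (hr3 : r ^ 3 = Real.log (2 / (ε * p)) / ε) (hT : T = 10 ^ 16 * r ^ 4 / p) (hT1 : 1 ≤ T)
    (q y : ℝ) (hq : T ≤ q) (hy : p ≤ y) :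
    1012 * √√(2 * q * y) * Real.log q / q ≤ ε * y / 5 * √(T / q) := by
  set Λ := Real.log (2 / (ε * p)) with hΛ
  have hT0 : 0 < T := by rw [hT]; positivity
  have hq0 : 0 < q := hT0.trans_le hq
  have hy0 : 0 < y := hp0.trans_le hy
  have hlog2 := Real.log_two_gt_d9
  have hlε : Real.log ε < 0 := Real.log_neg hε0 hε1
  have hlp : Real.log p < 0 := Real.log_neg hp0 hp1
  have hΛeq : Λ = Real.log 2 - Real.log ε - Real.log p := by
    rw [hΛ, Real.log_div (by norm_num) (by positivity), Real.log_mul hε0.ne' hp0.ne']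
    ring
  have hΛ0 : 1 / 2 < Λ := by linarith
  have hlogr : 3 * Real.log r = Real.log Λ - Real.log ε := by
    have := congrArg Real.log hr3
    rw [Real.log_pow, Real.log_div (by linarith) hε0.ne'] at this
    exact_mod_cast this
  have hlogT : Real.log T ≤ 300 * Λ := by
    rw [hT, Real.log_div (by positivity) hp0.ne', Real.log_mul (by positivity) (by positivity),
      Real.log_pow, Real.log_pow]
    have h1 := Real.log_le_sub_one_of_pos (show (0 : ℝ) < 10 by norm_num)
    have h2 := Real.log_le_sub_one_of_pos (show 0 < Λ by linarith)
    push_cast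
    linarith
  set z := √√(q / T) with hz
  have hz4 : z ^ 4 = q / T := by
    rw [show z ^ 4 = (z ^ 2) ^ 2 by ring, hz, Real.sq_sqrt (by positivity),
      Real.sq_sqrt (by positivity)]
  have hz1 : 1 ≤ z := Real.one_le_sqrt.2 (Real.one_le_sqrt.2 ((one_le_div hT0).2 hq))
  have hqz : q = T * z ^ 4 := by rw [hz4]; field_simp
  set τ := √√(y * T) with hτ
  have hτ4 : τ ^ 4 = y * T := by
    rw [show τ ^ 4 = (τ ^ 2) ^ 2 by ring, hτ, Real.sq_sqrt (by positivity),
      Real.sq_sqrt (by positivity)]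
  have hyτ : y = τ ^ 4 / T := by rw [hτ4]; field_simp
  have hτr : 10 ^ 4 * r ≤ τ := by
    refine Real.le_sqrt_of_sq_le (Real.le_sqrt_of_sq_le ?_)
    have h1 : p * T ≤ y * T := mul_le_mul_of_nonneg_right hy hT0.le
    have h2 : p * T = 10 ^ 16 * r ^ 4 := by rw [hT]; field_simp
    refine le_trans (le_of_eq ?_) h1
    rw [h2]
    ring
  have hτ3 : 10 ^ 12 * Λ ≤ ε * τ ^ 3 := by
    have h1 : (10 ^ 4 * r) ^ 3 ≤ τ ^ 3 := pow_le_pow_left₀ (by positivity) hτr 3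
    have h2 : ε * (10 ^ 4 * r) ^ 3 = 10 ^ 12 * Λ := by
      rw [mul_pow, hr3]
      field_simp
    rw [← h2]
    exact mul_le_mul_of_nonneg_left h1 hε0.le
  have hlogq : Real.log q ≤ 310 * Λ * z := by
    have h1 : Real.log q = Real.log T + 4 * Real.log z := by
      conv_lhs => rw [hqz]
      rw [Real.log_mul hT0.ne' (by positivity), Real.log_pow]
      norm_num
    have h2 := Real.log_le_sub_one_of_pos (show 0 < z by linarith)
    nlinarith
  have hsqrt : √√(2 * q * y) ≤ 2 * (z * τ) := by
    rw [Real.sqrt_le_left (by positivity), Real.sqrt_le_left (by positivity)]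
    have h1 : ((2 * (z * τ)) ^ 2) ^ 2 = 16 * (z ^ 4 * τ ^ 4) := by ring
    rw [h1, hz4, hτ4]
    have h2 : q / T * (y * T) = q * y := by field_simp
    rw [h2]
    have : 0 < q * y := by positivity
    linarith
  have hsq : √(T / q) = 1 / z ^ 2 := by
    rw [hz, Real.sq_sqrt (Real.sqrt_nonneg _), one_div, ← Real.sqrt_inv, inv_div]
  have hτ0 : 0 < τ := lt_of_lt_of_le (by positivity) hτr
  have hz0 : 0 < z := by linarith
  have hΛ' : 0 < Λ := by linarith
  have hlogq0 : 0 ≤ Real.log q := Real.log_nonneg (hT1.trans hq)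
  rw [hsq]
  calc 1012 * √√(2 * q * y) * Real.log q / q
      ≤ 1012 * (2 * (z * τ)) * (310 * Λ * z) / q := by gcongr
    _ = (1012 * 2 * 310 * 5 * Λ) * (τ / (5 * T * z ^ 2)) := by rw [hqz]; field_simp
    _ ≤ (ε * τ ^ 3) * (τ / (5 * T * z ^ 2)) := by
      refine mul_le_mul_of_nonneg_right ?_ (by positivity)
      linarith
    _ = ε * y / 5 * (1 / z ^ 2) := by rw [hyτ]; field_simp

/-- Every finite planar point set admits a relative `(p,ε)`-approximation of
size `O((1/(ε^{4/3}p))·log^{4/3}(2/(εp)))` with respect to closed halfplane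
ranges. -/
theorem small_relative_approx_halfplanes :
    ∃ C : ℝ, 0 < C ∧
      ∀ P : Finset (ℝ × ℝ), P.Nonempty →
        ∀ ε p : ℝ, 0 < ε → ε < 1 → 0 < p → p < 1 →
          ∃ Z : Finset (ℝ × ℝ), Z ⊆ P ∧ Z.Nonempty ∧
            (Z.card : ℝ) ≤
              C * (1 / (ε ^ ((4 : ℝ) / 3) * p)) *
                Real.log (2 / (ε * p)) ^ ((4 : ℝ) / 3) ∧
            ∀ a b c : ℝ, (a, b) ≠ (0, 0) →
              (p ≤ meas2 {x : ℝ × ℝ | 0 ≤ a * x.1 + b * x.2 + c} P →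
                (1 - ε) * meas2 {x : ℝ × ℝ | 0 ≤ a * x.1 + b * x.2 + c} P ≤
                    meas2 {x : ℝ × ℝ | 0 ≤ a * x.1 + b * x.2 + c} Z ∧
                  meas2 {x : ℝ × ℝ | 0 ≤ a * x.1 + b * x.2 + c} Z ≤
                    (1 + ε) * meas2 {x : ℝ × ℝ | 0 ≤ a * x.1 + b * x.2 + c} P) ∧
              (meas2 {x : ℝ × ℝ | 0 ≤ a * x.1 + b * x.2 + c} P ≤ p →
                |meas2 {x : ℝ × ℝ | 0 ≤ a * x.1 + b * x.2 + c} Z -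
                    meas2 {x : ℝ × ℝ | 0 ≤ a * x.1 + b * x.2 + c} P| ≤ ε * p) := by
  refine ⟨10 ^ 16, by positivity, fun P hP ε p hε0 hε1 hp0 hp1 => ?_⟩
  have hlog2 := Real.log_two_gt_d9
  have hlε : Real.log ε < 0 := Real.log_neg hε0 hε1
  have hlp : Real.log p < 0 := Real.log_neg hp0 hp1
  set Λ := Real.log (2 / (ε * p)) with hΛ
  have hΛ0 : 1 / 2 < Λ := by
    rw [hΛ, Real.log_div (by norm_num) (by positivity), Real.log_mul hε0.ne' hp0.ne']
    linarith
  have hΛ' : 0 < Λ := by linarith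
  set r := (Λ / ε) ^ ((1 : ℝ) / 3) with hr
  have hr0 : 0 < r := by positivity
  have hr3 : r ^ 3 = Λ / ε := by
    rw [hr, ← Real.rpow_natCast, ← Real.rpow_mul (by positivity)]
    norm_num
  have hr4 : r ^ 4 = Λ ^ ((4 : ℝ) / 3) / ε ^ ((4 : ℝ) / 3) := by
    rw [hr, ← Real.rpow_natCast, ← Real.rpow_mul (by positivity),
      ← Real.div_rpow hΛ'.le hε0.le]
    norm_num
  set T := 10 ^ 16 * r ^ 4 / p with hT
  have hTeq : (10 : ℝ) ^ 16 * (1 / (ε ^ ((4 : ℝ) / 3) * p)) * Λ ^ ((4 : ℝ) / 3) = T := by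
    rw [hT, hr4]
    field_simp
  rw [hTeq]
  have hT3 : 3 ≤ T := by
    have h1 : (1 : ℝ) / 2 ≤ r := by
      by_contra! h
      have h2 : r ^ 3 < (1 / 2) ^ 3 := pow_lt_pow_left₀ h hr0.le (by norm_num)
      have h3 : Λ ≤ Λ / ε := le_div_self hΛ'.le hε0 hε1.le
      rw [hr3] at h2
      linarith
    have h4 : ((1 : ℝ) / 2) ^ 4 ≤ r ^ 4 := pow_le_pow_left₀ (by norm_num) h1 4
    rw [hT, le_div_iff₀ hp0]
    linarith
  obtain ⟨Z, hZP, hZ, hZT, happ⟩ : ∃ Z ⊆ P, Z.Nonempty ∧ (Z.card : ℝ) ≤ T ∧ ∀ t y, p ≤ y →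
      (countIn P (halfPlane t) : ℝ) / P.card ≤ y →
      |(countIn Z (halfPlane t) : ℝ) / Z.card - countIn P (halfPlane t) / P.card| ≤ ε * y := by
    rcases le_total (P.card : ℝ) T with h | h
    · refine ⟨P, Finset.Subset.rfl, hP, h, fun t y hy _ => ?_⟩
      rw [sub_self, abs_zero]
      exact mul_nonneg hε0.le (hp0.le.trans hy)
    · exact exists_approx_of_step P T ε p hT3 hε0 hε1 hp0 h
        (halving_step_le hε0 hε1 hp0 hp1 hr0 hr3 hT (by linarith))
  refine ⟨Z, hZP, hZ, hZT, fun a b c _ => ?_⟩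
  change (p ≤ (countIn P (halfPlane (a, b, c)) : ℝ) / P.card →
      (1 - ε) * ((countIn P (halfPlane (a, b, c)) : ℝ) / P.card) ≤
        (countIn Z (halfPlane (a, b, c)) : ℝ) / Z.card ∧
      (countIn Z (halfPlane (a, b, c)) : ℝ) / Z.card ≤
        (1 + ε) * ((countIn P (halfPlane (a, b, c)) : ℝ) / P.card)) ∧
    ((countIn P (halfPlane (a, b, c)) : ℝ) / P.card ≤ p →
      |(countIn Z (halfPlane (a, b, c)) : ℝ) / Z.card -
        countIn P (halfPlane (a, b, c)) / P.card| ≤ ε * p)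
  refine ⟨fun h => ?_, fun h => happ _ p le_rfl h⟩
  have := abs_le.1 (happ _ _ h le_rfl)
  constructor <;> linarith
end

section
/- There is an absolute constant C > 0 with the following property. For every nonempty finite set P of n points in ℝ² and every parameter 0 < ε < 1, there exists a nonempty subset Z ⊆ P with |Z| ≤ C·(1/ε²)·log^{4/3}(2/ε) such that for every closed halfplane h in ℝ², |X̄(h,P) − X̄(h,Z)| ≤ (1/2)·( ε^{3/2}·X̄(h,P)^{1/4} + ε² ). -/
section
open Finset

/-- The number of edges in direction `a` of the one-inclusion graph of `𝒜`. -/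
def inclusionEdges {α : Type*} [DecidableEq α] (𝒜 : Finset (Finset α)) (a : α) :
    Finset (Finset α) :=
  𝒜.memberSubfamily a ∩ 𝒜.nonMemberSubfamily a

section
variable {α : Type*} [DecidableEq α]

lemma mem_inclusionEdges {𝒜 : Finset (Finset α)} {a : α} {s : Finset α} :
    s ∈ inclusionEdges 𝒜 a ↔ a ∉ s ∧ s ∈ 𝒜 ∧ insert a s ∈ 𝒜 := by
  simp only [inclusionEdges, mem_inter, mem_memberSubfamily, mem_nonMemberSubfamily]
  tauto

lemma sum_card_inclusionEdges_le (U : Finset α) : ∀ (d : ℕ) (𝒜 : Finset (Finset α)),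
    (∀ s ∈ 𝒜, s ⊆ U) → (∀ s, 𝒜.Shatters s → #s ≤ d) →
    ∑ a ∈ U, #(inclusionEdges 𝒜 a) ≤ d * #𝒜 := by
  induction U using Finset.induction_on with
  | empty => intro d 𝒜 _ _; simp
  | insert a U ha ih =>
    intro d 𝒜 hU hd
    set F0 := 𝒜.nonMemberSubfamily a with hF0
    set F1 := 𝒜.memberSubfamily a with hF1
    have hF0U : ∀ s ∈ F0, s ⊆ U := fun s hs => by
      rw [hF0, mem_nonMemberSubfamily] at hs
      exact (subset_insert_iff_of_notMem hs.2).1 (hU s hs.1)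
    have hF1U : ∀ s ∈ F1, s ⊆ U := fun s hs => by
      rw [hF1, mem_memberSubfamily] at hs
      exact (subset_insert_iff_of_notMem hs.2).1 ((subset_insert a s).trans (hU _ hs.1))
    have hcard : #F1 + #F0 = #𝒜 := card_memberSubfamily_add_card_nonMemberSubfamily a 𝒜
    have hui := card_union_add_card_inter F1 F0
    have hstep : ∀ b ∈ U, #(inclusionEdges 𝒜 b) ≤
        #(inclusionEdges (F1 ∪ F0) b) + #(inclusionEdges (F1 ∩ F0) b) := by
      intro b hb
      have hba : a ≠ b := fun h => ha (h ▸ hb)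
      have h1 : (inclusionEdges 𝒜 b).memberSubfamily a = inclusionEdges F1 b := by
        ext s
        simp only [mem_memberSubfamily, mem_inclusionEdges, hF1, mem_insert, not_or,
          insert_comm b a s]
        have := hba.symm
        tauto
      have h0 : (inclusionEdges 𝒜 b).nonMemberSubfamily a = inclusionEdges F0 b := by
        ext s
        simp only [mem_nonMemberSubfamily, mem_inclusionEdges, hF0, mem_insert, not_or]
        tauto
      rw [← card_memberSubfamily_add_card_nonMemberSubfamily a, h1, h0,
        ← card_union_add_card_inter]
      refine Nat.add_le_add (card_le_card fun s hs => ?_) (card_le_card fun s hs => ?_)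
      · simp only [mem_union, mem_inclusionEdges] at hs ⊢
        tauto
      · simp only [mem_inter, mem_inclusionEdges] at hs ⊢
        tauto
    have hunion : ∑ b ∈ U, #(inclusionEdges (F1 ∪ F0) b) ≤ d * #(F1 ∪ F0) := by
      refine ih d _ (fun s hs => ?_) (fun s hs => hd s fun t ht => ?_)
      · rcases mem_union.1 hs with h | h
        exacts [hF1U s h, hF0U s h]
      · have has : a ∉ s := by
          intro has
          obtain ⟨u, hu, hsu⟩ := hs (Subset.refl s)
          have hau : a ∈ u := (inter_eq_left.1 hsu) has
          rcases mem_union.1 hu with h | h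
          · exact (mem_memberSubfamily.1 h).2 hau
          · exact (mem_nonMemberSubfamily.1 h).2 hau
        obtain ⟨u, hu, hsu⟩ := hs ht
        rcases mem_union.1 hu with h | h
        · exact ⟨insert a u, (mem_memberSubfamily.1 h).1, by rwa [inter_insert_of_notMem has]⟩
        · exact ⟨u, (mem_nonMemberSubfamily.1 h).1, hsu⟩
    have hinter : ∑ b ∈ U, #(inclusionEdges (F1 ∩ F0) b) + #(F1 ∩ F0) ≤ d * #(F1 ∩ F0) := by
      rcases (F1 ∩ F0).eq_empty_or_nonempty with he | hne
      · simp [he, inclusionEdges, memberSubfamily, nonMemberSubfamily]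
      have hsh : ∀ s, (F1 ∩ F0).Shatters s → #s + 1 ≤ d := by
        intro s hs
        have has : a ∉ s := by
          intro has
          obtain ⟨u, hu, hsu⟩ := hs (Subset.refl s)
          exact (mem_memberSubfamily.1 (mem_inter.1 hu).1).2 ((inter_eq_left.1 hsu) has)
        rw [← card_insert_of_notMem has]
        refine hd _ fun t ht => ?_
        obtain ⟨u, hu, hsu⟩ := hs (subset_insert_iff.1 ht)
        rw [mem_inter, mem_memberSubfamily, mem_nonMemberSubfamily] at hu
        by_cases hat : a ∈ t
        · exact ⟨insert a u, hu.1.1, by rw [← insert_inter_distrib, hsu, insert_erase hat]⟩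
        · exact ⟨u, hu.2.1, by rw [insert_inter_of_notMem hu.2.2, hsu, erase_eq_of_notMem hat]⟩
      obtain ⟨e, rfl⟩ : ∃ e, d = e + 1 :=
        ⟨d - 1, by have := hsh ∅ (shatters_empty.2 hne); omega⟩
      have := ih e (F1 ∩ F0) (fun s hs => hF1U s (mem_inter.1 hs).1)
        (fun s hs => by have := hsh s hs; omega)
      rw [add_mul, one_mul]
      omega
    rw [sum_insert ha]
    have h2 := sum_le_sum hstep
    rw [sum_add_distrib] at h2
    have h3 : #(inclusionEdges 𝒜 a) = #(F1 ∩ F0) := rfl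
    calc _ ≤ d * (#(F1 ∪ F0) + #(F1 ∩ F0)) := by rw [mul_add]; omega
      _ = d * #𝒜 := by rw [hui, hcard]

/-- Weighted edge bound: if the traces of `Q` shatter no set of more than `d` elements, then the
one-inclusion graph with edges weighted by the smaller of the two fibres has weight at most
`d * #Q`. -/
lemma sum_min_card_fiber_le {V ι : Type*} [DecidableEq ι] [Fintype ι] (Q : Finset V)
    (tr : V → Finset ι) (d : ℕ) (hd : ∀ s, (Q.image tr).Shatters s → #s ≤ d) :
    ∑ i : ι, ∑ c ∈ Q.image (fun p => (tr p).erase i),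
      min #{p ∈ Q | tr p = insert i c} #{p ∈ Q | tr p = c} ≤ d * #Q := by
  classical
  set W : Finset ι → ℕ := fun u => #{p ∈ Q | tr p = u} with hW
  let L : ℕ → Finset (Finset ι) := fun τ => {u ∈ Q.image tr | τ < W u}
  have hWle : ∀ u, W u ≤ #Q := fun u => card_filter_le _ _
  have hL : ∀ τ, ∑ i : ι, #(inclusionEdges (L τ) i) ≤ d * #(L τ) := fun τ =>
    sum_card_inclusionEdges_le univ d _ (fun s _ => subset_univ s)
      (fun s hs => hd s (hs.mono_left (filter_subset _ _)))
  have hsumL : ∑ τ ∈ range #Q, #(L τ) = #Q := by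
    simp only [L, card_filter]
    rw [sum_comm]
    refine Eq.trans ?_ (card_eq_sum_card_image tr Q).symm
    refine sum_congr rfl fun u _ => ?_
    rw [← card_filter]
    have : {τ ∈ range #Q | τ < W u} = range (W u) := by
      ext τ; simp only [mem_filter, mem_range]; have := hWle u; omega
    rw [this, card_range]
  have hmin : ∀ i : ι, ∑ c ∈ Q.image (fun p => (tr p).erase i), min (W (insert i c)) (W c) ≤
      ∑ τ ∈ range #Q, #(inclusionEdges (L τ) i) := by
    intro i
    have h1 : ∀ τ, #{c ∈ Q.image (fun p => (tr p).erase i) | τ < min (W (insert i c)) (W c)} ≤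
        #(inclusionEdges (L τ) i) := by
      intro τ
      have hpos : ∀ u, τ < W u → u ∈ L τ := by
        intro u hu
        refine mem_filter.2 ⟨?_, hu⟩
        obtain ⟨p, hp⟩ := card_pos.1 (lt_of_le_of_lt (Nat.zero_le _) hu)
        rw [mem_filter] at hp
        exact mem_image.2 ⟨p, hp.1, hp.2⟩
      refine card_le_card fun c hc => ?_
      rw [mem_filter, mem_image, lt_min_iff] at hc
      obtain ⟨⟨p, _, rfl⟩, h1, h2⟩ := hc
      exact mem_inclusionEdges.2 ⟨notMem_erase _ _, hpos _ h2, hpos _ h1⟩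
    refine le_trans (le_of_eq ?_) (sum_le_sum fun τ _ => h1 τ)
    simp only [card_filter]
    rw [sum_comm]
    refine sum_congr rfl fun c _ => ?_
    rw [← card_filter]
    have : {τ ∈ range #Q | τ < min (W (insert i c)) (W c)} =
        range (min (W (insert i c)) (W c)) := by
      ext τ; simp only [mem_filter, mem_range]; have := hWle c; omega
    rw [this, card_range]
  calc _ ≤ ∑ i : ι, ∑ τ ∈ range #Q, #(inclusionEdges (L τ) i) := sum_le_sum fun i _ => hmin i
    _ = ∑ τ ∈ range #Q, ∑ i : ι, #(inclusionEdges (L τ) i) := sum_comm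
    _ ≤ ∑ τ ∈ range #Q, d * #(L τ) := sum_le_sum fun τ _ => hL τ
    _ = d * #Q := by rw [← mul_sum, hsumL]
end

section
variable {V H ι : Type*} [Fintype H] [Fintype ι] [DecidableEq ι]

lemma sum_prod_eq_one (μ : H → ℝ) (hμ : ∑ h, μ h = 1) :
    ∑ f : ι → H, ∏ j, μ (f j) = 1 := by
  rw [← Fintype.piFinset_univ, ← prod_univ_sum]
  simp [hμ]

/-- Resampling one coordinate of a product distribution does not change expectations. -/
lemma sum_prod_mul_eq_resample (μ : H → ℝ) (hμ : ∑ h, μ h = 1) (i : ι) (F : (ι → H) → ℝ) :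
    ∑ f : ι → H, (∏ j, μ (f j)) * F f =
      ∑ f : ι → H, (∏ j, μ (f j)) * ∑ h, μ h * F (Function.update f i h) := by
  let e : (ι → H) × H ≃ (ι → H) × H :=
    { toFun := fun x => (Function.update x.1 i x.2, x.1 i)
      invFun := fun x => (Function.update x.1 i x.2, x.1 i)
      left_inv := fun x => by simp
      right_inv := fun x => by simp }
  have hprod : ∀ (f : ι → H) (h : H),
      (∏ j, μ (Function.update f i h j)) * μ (f i) = (∏ j, μ (f j)) * μ h := by
    intro f h
    rw [← mul_prod_erase univ (fun j => μ (f j)) (mem_univ i),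
      ← mul_prod_erase univ (fun j => μ (Function.update f i h j)) (mem_univ i),
      Function.update_self]
    have : ∏ j ∈ univ.erase i, μ (Function.update f i h j) = ∏ j ∈ univ.erase i, μ (f j) :=
      prod_congr rfl fun j hj => by rw [Function.update_of_ne (ne_of_mem_erase hj)]
    rw [this]; ring
  have h1 : ∑ x : (ι → H) × H, (∏ j, μ (x.1 j)) * μ x.2 * F x.1 =
      ∑ x : (ι → H) × H, (∏ j, μ (x.1 j)) * μ x.2 * F (Function.update x.1 i x.2) := by
    rw [← e.sum_comp]
    exact sum_congr rfl fun x _ => by simp only [e, Equiv.coe_fn_mk, hprod]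
  rw [Fintype.sum_prod_type, Fintype.sum_prod_type] at h1
  simp only [mul_sum, ← mul_assoc]
  rw [← h1]
  refine sum_congr rfl fun f _ => ?_
  dsimp only
  rw [← sum_mul, ← mul_sum, hμ, mul_one]

omit [Fintype ι] [DecidableEq ι] in
/-- If every two points of a cell are separated with probability at least `δ`, then a random range
splits the cell evenly on average. -/
lemma le_sum_mul_min_card (In : H → V → Prop) [∀ h p, Decidable (In h p)] (μ : H → ℝ)
    (hμ0 : ∀ h, 0 ≤ μ h) (δ : ℝ) (c : Finset V) (hc : c.Nonempty)
    (hδ : ∀ p ∈ c, ∀ q ∈ c, p ≠ q → δ ≤ ∑ h, μ h * if In h p ↔ In h q then 0 else 1) :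
    δ / 2 * ((#c : ℝ) - 1) ≤
      ∑ h, μ h * (min #{p ∈ c | In h p} #{p ∈ c | ¬ In h p} : ℕ) := by
  classical
  have hc0 : (0 : ℝ) < #c := by exact_mod_cast hc.card_pos
  have key : ∀ h, ∑ p ∈ c, ∑ q ∈ c, (if In h p ↔ In h q then (0 : ℝ) else 1) =
      2 * (#{p ∈ c | In h p} * #{p ∈ c | ¬ In h p}) := by
    intro h
    have h1 : ∀ p ∈ c, ∑ q ∈ c, (if In h p ↔ In h q then (0 : ℝ) else 1) =
        if In h p then (#{p ∈ c | ¬ In h p} : ℝ) else #{p ∈ c | In h p} := by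
      intro p _
      by_cases hp : In h p <;> simp [hp, Finset.sum_ite]
    rw [sum_congr rfl h1, sum_ite, sum_const, sum_const, nsmul_eq_mul, nsmul_eq_mul]
    ring
  have hmin : ∀ h, (#{p ∈ c | In h p} * #{p ∈ c | ¬ In h p} : ℝ) ≤
      #c * (min #{p ∈ c | In h p} #{p ∈ c | ¬ In h p} : ℕ) := by
    intro h
    rw [← card_filter_add_card_filter_not (s := c) (In h)]
    generalize #{p ∈ c | In h p} = a
    generalize #{p ∈ c | ¬ In h p} = b
    norm_cast
    rcases le_total a b with hab | hab
    · rw [min_eq_left hab]; nlinarith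
    · rw [min_eq_right hab]; nlinarith
  have hlow : (#c : ℝ) * ((#c : ℝ) - 1) * δ ≤
      ∑ p ∈ c, ∑ q ∈ c, ∑ h, μ h * (if In h p ↔ In h q then (0 : ℝ) else 1) := by
    have h2 : ∀ p ∈ c, ((#c : ℝ) - 1) * δ ≤
        ∑ q ∈ c, ∑ h, μ h * (if In h p ↔ In h q then (0 : ℝ) else 1) := by
      intro p hp
      rw [← add_sum_erase _ _ hp]
      have h3 := card_nsmul_le_sum (c.erase p)
        (fun q => ∑ h, μ h * (if In h p ↔ In h q then (0 : ℝ) else 1)) δ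
        (fun q hq => hδ p hp q (mem_of_mem_erase hq) (ne_of_mem_erase hq).symm)
      rw [nsmul_eq_mul, cast_card_erase_of_mem hp] at h3
      simpa using h3
    have := card_nsmul_le_sum c _ _ h2
    rw [nsmul_eq_mul] at this
    linarith
  have hswap : ∑ p ∈ c, ∑ q ∈ c, ∑ h, μ h * (if In h p ↔ In h q then (0 : ℝ) else 1) =
      ∑ h, μ h * (2 * (#{p ∈ c | In h p} * #{p ∈ c | ¬ In h p})) := by
    simp only [← key, mul_sum]
    exact (sum_congr rfl fun p _ => sum_comm).trans sum_comm
  have hup : ∑ h, μ h * (2 * (#{p ∈ c | In h p} * #{p ∈ c | ¬ In h p} : ℝ)) ≤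
      2 * #c * ∑ h, μ h * (min #{p ∈ c | In h p} #{p ∈ c | ¬ In h p} : ℕ) := by
    rw [mul_sum]
    refine sum_le_sum fun h _ => ?_
    have := mul_le_mul_of_nonneg_left (hmin h) (hμ0 h)
    linarith
  rw [hswap] at hlow
  have := hlow.trans hup
  refine le_of_mul_le_mul_left ?_ hc0
  linarith
end

section
variable {V H : Type*} [Fintype H]

/-- The set of sampled ranges containing a point. -/
def sampleTrace {m : ℕ} (In : H → V → Prop) [∀ h p, Decidable (In h p)] (f : Fin m → H) (p : V) :
    Finset (Fin m) := {i | In (f i) p}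

omit [Fintype H] in
lemma sampleTrace_update {m : ℕ} (In : H → V → Prop) [∀ h p, Decidable (In h p)] (f : Fin m → H)
    (i : Fin m) (h : H) (p : V) :
    sampleTrace In (Function.update f i h) p =
      if In h p then insert i ((sampleTrace In f p).erase i) else (sampleTrace In f p).erase i := by
  ext j
  by_cases hj : j = i
  · subst hj; by_cases hp : In h p <;> simp [sampleTrace, hp]
  · by_cases hp : In h p <;> simp [sampleTrace, hp, hj]

lemma le_sum_resample {m : ℕ} (In : H → V → Prop) [∀ h p, Decidable (In h p)] (μ : H → ℝ)
    (hμ0 : ∀ h, 0 ≤ μ h) (δ : ℝ) (hδ0 : 0 ≤ δ) (Q : Finset V)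
    (hδ : ∀ p ∈ Q, ∀ q ∈ Q, p ≠ q → δ ≤ ∑ h, μ h * if In h p ↔ In h q then 0 else 1)
    (f : Fin m → H) (i : Fin m) :
    δ / 2 * ((#Q : ℝ) - #(Q.image (sampleTrace In f))) ≤
      ∑ h, μ h * (∑ c ∈ Q.image (fun p => (sampleTrace In (Function.update f i h) p).erase i),
        min #{p ∈ Q | sampleTrace In (Function.update f i h) p = insert i c}
          #{p ∈ Q | sampleTrace In (Function.update f i h) p = c} : ℕ) := by
  classical
  set cells := Q.image (fun p => (sampleTrace In f p).erase i) with hcells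
  let cell : Finset (Fin m) → Finset V := fun c => {p ∈ Q | (sampleTrace In f p).erase i = c}
  have herase : ∀ h p, (sampleTrace In (Function.update f i h) p).erase i =
      (sampleTrace In f p).erase i := by
    intro h p
    rw [sampleTrace_update]
    split_ifs <;> simp
  have hnot : ∀ c ∈ cells, i ∉ c := by
    intro c hc
    obtain ⟨p, _, rfl⟩ := mem_image.1 hc
    exact notMem_erase _ _
  have hin : ∀ h, ∀ c ∈ cells, {p ∈ Q | sampleTrace In (Function.update f i h) p = insert i c} =
      {p ∈ cell c | In h p} := by
    intro h c hc
    rw [filter_filter]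
    refine filter_congr fun p _ => ?_
    rw [sampleTrace_update]
    have hic := hnot c hc
    have hie := notMem_erase i (sampleTrace In f p)
    by_cases hp : In h p
    · simp only [hp, if_true, and_true]
      refine ⟨fun e => ?_, fun e => by rw [e]⟩
      rw [← erase_insert hie, e, erase_insert hic]
    · simp only [hp, if_false, and_false, iff_false]
      exact fun e => hie (e ▸ mem_insert_self i c)
  have hout : ∀ h, ∀ c ∈ cells, {p ∈ Q | sampleTrace In (Function.update f i h) p = c} =
      {p ∈ cell c | ¬ In h p} := by
    intro h c hc
    rw [filter_filter]
    refine filter_congr fun p _ => ?_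
    rw [sampleTrace_update]
    have hic := hnot c hc
    by_cases hp : In h p
    · simp only [hp, if_true, not_true, and_false, iff_false]
      exact fun e => hic (e ▸ mem_insert_self i _)
    · simp [hp]
  have hcellsle : (#cells : ℝ) ≤ #(Q.image (sampleTrace In f)) := by
    have : cells = (Q.image (sampleTrace In f)).image (fun c => c.erase i) := by
      rw [image_image]; rfl
    rw [this]
    exact_mod_cast card_image_le
  have hsum : (#Q : ℝ) = ∑ c ∈ cells, (#(cell c) : ℝ) := by
    exact_mod_cast card_eq_sum_card_image (fun p => (sampleTrace In f p).erase i) Q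
  calc δ / 2 * ((#Q : ℝ) - #(Q.image (sampleTrace In f)))
      ≤ δ / 2 * ((#Q : ℝ) - #cells) := by gcongr
    _ = ∑ c ∈ cells, δ / 2 * ((#(cell c) : ℝ) - 1) := by
        rw [← mul_sum, sum_sub_distrib, ← hsum]; simp
    _ ≤ ∑ c ∈ cells, ∑ h, μ h * (min #{p ∈ cell c | In h p} #{p ∈ cell c | ¬ In h p} : ℕ) := by
        refine sum_le_sum fun c hc => le_sum_mul_min_card In μ hμ0 δ _ ?_ ?_
        · obtain ⟨p, hp, rfl⟩ := mem_image.1 hc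
          exact ⟨p, mem_filter.2 ⟨hp, rfl⟩⟩
        · exact fun p hp q hq => hδ p (mem_filter.1 hp).1 q (mem_filter.1 hq).1
    _ = _ := by
        rw [sum_comm]
        refine sum_congr rfl fun h _ => ?_
        rw [← mul_sum]
        congr 1
        simp only [herase]
        push_cast
        refine sum_congr rfl fun c hc => ?_
        rw [hin h c hc, hout h c hc]

/-- A packing lemma: some two points are separated by few ranges, where the range `h` is counted
with weight `w h / s h` and `s` controls the number of cells of every sample. -/
lemma exists_pair_sum_separated_le [Nonempty H] (In : H → V → Prop) [∀ h p, Decidable (In h p)]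
    (Q : Finset V) (hQ : 2 ≤ #Q) (s : H → ℝ) (hs : ∀ h, 0 < s h) (C₁ : ℝ) (hC₁ : 0 < C₁)
    (hvc : ∀ (m : ℕ) (f : Fin m → H) (S : Finset (Fin m)),
      (Q.image (sampleTrace In f)).Shatters S → #S ≤ 2)
    (htr : ∀ (m : ℕ) (f : Fin m → H),
      (#(Q.image (sampleTrace In f)) : ℝ) ≤ 1 + C₁ * ∑ i, s (f i))
    (w : H → ℝ) (hw : ∀ h, 0 < w h) :
    ∃ p ∈ Q, ∃ q ∈ Q, p ≠ q ∧
      ∑ h, w h / s h * (if In h p ↔ In h q then 0 else 1) ≤ 136 * C₁ / #Q * ∑ h, w h := by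
  by_contra! hcon
  set t : ℝ := (#Q : ℝ) with ht
  have ht2 : (2 : ℝ) ≤ t := by rw [ht]; exact_mod_cast hQ
  set A : ℝ := ∑ h, w h / s h with hA
  set W : ℝ := ∑ h, w h with hW
  have hA0 : 0 < A := sum_pos (fun h _ => div_pos (hw h) (hs h)) univ_nonempty
  have hW0 : 0 < W := sum_pos (fun h _ => hw h) univ_nonempty
  let μ : H → ℝ := fun h => w h / s h / A
  have hμ0 : ∀ h, 0 ≤ μ h := fun h => (div_pos (div_pos (hw h) (hs h)) hA0).le
  have hμ1 : ∑ h, μ h = 1 := by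
    simp only [μ]; rw [← sum_div, ← hA, div_self hA0.ne']
  have hμs : ∑ h, μ h * s h = W / A := by
    rw [hW, sum_div]
    refine sum_congr rfl fun h _ => ?_
    have := (hs h).ne'
    simp only [μ]; field_simp
  set δ : ℝ := 136 * C₁ * W / (t * A) with hδdef
  have hδ0 : 0 < δ := by positivity
  have hδ : ∀ p ∈ Q, ∀ q ∈ Q, p ≠ q → δ < ∑ h, μ h * if In h p ↔ In h q then 0 else 1 := by
    intro p hp q hq hpq
    have h1 := hcon p hp q hq hpq
    have h2 : ∑ h, μ h * (if In h p ↔ In h q then (0 : ℝ) else 1) =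
        (∑ h, w h / s h * (if In h p ↔ In h q then (0 : ℝ) else 1)) / A := by
      rw [sum_div]
      exact sum_congr rfl fun h _ => by simp only [μ]; ring
    rw [h2, lt_div_iff₀ hA0]
    refine lt_of_le_of_lt (le_of_eq ?_) h1
    rw [hδdef]; field_simp
  have hδ1 : δ < 1 := by
    obtain ⟨p, hp, q, hq, hpq⟩ := one_lt_card.1 (lt_of_lt_of_le one_lt_two hQ)
    refine (hδ p hp q hq hpq).trans_le ?_
    refine le_trans (sum_le_sum fun h _ => mul_le_of_le_one_right (hμ0 h) ?_) hμ1.le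
    split_ifs <;> norm_num
  set x : ℝ := t * A / W with hx
  have hδx : δ * x = 136 * C₁ := by rw [hδdef, hx]; field_simp
  have hx0 : 0 < x := by positivity
  have hxC : 136 * C₁ < x := by rw [← hδx]; nlinarith
  set m : ℕ := ⌊x / (4 * C₁)⌋₊ with hm
  have hm_le : (m : ℝ) ≤ x / (4 * C₁) := Nat.floor_le (by positivity)
  have hm_ge : x / (8 * C₁) ≤ m := by
    have h1 : x / (4 * C₁) < m + 1 := Nat.lt_floor_add_one _
    have h2 : 1 ≤ x / (8 * C₁) := by rw [le_div_iff₀ (by positivity)]; linarith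
    have h3 : x / (4 * C₁) = 2 * (x / (8 * C₁)) := by field_simp; norm_num
    linarith
  let G : Fin m → (Fin m → H) → ℕ := fun i f =>
    ∑ c ∈ Q.image (fun p => (sampleTrace In f p).erase i),
      min #{p ∈ Q | sampleTrace In f p = insert i c} #{p ∈ Q | sampleTrace In f p = c}
  let E : ((Fin m → H) → ℝ) → ℝ := fun F => ∑ f : Fin m → H, (∏ j, μ (f j)) * F f
  have hE1 : ∑ f : Fin m → H, ∏ j, μ (f j) = 1 := sum_prod_eq_one μ hμ1
  have hEmono : ∀ F F' : (Fin m → H) → ℝ, (∀ f, F f ≤ F' f) → E F ≤ E F' := fun F F' hF =>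
    sum_le_sum fun f _ => mul_le_mul_of_nonneg_left (hF f) (prod_nonneg fun j _ => hμ0 _)
  have hEs : E (fun f => ∑ i, s (f i)) = m * (W / A) := by
    have h1 : ∀ i : Fin m, E (fun f => s (f i)) = W / A := by
      intro i
      simp only [E]
      rw [sum_prod_mul_eq_resample μ hμ1 i]
      simp only [Function.update_self, hμs]
      rw [← sum_mul, hE1, one_mul]
    have h2 : E (fun f => ∑ i, s (f i)) = ∑ i, E (fun f => s (f i)) := by
      simp only [E, mul_sum]
      rw [sum_comm]
    rw [h2, sum_congr rfl fun i _ => h1 i]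
    simp
  have hup : E (fun f => ∑ i, (G i f : ℝ)) ≤ 2 * t := by
    have h1 : E (fun f => ∑ i, (G i f : ℝ)) ≤ E (fun _ => 2 * t) := by
      refine hEmono _ _ fun f => ?_
      have := sum_min_card_fiber_le Q (sampleTrace In f) 2 (hvc m f)
      simp only [G, ht]
      exact_mod_cast this
    refine h1.trans (le_of_eq ?_)
    simp only [E]
    rw [← sum_mul, hE1, one_mul]
  have hlow : ∀ i, δ / 2 * (t - 1 - C₁ * (m * (W / A))) ≤ E (fun f => (G i f : ℝ)) := by
    intro i
    have h1 : E (fun f => δ / 2 * (t - 1 - C₁ * ∑ i, s (f i))) =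
        δ / 2 * (t - 1 - C₁ * (m * (W / A))) := by
      rw [← hEs]
      have : ∀ f : Fin m → H, (∏ j, μ (f j)) * (δ / 2 * (t - 1 - C₁ * ∑ i, s (f i))) =
          δ / 2 * (t - 1) * (∏ j, μ (f j)) -
            δ / 2 * C₁ * ((∏ j, μ (f j)) * ∑ i, s (f i)) := fun f => by ring
      simp only [E, this]
      rw [sum_sub_distrib, ← mul_sum, ← mul_sum, hE1]
      ring
    rw [← h1]
    simp only [E]
    rw [sum_prod_mul_eq_resample μ hμ1 i (fun f => (G i f : ℝ))]
    refine hEmono _ _ fun f => ?_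
    refine le_trans ?_ (le_sum_resample In μ hμ0 δ hδ0.le Q
      (fun p hp q hq hpq => (hδ p hp q hq hpq).le) f i)
    have := htr m f
    exact mul_le_mul_of_nonneg_left (by linarith) (by positivity)
  have hsumE : E (fun f => ∑ i, (G i f : ℝ)) = ∑ i, E (fun f => (G i f : ℝ)) := by
    simp only [E, mul_sum]
    rw [sum_comm]
  have hfin : m * (δ / 2 * (t - 1 - C₁ * (m * (W / A)))) ≤ 2 * t := by
    refine le_trans ?_ hup
    rw [hsumE]
    have := card_nsmul_le_sum univ _ _ (fun i (_ : i ∈ univ) => hlow i)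
    simpa using this
  have hcell : C₁ * (m * (W / A)) ≤ t / 4 := by
    have h1 : C₁ * (m * (W / A)) ≤ C₁ * (x / (4 * C₁) * (W / A)) := by gcongr
    refine h1.trans (le_of_eq ?_)
    rw [hx]; field_simp
  have hmδ : 17 ≤ m * δ := by
    have h1 : x / (8 * C₁) * δ ≤ m * δ := by gcongr
    refine le_trans (le_of_eq ?_) h1
    have : x / (8 * C₁) * δ = δ * x / (8 * C₁) := by ring
    rw [this, hδx]; field_simp; norm_num
  have h4 : t / 4 ≤ t - 1 - C₁ * (m * (W / A)) := by linarith
  have h5 : 17 * (t / 4) ≤ m * δ * (t - 1 - C₁ * (m * (W / A))) :=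
    mul_le_mul hmδ h4 (by positivity) (by positivity)
  linarith
end

/-- The value at `p` of the affine function with coefficients `f`. -/
def affEval (f : ℝ × ℝ × ℝ) (p : ℝ × ℝ) : ℝ := f.1 * p.1 + f.2.1 * p.2 + f.2.2

/-- Points on both sides of a line and in the same cell give a point of that cell on the line. -/
lemma exists_affEval_eq_zero (f : ℝ × ℝ × ℝ) {p q : ℝ × ℝ} (hp : 0 ≤ affEval f p)
    (hq : affEval f q < 0) :
    ∃ x : ℝ × ℝ, affEval f x = 0 ∧ ∀ g : ℝ × ℝ × ℝ,
      (0 ≤ affEval g p ↔ 0 ≤ affEval g q) → (0 ≤ affEval g x ↔ 0 ≤ affEval g p) := by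
  have hd : 0 < affEval f p - affEval f q := by linarith
  set l : ℝ := - affEval f q / (affEval f p - affEval f q) with hl
  have hl0 : 0 < l := div_pos (by linarith) hd
  have hl1 : l ≤ 1 := by rw [hl, div_le_one hd]; linarith
  have hcomb : ∀ g : ℝ × ℝ × ℝ,
      affEval g (q.1 + l * (p.1 - q.1), q.2 + l * (p.2 - q.2)) =
        (1 - l) * affEval g q + l * affEval g p := by
    intro g; simp only [affEval]; ring
  refine ⟨(q.1 + l * (p.1 - q.1), q.2 + l * (p.2 - q.2)), ?_, fun g hg => ?_⟩
  · rw [hcomb]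
    have : l * (affEval f p - affEval f q) = - affEval f q := by rw [hl]; field_simp
    linarith
  · rw [hcomb]
    by_cases h : 0 ≤ affEval g p
    · have h' := hg.1 h
      simp only [h, iff_true]
      exact add_nonneg (mul_nonneg (by linarith) h') (mul_nonneg hl0.le h)
    · have h' : ¬ 0 ≤ affEval g q := fun h' => h (hg.2 h')
      simp only [h, iff_false]
      rw [not_le] at h h' ⊢
      nlinarith

section
variable {ι : Type*} [DecidableEq ι]

/-- A line crosses at most `2 * D + 1` cells of depth at most `D`. -/
lemma card_cells_crossed_le (g : ι → ℝ × ℝ × ℝ) (f : ℝ × ℝ × ℝ) (S : Finset ι) (D : ℕ)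
    (𝒞 : Finset (Finset ι)) (hD : ∀ c ∈ 𝒞, #c ≤ D)
    (h𝒞 : ∀ c ∈ 𝒞, ∃ p q, 0 ≤ affEval f p ∧ affEval f q < 0 ∧
      {i ∈ S | 0 ≤ affEval (g i) p} = c ∧ {i ∈ S | 0 ≤ affEval (g i) q} = c) :
    #𝒞 ≤ 2 * D + 1 := by
  rcases 𝒞.eq_empty_or_nonempty with he | ⟨c0, hc0⟩
  · simp [he]
  have hpos : 0 < f.1 ^ 2 + f.2.1 ^ 2 := by
    obtain ⟨p, q, hp, hq, -⟩ := h𝒞 c0 hc0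
    by_contra h
    have h1 : f.1 = 0 := by nlinarith [sq_nonneg f.1, sq_nonneg f.2.1]
    have h2 : f.2.1 = 0 := by nlinarith [sq_nonneg f.1, sq_nonneg f.2.1]
    simp only [affEval, h1, h2] at hp hq
    linarith
  have hx : ∀ c ∈ 𝒞, ∃ x : ℝ × ℝ, affEval f x = 0 ∧ {i ∈ S | 0 ≤ affEval (g i) x} = c := by
    intro c hc
    obtain ⟨p, q, hp, hq, hpc, hqc⟩ := h𝒞 c hc
    obtain ⟨x, hx0, hx⟩ := exists_affEval_eq_zero f hp hq
    refine ⟨x, hx0, ?_⟩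
    rw [← hpc]
    refine filter_congr fun i hi => hx _ ?_
    have h1 : i ∈ c ↔ 0 ≤ affEval (g i) p := by rw [← hpc]; simp [hi]
    have h2 : i ∈ c ↔ 0 ≤ affEval (g i) q := by rw [← hqc]; simp [hi]
    exact h1.symm.trans h2
  choose! x hx0 hxc using hx
  let dir : ι → ℝ := fun i => (g i).1 * (-f.2.1) + (g i).2.1 * f.1
  let T : ℝ × ℝ → ℝ := fun y => -f.2.1 * y.1 + f.1 * y.2
  have hmove : ∀ c ∈ 𝒞, ∀ c' ∈ 𝒞, ∀ i,
      (f.1 ^ 2 + f.2.1 ^ 2) * (affEval (g i) (x c') - affEval (g i) (x c)) =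
        (T (x c') - T (x c)) * dir i := by
    intro c hc c' hc' i
    have h1 := hx0 c hc
    have h2 := hx0 c' hc'
    simp only [affEval, T, dir] at h1 h2 ⊢
    linear_combination (f.1 * (g i).1 + f.2.1 * (g i).2.1) * (h2 - h1)
  have hmem : ∀ c ∈ 𝒞, ∀ i, i ∈ c ↔ i ∈ S ∧ 0 ≤ affEval (g i) (x c) := by
    intro c hc i
    conv_lhs => rw [← hxc c hc]
    exact mem_filter
  let ψ : Finset ι → ℕ := fun c => #{i ∈ c | 0 ≤ dir i} + (D - #{i ∈ c | ¬ 0 ≤ dir i})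
  have hwlog : ∀ c ∈ 𝒞, ∀ c' ∈ 𝒞, T (x c) ≤ T (x c') → ψ c = ψ c' → c = c' := by
    intro c hc c' hc' hT hψ
    have hR : {i ∈ c | 0 ≤ dir i} ⊆ {i ∈ c' | 0 ≤ dir i} := by
      intro i hi
      rw [mem_filter, hmem c hc] at hi
      rw [mem_filter, hmem c' hc']
      refine ⟨⟨hi.1.1, ?_⟩, hi.2⟩
      have h1 := hmove c hc c' hc' i
      have h2 : 0 ≤ (T (x c') - T (x c)) * dir i := mul_nonneg (by linarith) hi.2
      rw [← h1] at h2
      have := nonneg_of_mul_nonneg_right h2 hpos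
      linarith [hi.1.2]
    have hL : {i ∈ c' | ¬ 0 ≤ dir i} ⊆ {i ∈ c | ¬ 0 ≤ dir i} := by
      intro i hi
      rw [mem_filter, hmem c' hc'] at hi
      rw [mem_filter, hmem c hc]
      refine ⟨⟨hi.1.1, ?_⟩, hi.2⟩
      have h1 := hmove c' hc' c hc i
      have h2 : 0 ≤ (T (x c) - T (x c')) * dir i :=
        mul_nonneg_of_nonpos_of_nonpos (by linarith) (not_le.1 hi.2).le
      rw [← h1] at h2
      have := nonneg_of_mul_nonneg_right h2 hpos
      linarith [hi.1.2]
    have h1 := card_le_card hR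
    have h2 := card_le_card hL
    have h3 : #{i ∈ c | ¬ 0 ≤ dir i} ≤ D := (card_filter_le _ _).trans (hD c hc)
    have h4 : #{i ∈ c | 0 ≤ dir i} + (D - #{i ∈ c | ¬ 0 ≤ dir i}) =
      #{i ∈ c' | 0 ≤ dir i} + (D - #{i ∈ c' | ¬ 0 ≤ dir i}) := hψ
    have hR' := eq_of_subset_of_card_le hR (by omega)
    have hL' := eq_of_subset_of_card_le hL (by omega)
    rw [← filter_union_filter_not_eq (fun i => 0 ≤ dir i) c,
      ← filter_union_filter_not_eq (fun i => 0 ≤ dir i) c', hR', hL']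
  have hcard : #𝒞 ≤ #(range (2 * D + 1)) := by
    refine card_le_card_of_injOn ψ (fun c hc => ?_) fun c hc c' hc' h => ?_
    · have h1 : #{i ∈ c | 0 ≤ dir i} ≤ D := (card_filter_le _ _).trans (hD c hc)
      simp only [ψ, coe_range, Set.mem_Iio]
      omega
    · rcases le_total (T (x c)) (T (x c')) with hT | hT
      · exact hwlog c hc c' hc' hT h
      · exact (hwlog c' hc' c hc hT h.symm).symm
  rwa [card_range] at hcard

lemma card_image_trace_le_of_depth_le (Q : Finset (ℝ × ℝ)) (g : ι → ℝ × ℝ × ℝ) (j : ι → ℕ)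
    (S : Finset ι) : (∀ p ∈ Q, ∀ i ∈ S,
      #{i' ∈ S | j i' ≤ j i ∧ 0 ≤ affEval (g i') p} ≤ 2 * 2 ^ j i) →
    #(Q.image fun p => {i ∈ S | 0 ≤ affEval (g i) p}) ≤ 1 + ∑ i ∈ S, 5 * 2 ^ j i := by
  induction S using Finset.induction_on_max_value j with
  | empty => intro _; simpa using card_le_one.2 (by simp +contextual)
  | insert a S ha hmax ih =>
    intro hdepth
    set X := Q.image fun p => {i ∈ insert a S | 0 ≤ affEval (g i) p} with hX
    set Y := Q.image fun p => {i ∈ S | 0 ≤ affEval (g i) p} with hY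
    have ihS : #Y ≤ 1 + ∑ i ∈ S, 5 * 2 ^ j i := by
      refine ih fun p hp i hi => le_trans (card_le_card ?_) (hdepth p hp i (mem_insert_of_mem hi))
      exact filter_subset_filter _ (subset_insert a S)
    have h1 : ∀ c ∈ X.memberSubfamily a, ∃ p ∈ Q, 0 ≤ affEval (g a) p ∧
        {i ∈ S | 0 ≤ affEval (g i) p} = c := by
      intro c hc
      rw [mem_memberSubfamily, hX, mem_image] at hc
      obtain ⟨⟨p, hp, hpc⟩, hac⟩ := hc
      rw [filter_insert] at hpc
      split_ifs at hpc with h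
      · refine ⟨p, hp, h, ?_⟩
        rw [← erase_insert hac, ← hpc, erase_insert]
        simp [ha]
      · exact absurd (hpc ▸ mem_insert_self a c) (by simp [ha])
    have h0 : ∀ c ∈ X.nonMemberSubfamily a, ∃ p ∈ Q, affEval (g a) p < 0 ∧
        {i ∈ S | 0 ≤ affEval (g i) p} = c := by
      intro c hc
      rw [mem_nonMemberSubfamily, hX, mem_image] at hc
      obtain ⟨⟨p, hp, hpc⟩, hac⟩ := hc
      rw [filter_insert] at hpc
      split_ifs at hpc with h
      · exact absurd (hpc ▸ mem_insert_self a _) hac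
      · exact ⟨p, hp, not_le.1 h, hpc⟩
    have hunion : X.memberSubfamily a ∪ X.nonMemberSubfamily a ⊆ Y := by
      intro c hc
      rcases mem_union.1 hc with h | h
      · obtain ⟨p, hp, -, hpc⟩ := h1 c h
        exact mem_image.2 ⟨p, hp, hpc⟩
      · obtain ⟨p, hp, -, hpc⟩ := h0 c h
        exact mem_image.2 ⟨p, hp, hpc⟩
    have hinter : #(X.memberSubfamily a ∩ X.nonMemberSubfamily a) ≤ 2 * (2 * 2 ^ j a) + 1 := by
      refine card_cells_crossed_le g (g a) S _ _ (fun c hc => ?_) fun c hc => ?_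
      · obtain ⟨p, hp, -, hpc⟩ := h1 c (mem_inter.1 hc).1
        refine le_trans (card_le_card ?_) (hdepth p hp a (mem_insert_self a S))
        rw [← hpc]
        intro i hi
        rw [mem_filter] at hi ⊢
        exact ⟨mem_insert_of_mem hi.1, hmax i hi.1, hi.2⟩
      · obtain ⟨p, -, hp, hpc⟩ := h1 c (mem_inter.1 hc).1
        obtain ⟨q, -, hq, hqc⟩ := h0 c (mem_inter.1 hc).2
        exact ⟨p, q, hp, hq, hpc, hqc⟩
    have hcard : #(X.memberSubfamily a) + #(X.nonMemberSubfamily a) = #X :=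
      card_memberSubfamily_add_card_nonMemberSubfamily a X
    have hui := card_union_add_card_inter (X.memberSubfamily a) (X.nonMemberSubfamily a)
    have hle := card_le_card hunion
    rw [sum_insert ha]
    have : 1 ≤ 2 ^ j a := Nat.one_le_two_pow
    omega

/-- The number of cells containing a point of `Q` in an arrangement of shallow halfplanes. -/
lemma card_image_trace_le [Fintype ι] (Q : Finset (ℝ × ℝ)) (g : ι → ℝ × ℝ × ℝ) (j : ι → ℕ)
    (hj : ∀ i, #{p ∈ Q | 0 ≤ affEval (g i) p} ≤ 4 ^ (j i + 1)) :
    #(Q.image fun p => ({i | 0 ≤ affEval (g i) p} : Finset ι)) ≤ 1 + 9 * ∑ i, 2 ^ j i := by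
  let good : ℝ × ℝ → Prop := fun p => ∀ l, #{i | j i = l ∧ 0 ≤ affEval (g i) p} ≤ 2 ^ l
  classical
  have hgood : #({p ∈ Q | good p}.image fun p => ({i | 0 ≤ affEval (g i) p} : Finset ι)) ≤
      1 + ∑ i, 5 * 2 ^ j i := by
    refine card_image_trace_le_of_depth_le _ g j univ fun p hp i _ => ?_
    have hp' := (mem_filter.1 hp).2
    have hsub : ({i' | j i' ≤ j i ∧ 0 ≤ affEval (g i') p} : Finset ι) ⊆
        (range (j i + 1)).biUnion fun l => {i | j i = l ∧ 0 ≤ affEval (g i) p} := by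
      intro i' hi'
      simp only [mem_filter, mem_univ, true_and, mem_biUnion, mem_range] at hi' ⊢
      exact ⟨j i', by omega, rfl, hi'.2⟩
    refine (card_le_card hsub).trans
      (card_biUnion_le.trans ((sum_le_sum fun l _ => hp' l).trans ?_))
    have := Nat.geomSum_eq (le_refl 2) (j i + 1)
    rw [this, pow_succ]
    omega
  have hbad : #{p ∈ Q | ¬ good p} ≤ ∑ i, 4 * 2 ^ j i := by
    have h1 : ∀ p ∈ {p ∈ Q | ¬ good p},
        (1 : ℝ) ≤ ∑ i, (if 0 ≤ affEval (g i) p then (1 : ℝ) else 0) / 2 ^ j i := by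
      intro p hp
      have hp' := (mem_filter.1 hp).2
      simp only [good, not_forall, not_le] at hp'
      obtain ⟨l, hl⟩ := hp'
      have h2 : ∑ i ∈ {i | j i = l ∧ 0 ≤ affEval (g i) p},
          (if 0 ≤ affEval (g i) p then (1 : ℝ) else 0) / 2 ^ j i =
          #{i | j i = l ∧ 0 ≤ affEval (g i) p} / 2 ^ l := by
        rw [sum_congr rfl (g := fun _ => (1 : ℝ) / 2 ^ l), sum_const, nsmul_eq_mul]
        · ring
        · intro i hi
          simp only [mem_filter, mem_univ, true_and] at hi
          rw [if_pos hi.2, hi.1]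
      have h3 : (1 : ℝ) ≤ #{i | j i = l ∧ 0 ≤ affEval (g i) p} / 2 ^ l := by
        rw [le_div_iff₀ (by positivity), one_mul]
        exact_mod_cast hl.le
      rw [← h2] at h3
      refine h3.trans (sum_le_sum_of_subset_of_nonneg (subset_univ _) fun i _ _ => ?_)
      split_ifs <;> positivity
    have h4 : (#{p ∈ Q | ¬ good p} : ℝ) ≤ ∑ i, 4 * 2 ^ j i := by
      calc (#{p ∈ Q | ¬ good p} : ℝ)
          ≤ ∑ p ∈ Q with ¬ good p, ∑ i, (if 0 ≤ affEval (g i) p then (1 : ℝ) else 0) / 2 ^ j i := by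
            have := card_nsmul_le_sum _ _ _ h1
            simpa using this
        _ ≤ ∑ p ∈ Q, ∑ i, (if 0 ≤ affEval (g i) p then (1 : ℝ) else 0) / 2 ^ j i := by
            refine sum_le_sum_of_subset_of_nonneg (filter_subset _ _) fun p _ _ =>
              sum_nonneg fun i _ => ?_
            split_ifs <;> positivity
        _ = ∑ i, (#{p ∈ Q | 0 ≤ affEval (g i) p} : ℝ) / 2 ^ j i := by
            rw [sum_comm]
            refine sum_congr rfl fun i _ => ?_
            rw [← sum_div, sum_boole]
        _ ≤ ∑ i, 4 * 2 ^ j i := by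
            refine sum_le_sum fun i _ => ?_
            rw [div_le_iff₀ (by positivity)]
            have h5 : (#{p ∈ Q | 0 ≤ affEval (g i) p} : ℝ) ≤ 4 ^ (j i + 1) := by exact_mod_cast hj i
            refine h5.trans (le_of_eq ?_)
            rw [pow_succ, mul_assoc, ← mul_pow]
            norm_num [mul_comm]
    exact_mod_cast h4
  have hsplit : (Q.image fun p => ({i | 0 ≤ affEval (g i) p} : Finset ι)) ⊆
      ({p ∈ Q | good p}.image fun p => ({i | 0 ≤ affEval (g i) p} : Finset ι)) ∪
      ({p ∈ Q | ¬ good p}.image fun p => ({i | 0 ≤ affEval (g i) p} : Finset ι)) := by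
    rw [← image_union, filter_union_filter_not_eq]
  refine (card_le_card hsplit).trans ((card_union_le _ _).trans ?_)
  have h6 := (card_image_le (s := {p ∈ Q | ¬ good p})
    (f := fun p => ({i | 0 ≤ affEval (g i) p} : Finset ι))).trans hbad
  rw [← mul_sum] at hgood h6
  omega
end

/-- A nontrivial linear relation with constant value on a set of vectors excludes some sign
pattern. -/
lemma exists_sign_pattern_not_realized {ι : Type*} [Fintype ι] (c : ι → ℝ) (hc : ∃ i, c i ≠ 0)
    (κ : ℝ) (Y : Set (ι → ℝ)) (hY : ∀ y ∈ Y, ∑ i, c i * y i = κ) :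
    ∃ T : Set ι, ∀ y ∈ Y, ¬ ∀ i, 0 ≤ y i ↔ i ∈ T := by
  by_contra! hcon
  obtain ⟨y, hy, hy'⟩ := hcon {i | 0 < c i}
  obtain ⟨z, hz, hz'⟩ := hcon {i | c i ≤ 0}
  simp only [Set.mem_ofPred_eq] at hy' hz'
  have h1 : ∀ i, 0 ≤ c i * y i - c i * z i ∧ (c i ≠ 0 → 0 < c i * y i - c i * z i) := by
    intro i
    rcases lt_trichotomy (c i) 0 with h | h | h
    · have ha : y i < 0 := by
        by_contra hn; exact absurd ((hy' i).1 (not_lt.1 hn)) (by linarith)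
      have hb : 0 ≤ z i := (hz' i).2 h.le
      have : 0 < c i * y i - c i * z i := by nlinarith
      exact ⟨this.le, fun _ => this⟩
    · simp [h]
    · have ha : 0 ≤ y i := (hy' i).2 h
      have hb : z i < 0 := by
        by_contra hn; exact absurd ((hz' i).1 (not_lt.1 hn)) (by linarith)
      have : 0 < c i * y i - c i * z i := by nlinarith
      exact ⟨this.le, fun _ => this⟩
  obtain ⟨i, hi⟩ := hc
  have h2 : 0 < ∑ i, (c i * y i - c i * z i) :=
    sum_pos' (fun i _ => (h1 i).1) ⟨i, mem_univ i, (h1 i).2 hi⟩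
  rw [sum_sub_distrib, hY y hy, hY z hz] at h2
  linarith

lemma card_le_two_of_shatters {ι : Type*} [Fintype ι] [DecidableEq ι] (g : ι → ℝ × ℝ × ℝ)
    (Q : Finset (ℝ × ℝ)) (S : Finset ι)
    (hS : (Q.image fun p => ({i | 0 ≤ affEval (g i) p} : Finset ι)).Shatters S) : #S ≤ 2 := by
  classical
  by_contra! hcard
  have hdep : ¬ LinearIndependent ℝ (fun i : S => ((g i).1, (g i).2.1)) := by
    intro h
    have := h.fintype_card_le_finrank
    simp at this
    omega
  obtain ⟨c, hc, hc0⟩ := Fintype.not_linearIndependent_iff.1 hdep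
  have hca : ∑ i : S, c i * (g i).1 = 0 := by simpa [Prod.fst_sum] using congrArg Prod.fst hc
  have hcb : ∑ i : S, c i * (g i).2.1 = 0 := by simpa [Prod.snd_sum] using congrArg Prod.snd hc
  obtain ⟨T, hT⟩ := exists_sign_pattern_not_realized c hc0 (∑ i : S, c i * (g i).2.2)
    (Set.range fun (p : ℝ × ℝ) (i : S) => affEval (g i) p) (by
      rintro _ ⟨p, rfl⟩
      have h1 : ∀ i : S, c i * affEval (g i) p =
          (c i * (g i).1) * p.1 + (c i * (g i).2.1) * p.2 + c i * (g i).2.2 := fun i => by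
        simp only [affEval]; ring
      simp only [h1]
      rw [sum_add_distrib, sum_add_distrib, ← sum_mul, ← sum_mul, hca, hcb]
      ring)
  obtain ⟨u, hu, hSu⟩ := hS (t := {i ∈ S | ∃ h : i ∈ S, (⟨i, h⟩ : S) ∈ T}) (filter_subset _ _)
  obtain ⟨p, -, rfl⟩ := mem_image.1 hu
  refine hT _ ⟨p, rfl⟩ fun i => ?_
  have := Finset.ext_iff.1 hSu i
  simpa using this

lemma card_le_three_of_shatters (P : Finset (ℝ × ℝ)) (𝒜 : Finset (Finset (ℝ × ℝ)))
    (h𝒜 : ∀ A ∈ 𝒜, ∃ f, A = {p ∈ P | 0 ≤ affEval f p}) (S : Finset (ℝ × ℝ))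
    (hS : 𝒜.Shatters S) : #S ≤ 3 := by
  classical
  have hSP : S ⊆ P := by
    obtain ⟨A, hA, hSA⟩ := hS.exists_superset
    obtain ⟨f, rfl⟩ := h𝒜 A hA
    exact hSA.trans (filter_subset _ _)
  by_contra! hcard
  have hdep : ¬ LinearIndependent ℝ (fun p : S => (p.1.1, p.1.2, (1 : ℝ))) := by
    intro h
    have := h.fintype_card_le_finrank
    simp at this
    omega
  obtain ⟨c, hc, hc0⟩ := Fintype.not_linearIndependent_iff.1 hdep
  have hca : ∑ p : S, c p * p.1.1 = 0 := by simpa [Prod.fst_sum] using congrArg Prod.fst hc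
  have hcb : ∑ p : S, c p * p.1.2 = 0 := by
    simpa [Prod.snd_sum, Prod.fst_sum] using congrArg (fun x => x.2.1) hc
  have hcc : ∑ p : S, c p = 0 := by
    simpa [Prod.snd_sum] using congrArg (fun x => x.2.2) hc
  obtain ⟨T, hT⟩ := exists_sign_pattern_not_realized c hc0 0
    (Set.range fun (f : ℝ × ℝ × ℝ) (p : S) => affEval f p) (by
      rintro _ ⟨f, rfl⟩
      have h1 : ∀ p : S, c p * affEval f p =
          f.1 * (c p * p.1.1) + f.2.1 * (c p * p.1.2) + f.2.2 * c p := fun p => by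
        simp only [affEval]; ring
      simp only [h1]
      rw [sum_add_distrib, sum_add_distrib, ← mul_sum, ← mul_sum, ← mul_sum, hca, hcb, hcc]
      ring)
  obtain ⟨u, hu, hSu⟩ := hS (t := {p ∈ S | ∃ h : p ∈ S, (⟨p, h⟩ : S) ∈ T}) (filter_subset _ _)
  obtain ⟨f, rfl⟩ := h𝒜 u hu
  refine hT _ ⟨f, rfl⟩ fun p => ?_
  have := Finset.ext_iff.1 hSu p
  simpa [hSP p.2] using this

lemma cosh_le_one_add_sq {x : ℝ} (hx : x ^ 2 ≤ 1) : Real.cosh x ≤ 1 + x ^ 2 := by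
  have h1 := Real.cosh_le_exp_half_sq x
  have h2 := Real.exp_bound_div_one_sub_of_interval (x := x ^ 2 / 2) (by positivity) (by linarith)
  refine h1.trans (h2.trans ?_)
  rw [div_le_iff₀ (by linarith)]
  nlinarith [sq_nonneg x]

section
variable {H V : Type*} [Fintype H]

/-- Splitting one suitable pair of points hardly increases the potential. -/
lemma exists_pair_sum_cosh_le (In : H → V → Prop) [∀ h p, Decidable (In h p)]
    (a : H → ℝ) (ha : ∀ h, a h ^ 2 ≤ 1) (D : H → ℝ) (Q : Finset V) (η : ℝ)
    (hpair : ∃ p ∈ Q, ∃ q ∈ Q, p ≠ q ∧ ∑ h, Real.cosh (a h * D h) * a h ^ 2 *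
      (if In h p ↔ In h q then 0 else 1) ≤ η * ∑ h, Real.cosh (a h * D h)) :
    ∃ p ∈ Q, ∃ q ∈ Q, p ≠ q ∧
      ∑ h, Real.cosh (a h * (D h + ((if In h p then 1 else 0) - (if In h q then 1 else 0)))) ≤
        (1 + η) * ∑ h, Real.cosh (a h * D h) := by
  obtain ⟨p, hp, q, hq, hpq, hle⟩ := hpair
  have hsum : (∑ h, Real.cosh (a h * (D h + ((if In h p then 1 else 0) -
        (if In h q then 1 else 0))))) +
      ∑ h, Real.cosh (a h * (D h + ((if In h q then 1 else 0) - (if In h p then 1 else 0)))) ≤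
      2 * ((1 + η) * ∑ h, Real.cosh (a h * D h)) := by
    have h1 : ∀ h, Real.cosh (a h * (D h + ((if In h p then 1 else 0) -
          (if In h q then 1 else 0)))) +
        Real.cosh (a h * (D h + ((if In h q then 1 else 0) - (if In h p then 1 else 0)))) ≤
        2 * (Real.cosh (a h * D h) + Real.cosh (a h * D h) * a h ^ 2 *
      (if In h p ↔ In h q then 0 else 1)) := by
      intro h
      have h2 := cosh_le_one_add_sq (ha h)
      have h3 := Real.cosh_pos (a h * D h)
      have h4 := mul_le_mul_of_nonneg_left h2 h3.le
      have h5 : Real.cosh (a h * (D h + (1 - 0))) + Real.cosh (a h * (D h + (0 - 1))) ≤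
          2 * (Real.cosh (a h * D h) + Real.cosh (a h * D h) * a h ^ 2 * 1) := by
        have e1 : a h * (D h + (1 - 0)) = a h * D h + a h := by ring
        have e2 : a h * (D h + (0 - 1)) = a h * D h - a h := by ring
        rw [e1, e2, Real.cosh_add, Real.cosh_sub]
        linarith
      by_cases hp' : In h p <;> by_cases hq' : In h q <;> simp only [hp', hq', if_true, if_false,
        iff_true, iff_false, not_true]
      · simp; linarith
      · exact h5
      · rw [add_comm]; exact h5
      · simp; linarith
    rw [← sum_add_distrib]
    refine (sum_le_sum fun h _ => h1 h).trans ?_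
    rw [← mul_sum, sum_add_distrib]
    linarith
  rcases le_total (∑ h, Real.cosh (a h * (D h + ((if In h p then 1 else 0) -
        (if In h q then 1 else 0)))))
      (∑ h, Real.cosh (a h * (D h + ((if In h q then 1 else 0) - (if In h p then 1 else 0)))))
    with h | h
  · exact ⟨p, hp, q, hq, hpq, by linarith⟩
  · exact ⟨q, hq, p, hp, hpq.symm, by linarith⟩

lemma exists_half_sum_cosh_le [DecidableEq V] (In : H → V → Prop) [∀ h p, Decidable (In h p)]
    (a : H → ℝ) (ha : ∀ h, a h ^ 2 ≤ 1) (P : Finset V) (C : ℝ)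
    (hpair : ∀ Q ⊆ P, 2 ≤ #Q → ∀ w : H → ℝ, (∀ h, 0 < w h) → ∃ p ∈ Q, ∃ q ∈ Q, p ≠ q ∧
      ∑ h, w h * a h ^ 2 * (if In h p ↔ In h q then 0 else 1) ≤ C / #Q * ∑ h, w h) (m : ℕ) :
    ∀ Q ⊆ P, #Q = 2 * m → ∀ D : H → ℝ, ∃ Z ⊆ Q, #Z = m ∧
      ∑ h, Real.cosh (a h * (D h + (2 * #{p ∈ Z | In h p} - #{p ∈ Q | In h p}))) ≤
        Real.exp (C / 2 * harmonic m) * ∑ h, Real.cosh (a h * D h) := by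
  induction m with
  | zero =>
    intro Q _ hQ D
    have : Q = ∅ := card_eq_zero.1 (by simpa using hQ)
    exact ⟨∅, empty_subset _, rfl, by simp [this]⟩
  | succ m ih =>
    intro Q hQP hQ D
    obtain ⟨p, hp, q, hq, hpq, hle⟩ := exists_pair_sum_cosh_le In a ha D Q (C / #Q)
      (hpair Q hQP (by omega) _ fun h => Real.cosh_pos _)
    have hq' : q ∈ Q.erase p := mem_erase.2 ⟨hpq.symm, hq⟩
    obtain ⟨Z, hZ, hZm, hZle⟩ := ih ((Q.erase p).erase q)
      ((erase_subset _ _).trans ((erase_subset _ _).trans hQP))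
      (by rw [card_erase_of_mem hq', card_erase_of_mem hp]; omega)
      (fun h => D h + ((if In h p then 1 else 0) - (if In h q then 1 else 0)))
    have hpZ : p ∉ Z := fun h => by simpa using hZ h
    refine ⟨insert p Z, insert_subset hp
      (hZ.trans ((erase_subset _ _).trans (erase_subset _ _))),
      by rw [card_insert_of_notMem hpZ, hZm], ?_⟩
    have hcount : ∀ h, D h + (2 * (#{x ∈ insert p Z | In h x} : ℝ) - #{x ∈ Q | In h x}) =
        D h + ((if In h p then 1 else 0) - (if In h q then 1 else 0)) +
          (2 * #{x ∈ Z | In h x} - #{x ∈ (Q.erase p).erase q | In h x}) := by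
      intro h
      have e1 : (#{x ∈ insert p Z | In h x} : ℝ) =
          (if In h p then 1 else 0) + #{x ∈ Z | In h x} := by
        simp only [← sum_boole]
        rw [sum_insert hpZ]
      have e2 : (#{x ∈ Q | In h x} : ℝ) = (if In h p then 1 else 0) + ((if In h q then 1 else 0) +
          #{x ∈ (Q.erase p).erase q | In h x}) := by
        simp only [← sum_boole]
        rw [← add_sum_erase Q _ hp, ← add_sum_erase (Q.erase p) _ hq']
      rw [e1, e2]; ring
    simp only [hcount]
    refine hZle.trans ?_
    have hΦ : 0 ≤ ∑ h, Real.cosh (a h * D h) := sum_nonneg fun h _ => (Real.cosh_pos _).le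
    have hexp : 1 + C / #Q ≤ Real.exp (C / 2 * ((m + 1 : ℕ) : ℝ)⁻¹) := by
      have : C / #Q = C / 2 * ((m + 1 : ℕ) : ℝ)⁻¹ := by rw [hQ]; push_cast; field_simp
      rw [this, add_comm]
      exact Real.add_one_le_exp _
    have e3 : Real.exp (C / 2 * (harmonic (m + 1) : ℝ)) =
        Real.exp (C / 2 * harmonic m) * Real.exp (C / 2 * ((m + 1 : ℕ) : ℝ)⁻¹) := by
      rw [harmonic_succ, ← Real.exp_add]; push_cast; ring_nf
    rw [e3, mul_assoc]
    refine mul_le_mul_of_nonneg_left (hle.trans ?_) (Real.exp_pos _).le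
    exact mul_le_mul_of_nonneg_right hexp hΦ

lemma abs_le_of_sum_cosh_le (x : H → ℝ) (B : ℝ) (h : ∑ h, Real.cosh (x h) ≤ Real.exp B) (i : H) :
    |x i| ≤ B + 1 := by
  have h1 : Real.cosh (x i) ≤ Real.exp B :=
    (single_le_sum (f := fun h => Real.cosh (x h)) (fun h _ => (Real.cosh_pos _).le)
      (mem_univ i)).trans h
  rw [← Real.cosh_abs, Real.cosh_eq] at h1
  have h2 := Real.exp_pos (-|x i|)
  have h3 : Real.exp |x i| ≤ Real.exp (B + 1) := by
    rw [Real.exp_add]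
    have := Real.add_one_le_exp (1 : ℝ)
    have := Real.exp_pos B
    nlinarith
  exact Real.exp_le_exp.1 h3
end

/-- Few subsets of a planar set are cut off by halfplanes. -/
lemma card_halfplane_traces_le (P : Finset (ℝ × ℝ)) (hP : 2 ≤ #P) (𝒜 : Finset (Finset (ℝ × ℝ)))
    (h𝒜 : ∀ A ∈ 𝒜, ∃ f, A = {p ∈ P | 0 ≤ affEval f p}) : #𝒜 ≤ #P ^ 4 := by
  have hsub : 𝒜.shatterer ⊆ (range 4).biUnion fun k => P.powersetCard k := by
    intro S hS
    rw [mem_shatterer] at hS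
    have h3 := card_le_three_of_shatters P 𝒜 h𝒜 S hS
    have hSP : S ⊆ P := by
      obtain ⟨A, hA, hSA⟩ := hS.exists_superset
      obtain ⟨f, rfl⟩ := h𝒜 A hA
      exact hSA.trans (filter_subset _ _)
    rw [mem_biUnion]
    exact ⟨#S, mem_range.2 (by omega), mem_powersetCard.2 ⟨hSP, rfl⟩⟩
  have h1 : #((range 4).biUnion fun k => P.powersetCard k) ≤ ∑ k ∈ range 4, #P ^ k := by
    refine card_biUnion_le.trans (sum_le_sum fun k _ => ?_)
    rw [card_powersetCard]
    exact Nat.choose_le_pow _ _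
  refine (card_le_card_shatterer 𝒜).trans ((card_le_card hsub).trans (h1.trans ?_))
  exact (Nat.geomSum_lt hP fun k hk => mem_range.1 hk).le

lemma exists_half_of_even (P : Finset (ℝ × ℝ)) (m : ℕ) (hm : 1 ≤ m) (hP : #P = 2 * m) :
    ∃ Z ⊆ P, #Z = m ∧ ∀ f, |2 * (#{p ∈ Z | 0 ≤ affEval f p} : ℝ) - #{p ∈ P | 0 ≤ affEval f p}| ≤
      1842 * Real.log #P * √√(#{p ∈ P | 0 ≤ affEval f p} : ℝ) := by
  classical
  let 𝒜 : Finset (Finset (ℝ × ℝ)) := {A ∈ P.powerset | ∃ f, A = {p ∈ P | 0 ≤ affEval f p}}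
  have h𝒜 : ∀ A ∈ 𝒜, ∃ f, A = {p ∈ P | 0 ≤ affEval f p} := fun A hA => (mem_filter.1 hA).2
  have hcard𝒜 := card_halfplane_traces_le P (by omega) 𝒜 h𝒜
  have hmem : ∀ f, {p ∈ P | 0 ≤ affEval f p} ∈ 𝒜 := fun f =>
    mem_filter.2 ⟨mem_powerset.2 (filter_subset _ _), f, rfl⟩
  choose g hg using fun A : 𝒜 => h𝒜 A A.2
  let j : 𝒜 → ℕ := fun A => Nat.log 4 #A.1
  let a : 𝒜 → ℝ := fun A => (√(2 ^ j A))⁻¹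
  have ha2 : ∀ A, a A ^ 2 = (2 ^ j A : ℝ)⁻¹ := fun A => by
    simp only [a]; rw [inv_pow, Real.sq_sqrt (by positivity)]
  have : Nonempty 𝒜 := ⟨⟨_, hmem 0⟩⟩
  have hj : ∀ A : 𝒜, #{p ∈ P | 0 ≤ affEval (g A) p} ≤ 4 ^ (j A + 1) := fun A => by
    rw [← hg A]
    exact (Nat.lt_pow_succ_log_self (by norm_num) _).le
  obtain ⟨Z, hZP, hZm, hZ⟩ := exists_half_sum_cosh_le (fun (A : 𝒜) p => 0 ≤ affEval (g A) p) a
    (fun A => by rw [ha2]; exact inv_le_one_of_one_le₀ (one_le_pow₀ (by norm_num))) P (136 * 9)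
    (fun Q hQP hQ w hw => by
      obtain ⟨p, hp, q, hq, hpq, hle⟩ := exists_pair_sum_separated_le
        (fun (A : 𝒜) p => 0 ≤ affEval (g A) p) Q hQ (fun A => 2 ^ j A) (fun A => by positivity) 9
        (by norm_num)
        (fun m f S hS => card_le_two_of_shatters (fun i => g (f i)) Q S hS)
        (fun m f => by
          have := card_image_trace_le Q (fun i => g (f i)) (fun i => j (f i)) fun i =>
            (card_le_card (filter_subset_filter _ hQP)).trans (hj (f i))
          exact_mod_cast this)
        w hw
      refine ⟨p, hp, q, hq, hpq, le_trans (le_of_eq ?_) hle⟩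
      refine sum_congr rfl fun A _ => ?_
      rw [ha2, div_eq_mul_inv]) m P subset_rfl hP (fun _ => 0)
  refine ⟨Z, hZP, hZm, fun f => ?_⟩
  set n : ℝ := (#P : ℝ) with hn
  have hn2 : (2 : ℝ) ≤ n := by rw [hn]; exact_mod_cast (by omega : 2 ≤ #P)
  have hlog : 1 / 2 ≤ Real.log n := by
    have := Real.log_two_gt_d9
    have := Real.log_le_log (by norm_num) hn2
    linarith
  rcases Nat.eq_zero_or_pos #{p ∈ P | 0 ≤ affEval f p} with h0 | hpos
  · have hZ0 : #{p ∈ Z | 0 ≤ affEval f p} = 0 :=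
      Nat.le_zero.1 (h0 ▸ card_le_card (filter_subset_filter _ hZP))
    simp [h0, hZ0]
  have hbound := abs_le_of_sum_cosh_le (fun A : 𝒜 => a A * (0 + (2 *
    (#{p ∈ Z | 0 ≤ affEval (g A) p} : ℝ) - #{p ∈ P | 0 ≤ affEval (g A) p})))
    (4 * Real.log n + 612 * (1 + Real.log n)) (by
    refine hZ.trans ?_
    rw [Real.exp_add, mul_comm]
    simp only [mul_zero, Real.cosh_zero, sum_const, card_univ, Fintype.card_coe, nsmul_eq_mul,
      mul_one]
    refine mul_le_mul ?_ (Real.exp_le_exp.2 ?_) (Real.exp_pos _).le (Real.exp_pos _).le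
    · have h1 : (#𝒜 : ℝ) ≤ n ^ 4 := by rw [hn]; exact_mod_cast hcard𝒜
      refine h1.trans (le_of_eq ?_)
      rw [← Real.log_rpow (by linarith), Real.exp_log (by positivity)]
      norm_cast
    · have h1 := harmonic_le_one_add_log m
      have h2 : Real.log m ≤ Real.log n := Real.log_le_log (by exact_mod_cast hm) (by
        rw [hn, hP]; exact_mod_cast (by omega : m ≤ 2 * m))
      linarith) ⟨_, hmem f⟩
  set A : 𝒜 := ⟨_, hmem f⟩ with hA
  have hPA : {p ∈ P | 0 ≤ affEval (g A) p} = {p ∈ P | 0 ≤ affEval f p} := (hg A).symm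
  have hZA : {p ∈ Z | 0 ≤ affEval (g A) p} = {p ∈ Z | 0 ≤ affEval f p} := by
    rw [← inter_eq_right.2 hZP, ← filter_inter, hPA, filter_inter]
  rw [hPA, hZA, zero_add, abs_mul] at hbound
  have hapos : 0 < √(2 ^ j A : ℝ) := Real.sqrt_pos.2 (by positivity)
  rw [abs_of_pos (by simp only [a]; positivity), inv_mul_le_iff₀ hapos] at hbound
  refine hbound.trans ?_
  have h1 : √(2 ^ j A : ℝ) ≤ √√(#{p ∈ P | 0 ≤ affEval f p} : ℝ) := by
    refine Real.sqrt_le_sqrt (Real.le_sqrt_of_sq_le ?_)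
    rw [← pow_mul, mul_comm, pow_mul]
    have := Nat.pow_log_le_self 4 hpos.ne'
    norm_num
    exact_mod_cast this
  rw [mul_comm]
  exact mul_le_mul (by linarith) h1 hapos.le (by linarith)

/-- Halving a planar point set with halfplane discrepancy sensitive to the halfplane. -/
lemma exists_half (P : Finset (ℝ × ℝ)) (hP : 2 ≤ #P) :
    ∃ Z ⊆ P, #P ≤ 2 * #Z ∧ 2 * #Z ≤ #P + 1 ∧ ∀ f,
      |2 * (#{p ∈ Z | 0 ≤ affEval f p} : ℝ) - #{p ∈ P | 0 ≤ affEval f p}| ≤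
        1844 * Real.log #P * √√(#{p ∈ P | 0 ≤ affEval f p} : ℝ) := by
  have hlog : 1 / 2 ≤ Real.log #P := by
    have := Real.log_two_gt_d9
    have := Real.log_le_log (by norm_num) (by exact_mod_cast hP : (2 : ℝ) ≤ #P)
    linarith
  rcases Nat.even_or_odd' #P with ⟨m, hm | hm⟩
  · obtain ⟨Z, hZP, hZm, hZ⟩ := exists_half_of_even P m (by omega) hm
    refine ⟨Z, hZP, by omega, by omega, fun f => (hZ f).trans ?_⟩
    gcongr
    norm_num
  · obtain ⟨x, hx⟩ := card_pos.1 (by omega : 0 < #P)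
    have hcard : #(P.erase x) = 2 * m := by rw [card_erase_of_mem hx]; omega
    obtain ⟨Z, hZP, hZm, hZ⟩ := exists_half_of_even (P.erase x) m (by omega) hcard
    have hxZ : x ∉ Z := fun h => by simpa using hZP h
    have hZ1 : #(insert x Z) = m + 1 := by rw [card_insert_of_notMem hxZ, hZm]
    refine ⟨insert x Z, insert_subset hx (hZP.trans (erase_subset _ _)), by omega, by omega,
      fun f => ?_⟩
    have e1 : (#{p ∈ insert x Z | 0 ≤ affEval f p} : ℝ) =
        (if 0 ≤ affEval f x then 1 else 0) + #{p ∈ Z | 0 ≤ affEval f p} := by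
      simp only [← sum_boole]
      rw [sum_insert hxZ]
    have e2 : (#{p ∈ P | 0 ≤ affEval f p} : ℝ) =
        (if 0 ≤ affEval f x then 1 else 0) + #{p ∈ P.erase x | 0 ≤ affEval f p} := by
      simp only [← sum_boole]
      exact (add_sum_erase P _ hx).symm
    have hle : (#{p ∈ P.erase x | 0 ≤ affEval f p} : ℝ) ≤ #{p ∈ P | 0 ≤ affEval f p} := by
      exact_mod_cast card_le_card (filter_subset_filter _ (erase_subset _ _))
    have hind : (if 0 ≤ affEval f x then (1 : ℝ) else 0) ≤
        2 * Real.log #P * √√(#{p ∈ P | 0 ≤ affEval f p} : ℝ) := by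
      split_ifs with h
      · have : (1 : ℝ) ≤ #{p ∈ P | 0 ≤ affEval f p} := by
          exact_mod_cast card_pos.2 ⟨x, mem_filter.2 ⟨hx, h⟩⟩
        have : 1 ≤ √√(#{p ∈ P | 0 ≤ affEval f p} : ℝ) :=
          Real.one_le_sqrt.2 (Real.one_le_sqrt.2 this)
        nlinarith
      · exact mul_nonneg (by linarith) (Real.sqrt_nonneg _)
    have hind0 : 0 ≤ (if 0 ≤ affEval f x then (1 : ℝ) else 0) := by split_ifs <;> norm_num
    have hZf : |2 * (#{p ∈ Z | 0 ≤ affEval f p} : ℝ) - #{p ∈ P.erase x | 0 ≤ affEval f p}| ≤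
        1842 * Real.log #P * √√(#{p ∈ P | 0 ≤ affEval f p} : ℝ) := by
      refine (hZ f).trans ?_
      have : (0 : ℝ) < #(P.erase x) := by rw [hcard]; exact_mod_cast (by omega : 0 < 2 * m)
      have hle' : (#(P.erase x) : ℝ) ≤ #P := by exact_mod_cast card_erase_le
      gcongr
    rw [abs_le] at hZf ⊢
    rw [e1]
    constructor <;> linarith [hZf.1, hZf.2]

noncomputable section
/-- The fraction of points of `Z` in the halfplane `0 ≤ affEval f`. -/
def affMeas (f : ℝ × ℝ × ℝ) (Z : Finset (ℝ × ℝ)) : ℝ := #{p ∈ Z | 0 ≤ affEval f p} / #Z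

lemma affMeas_nonneg (f : ℝ × ℝ × ℝ) (Z : Finset (ℝ × ℝ)) : 0 ≤ affMeas f Z := by
  unfold affMeas; positivity

lemma affMeas_le_one (f : ℝ × ℝ × ℝ) (Z : Finset (ℝ × ℝ)) : affMeas f Z ≤ 1 :=
  div_le_one_of_le₀ (by exact_mod_cast card_filter_le _ _) (by positivity)

lemma sqrt_sqrt_le_iff {x y : ℝ} (hy : 0 ≤ y) : √√x ≤ y ↔ x ≤ y ^ 4 := by
  rw [Real.sqrt_le_left hy, Real.sqrt_le_left (by positivity), ← pow_mul]

lemma sqrt_sqrt_pow_four {x : ℝ} (hx : 0 ≤ x) : √√x ^ 4 = x := by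
  rw [show (4 : ℕ) = 2 * 2 from rfl, pow_mul, Real.sq_sqrt (Real.sqrt_nonneg _), Real.sq_sqrt hx]

lemma le_sqrt_sqrt_of_le_one {x : ℝ} (h0 : 0 ≤ x) (h1 : x ≤ 1) : x ≤ √√x := by
  have h2 : √√x ≤ 1 := (sqrt_sqrt_le_iff zero_le_one).2 (by simpa using h1)
  calc x = √√x ^ 4 := (sqrt_sqrt_pow_four h0).symm
    _ ≤ √√x := pow_le_of_le_one (Real.sqrt_nonneg _) h2 (by norm_num)

/-- Halving, in terms of measures. -/
lemma exists_half_affMeas (Q : Finset (ℝ × ℝ)) (hQ : 2 ≤ #Q) :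
    ∃ Z ⊆ Q, #Q ≤ 2 * #Z ∧ 2 * #Z ≤ #Q + 1 ∧ ∀ f,
      |affMeas f Z - affMeas f Q| * √√(#Q : ℝ) ^ 3 ≤ 1846 * Real.log #Q * √√(affMeas f Q) := by
  obtain ⟨Z, hZQ, hZ1, hZ2, hZ⟩ := exists_half Q hQ
  refine ⟨Z, hZQ, hZ1, hZ2, fun f => ?_⟩
  set n : ℝ := (#Q : ℝ) with hn
  set z : ℝ := (#Z : ℝ) with hz
  set r : ℝ := √√n with hr
  have hn2 : (2 : ℝ) ≤ n := by rw [hn]; exact_mod_cast hQ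
  have hz1 : n ≤ 2 * z := by rw [hn, hz]; exact_mod_cast hZ1
  have hz2 : 2 * z ≤ n + 1 := by rw [hn, hz]; exact_mod_cast hZ2
  have hlog : 1 / 2 ≤ Real.log n := by
    have := Real.log_two_gt_d9
    have := Real.log_le_log (by norm_num) hn2
    linarith
  have hr4 : r ^ 4 = n := sqrt_sqrt_pow_four (by linarith)
  have hr1 : 1 ≤ r := Real.one_le_sqrt.2 (Real.one_le_sqrt.2 (by linarith))
  set x := affMeas f Q with hx
  have hx0 : 0 ≤ x := affMeas_nonneg f Q
  have hx1 : x ≤ √√x := le_sqrt_sqrt_of_le_one hx0 (affMeas_le_one f Q)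
  have hk : (#{p ∈ Q | 0 ≤ affEval f p} : ℝ) = x * n := by
    rw [hx, affMeas, div_mul_cancel₀]; linarith
  have hkz : (#{p ∈ Z | 0 ≤ affEval f p} : ℝ) = affMeas f Z * z := by
    rw [affMeas, div_mul_cancel₀]; linarith
  have hZf := hZ f
  rw [hk, hkz, Real.sqrt_mul hx0, Real.sqrt_mul (Real.sqrt_nonneg _), ← hr] at hZf
  have h1 : |affMeas f Z - x| * (2 * z) ≤ 1846 * Real.log n * (√√x * r) := by
    have e : (affMeas f Z - x) * (2 * z) = (2 * (affMeas f Z * z) - x * n) + x * (n - 2 * z) := by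
      ring
    have h2 : |x * (n - 2 * z)| ≤ x := by
      rw [abs_mul, abs_of_nonneg hx0, abs_of_nonpos (by linarith)]
      nlinarith
    have h3 : x ≤ 2 * Real.log n * (√√x * r) := by
      have : √√x ≤ √√x * r := le_mul_of_one_le_right (Real.sqrt_nonneg _) hr1
      have h5 : 0 ≤ √√x * r := by positivity
      nlinarith
    rw [← abs_of_pos (by linarith : 0 < 2 * z), ← abs_mul, e]
    refine (abs_add_le _ _).trans ?_
    linarith
  have h4 : |affMeas f Z - x| * n ≤ 1846 * Real.log n * (√√x * r) :=
    le_trans (mul_le_mul_of_nonneg_left hz1 (abs_nonneg _)) h1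
  rw [← hr4] at h4
  have h5 : (|affMeas f Z - x| * r ^ 3) * r ≤ (1846 * Real.log n * √√x) * r := by
    rw [← hr4]; linarith
  exact le_of_mul_le_mul_right h5 (by linarith)

lemma exists_sensitive_approx_of_log_le (P : Finset (ℝ × ℝ)) (hP : P.Nonempty) (e R : ℝ)
    (he : 0 < e) (hR : 2 ≤ R)
    (hlog : 14768 * (4 * Real.log R + 4) ≤ 0.35 * e ^ 3 * R ^ 3) :
    ∃ Z ⊆ P, Z.Nonempty ∧ (#Z : ℝ) ≤ R ^ 4 ∧ ∀ f,
      |affMeas f P - affMeas f Z| ≤ 1 / 2 * (e ^ 3 * √√(affMeas f P) + e ^ 4) := by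
  classical
  rcases le_or_gt (#P : ℝ) (R ^ 4) with hsmall | hbig
  · exact ⟨P, subset_rfl, hP, hsmall, fun f => by rw [sub_self, abs_zero]; positivity⟩
  let M : ℝ × ℝ × ℝ → ℝ := fun f => √√(max (affMeas f P) (e ^ 4))
  have hM : ∀ f, M f ^ 4 = max (affMeas f P) (e ^ 4) := fun f =>
    sqrt_sqrt_pow_four (le_max_of_le_right (by positivity))
  have heM : ∀ f, e ≤ M f := fun f => by
    refine le_of_pow_le_pow_left₀ (n := 4) (by norm_num) (Real.sqrt_nonneg _) ?_
    rw [hM]; exact le_max_right _ _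
  have hpM : ∀ f, affMeas f P ≤ M f ^ 4 := fun f => by rw [hM]; exact le_max_left _ _
  let good : Finset (ℝ × ℝ) → Prop := fun Q => R ^ 4 / 2 ≤ #Q ∧
    ∀ f, |affMeas f Q - affMeas f P| * √(#Q : ℝ) ≤ 0.35 * e ^ 3 * R ^ 2 * M f
  have hgood : ∀ Q, good Q → ∀ f, |affMeas f Q - affMeas f P| ≤ 1 / 2 * e ^ 3 * M f := by
    intro Q hQ f
    have h1 : 0.7 * R ^ 2 ≤ √(#Q : ℝ) := by
      refine Real.le_sqrt_of_sq_le (le_trans ?_ hQ.1)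
      nlinarith [show 0 ≤ R ^ 4 by positivity]
    have h2 := hQ.2 f
    have h3 := (mul_le_mul_of_nonneg_left h1 (abs_nonneg (affMeas f Q - affMeas f P))).trans h2
    have h4 : 0 < R ^ 2 := by positivity
    refine le_of_mul_le_mul_right ?_ h4
    linarith
  have hstep : ∀ Q ⊆ P, good Q → R ^ 4 < #Q → ∃ Z ⊆ P, good Z ∧ #Z < #Q := by
    intro Q hQP hQ hcard
    have hR4 : (16 : ℝ) ≤ R ^ 4 := by
      calc (16 : ℝ) = 2 ^ 4 := by norm_num
        _ ≤ R ^ 4 := pow_le_pow_left₀ (by norm_num) hR 4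
    have hn16 : 16 ≤ #Q := by exact_mod_cast hR4.trans hcard.le
    obtain ⟨Z, hZQ, hZ1, hZ2, hZ⟩ := exists_half_affMeas Q (by omega)
    refine ⟨Z, hZQ.trans hQP, ⟨?_, fun f => ?_⟩, by omega⟩
    · have : (#Q : ℝ) ≤ 2 * #Z := by exact_mod_cast hZ1
      linarith
    have hMQ : √√(affMeas f Q) ≤ 2 * M f := by
      refine (sqrt_sqrt_le_iff (by positivity)).2 ?_
      have h1 := (abs_le.1 (hgood Q hQ f)).2
      have h2 : e ^ 3 * M f ≤ M f ^ 4 := by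
        have := pow_le_pow_left₀ he.le (heM f) 3
        have h3 : 0 ≤ M f := Real.sqrt_nonneg _
        nlinarith
      have h3 := hpM f
      have h4 : 0 ≤ M f ^ 4 := by positivity
      rw [mul_pow]
      linarith
    have hZf := hZ f
    set n : ℝ := (#Q : ℝ) with hn
    set r : ℝ := √√n with hr
    have hn0 : 0 ≤ n := by positivity
    have hr4 : r ^ 4 = n := sqrt_sqrt_pow_four hn0
    have hr2 : r ^ 2 = √n := Real.sq_sqrt (Real.sqrt_nonneg _)
    have hRr : R ≤ r := by
      refine le_of_pow_le_pow_left₀ (n := 4) (by norm_num) (Real.sqrt_nonneg _) ?_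
      rw [hr4]; exact hcard.le
    have hr0 : 0 < r := by linarith
    have hz : √(#Z : ℝ) ≤ 0.8 * r ^ 2 := by
      refine (Real.sqrt_le_left (by positivity)).2 ?_
      have h1 : (2 * #Z : ℝ) ≤ n + 1 := by rw [hn]; exact_mod_cast hZ2
      have h2 : (16 : ℝ) ≤ n := by rw [hn]; exact_mod_cast hn16
      rw [mul_pow, ← pow_mul, hr4]
      linarith
    have hlogn : 14768 * Real.log n ≤ 0.35 * e ^ 3 * R ^ 2 * r := by
      have h1 : Real.log n = 4 * Real.log r := by rw [← hr4, Real.log_pow]; norm_num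
      have h2 : Real.log r = Real.log R + Real.log (r / R) := by
        rw [Real.log_div (by linarith) (by linarith)]; ring
      have h3 : Real.log (r / R) ≤ r / R :=
        (Real.log_le_sub_one_of_pos (by positivity)).trans (by linarith)
      have h4 : 1 ≤ r / R := (one_le_div (by linarith)).2 hRr
      have h5 : 0 ≤ Real.log R := Real.log_nonneg (by linarith)
      have h6 : Real.log n ≤ r / R * (4 * Real.log R + 4) := by
        rw [h1, h2]; nlinarith
      have h7 := mul_le_mul_of_nonneg_left hlog (by positivity : 0 ≤ r / R)
      have h8 : r / R * (0.35 * e ^ 3 * R ^ 3) = 0.35 * e ^ 3 * R ^ 2 * r := by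
        have : R ≠ 0 := by linarith
        field_simp
      linarith
    have hM0 : 0 ≤ M f := Real.sqrt_nonneg _
    have hA : |affMeas f Z - affMeas f Q| * r ^ 2 ≤ 0.25 * (0.35 * e ^ 3 * R ^ 2 * M f) := by
      have hlog0 : 0 ≤ Real.log n := Real.log_natCast_nonneg _
      have h1 := mul_le_mul_of_nonneg_left hMQ (by positivity : 0 ≤ 1846 * Real.log n)
      have h2 := mul_le_mul_of_nonneg_right hlogn hM0
      refine le_of_mul_le_mul_right ?_ hr0
      linarith
    have hB : |affMeas f Q - affMeas f P| * r ^ 2 ≤ 0.35 * e ^ 3 * R ^ 2 * M f := by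
      rw [hr2]; exact hQ.2 f
    have hC := abs_sub_le (affMeas f Z) (affMeas f Q) (affMeas f P)
    calc |affMeas f Z - affMeas f P| * √(#Z : ℝ)
        ≤ (|affMeas f Z - affMeas f Q| + |affMeas f Q - affMeas f P|) * (0.8 * r ^ 2) := by
          gcongr
      _ ≤ 0.35 * e ^ 3 * R ^ 2 * M f := by linarith
  have hPgood : good P := by
    refine ⟨by linarith [show 0 ≤ R ^ 4 by positivity], fun f => ?_⟩
    have : 0 ≤ M f := Real.sqrt_nonneg _
    rw [sub_self, abs_zero, zero_mul]
    positivity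
  obtain ⟨Z, hZ, hmin⟩ := exists_min_image {Q ∈ P.powerset | good Q} card
    ⟨P, mem_filter.2 ⟨mem_powerset_self P, hPgood⟩⟩
  rw [mem_filter, mem_powerset] at hZ
  refine ⟨Z, hZ.1, ?_, ?_, fun f => ?_⟩
  · have h1 := hZ.2.1
    have h2 : 0 < R ^ 4 := by positivity
    refine card_pos.1 ?_
    exact_mod_cast (by linarith : (0 : ℝ) < #Z)
  · by_contra! h
    obtain ⟨Z', hZ', hgood', hlt⟩ := hstep Z hZ.1 hZ.2 h
    exact absurd (hmin Z' (mem_filter.2 ⟨mem_powerset.2 hZ', hgood'⟩)) (by omega)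
  · rw [abs_sub_comm]
    refine (hgood Z hZ.2 f).trans ?_
    have h1 : M f ≤ √√(affMeas f P) + e := by
      rcases max_choice (affMeas f P) (e ^ 4) with h | h
      · simp only [M, h]; linarith
      · simp only [M, h]
        have := (sqrt_sqrt_le_iff he.le).2 (le_refl (e ^ 4))
        have := Real.sqrt_nonneg √(affMeas f P)
        linarith
    have h2 := mul_le_mul_of_nonneg_left h1 (by positivity : 0 ≤ 1 / 2 * e ^ 3)
    linarith

/-- Every planar point set has a small sensitive approximation for affine functions. -/
lemma exists_sensitive_approx (P : Finset (ℝ × ℝ)) (hP : P.Nonempty) (ε : ℝ) (hε : 0 < ε)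
    (hε1 : ε < 1) :
    ∃ Z ⊆ P, Z.Nonempty ∧
      (#Z : ℝ) ≤ 10 ^ 12 * (1 / ε ^ 2) * Real.log (2 / ε) ^ ((4 : ℝ) / 3) ∧
      ∀ f, |affMeas f P - affMeas f Z| ≤
        1 / 2 * (ε ^ ((3 : ℝ) / 2) * affMeas f P ^ ((1 : ℝ) / 4) + ε ^ 2) := by
  set L : ℝ := Real.log (2 / ε) with hL
  have hLε : L = Real.log 2 - Real.log ε := Real.log_div (by norm_num) hε.ne'
  have hlog2 := Real.log_two_gt_d9
  have hlog2' := Real.log_two_lt_d9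
  have hlogε : Real.log ε < 0 := Real.log_neg hε hε1
  have hL0 : 0.69 ≤ L := by linarith
  set l : ℝ := L ^ ((1 : ℝ) / 3) with hl
  have hl0 : 0 < l := Real.rpow_pos_of_pos (by linarith) _
  have hl3 : l ^ 3 = L := by
    rw [hl, ← Real.rpow_natCast, ← Real.rpow_mul (by linarith)]; norm_num
  have hl4 : l ^ 4 = L ^ ((4 : ℝ) / 3) := by
    rw [hl, ← Real.rpow_natCast, ← Real.rpow_mul (by linarith)]; norm_num
  have hlhalf : 1 / 2 ≤ l := by
    refine le_of_pow_le_pow_left₀ (n := 3) (by norm_num) hl0.le ?_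
    rw [hl3]; linarith
  set e : ℝ := √ε with he
  have he0 : 0 < e := Real.sqrt_pos.2 hε
  have he2 : e ^ 2 = ε := Real.sq_sqrt hε.le
  have he1 : e ≤ 1 := Real.sqrt_le_one.2 hε1.le
  have he3 : e ^ 3 = ε ^ ((3 : ℝ) / 2) := by
    rw [he, Real.sqrt_eq_rpow, ← Real.rpow_natCast, ← Real.rpow_mul hε.le]; norm_num
  have he4 : e ^ 4 = ε ^ 2 := by rw [← he2]; ring
  obtain ⟨Z, hZP, hZ0, hZcard, hZ⟩ := exists_sensitive_approx_of_log_le P hP e (1000 * l / e) he0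
    (by rw [le_div_iff₀ he0]; linarith) (by
      have h1 : Real.log (1000 * l / e) = Real.log 1000 + Real.log l - Real.log e := by
        rw [Real.log_div (by positivity) he0.ne', Real.log_mul (by norm_num) hl0.ne']
      have h2 : Real.log 1000 ≤ 10 * Real.log 2 := by
        have : Real.log 1000 ≤ Real.log (2 ^ 10) := Real.log_le_log (by norm_num) (by norm_num)
        rwa [Real.log_pow] at this
      have h3 : 3 * Real.log l ≤ L := by
        have h4 : Real.log L = 3 * Real.log l := by rw [← hl3, Real.log_pow]; norm_num
        have := Real.log_le_sub_one_of_pos (by linarith : 0 < L)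
        linarith
      have h5 : 2 * Real.log e = Real.log ε := by rw [← he2, Real.log_pow]; norm_num
      have h6 : 0.35 * e ^ 3 * (1000 * l / e) ^ 3 = 0.35 * 1000 ^ 3 * L := by
        rw [← hl3]; field_simp
      rw [h1, h6]
      linarith)
  refine ⟨Z, hZP, hZ0, hZcard.trans (le_of_eq ?_), fun f => (hZ f).trans (le_of_eq ?_)⟩
  · rw [div_pow, mul_pow, he4, hl4]; ring
  · rw [he3, he4, Real.sqrt_eq_rpow, Real.sqrt_eq_rpow, ← Real.rpow_mul (affMeas_nonneg f P)]
    norm_num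
lemma meas2_eq_affMeas (a b c : ℝ) (Z : Finset (ℝ × ℝ)) :
    meas2 {x : ℝ × ℝ | 0 ≤ a * x.1 + b * x.2 + c} Z = affMeas (a, b, c) Z := by
  have h : (↑Z : Set (ℝ × ℝ)) ∩ {x : ℝ × ℝ | 0 ≤ a * x.1 + b * x.2 + c} =
      ↑({p ∈ Z | 0 ≤ affEval (a, b, c) p} : Finset (ℝ × ℝ)) := by
    ext x
    rw [Set.mem_inter_iff, mem_coe, mem_coe, mem_filter]
    rfl
  rw [meas2, affMeas, h, Set.ncard_coe_finset]

end

end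

/-- Every finite planar point set admits a subset `Z` of size
`O((1/ε²)·log^{4/3}(2/ε))` such that, for every closed halfplane `h`,
`|X̄(h,P) − X̄(h,Z)| ≤ (1/2)(ε^{3/2}·X̄(h,P)^{1/4} + ε²)`. -/
theorem improved_sensitive_approx_halfplanes :
    ∃ C : ℝ, 0 < C ∧
      ∀ P : Finset (ℝ × ℝ), P.Nonempty →
        ∀ ε : ℝ, 0 < ε → ε < 1 →
          ∃ Z : Finset (ℝ × ℝ), Z ⊆ P ∧ Z.Nonempty ∧
            (Z.card : ℝ) ≤ C * (1 / ε ^ 2) * Real.log (2 / ε) ^ ((4 : ℝ) / 3) ∧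
            ∀ a b c : ℝ, (a, b) ≠ (0, 0) →
              |meas2 {x : ℝ × ℝ | 0 ≤ a * x.1 + b * x.2 + c} P -
                  meas2 {x : ℝ × ℝ | 0 ≤ a * x.1 + b * x.2 + c} Z| ≤
                (1 / 2) * (ε ^ ((3 : ℝ) / 2) *
                    (meas2 {x : ℝ × ℝ | 0 ≤ a * x.1 + b * x.2 + c} P) ^ ((1 : ℝ) / 4) +
                  ε ^ 2) := by
  refine ⟨10 ^ 12, by norm_num, fun P hP ε hε hε1 => ?_⟩
  obtain ⟨Z, hZP, hZ0, hZcard, hZ⟩ := exists_sensitive_approx P hP ε hε hε1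
  refine ⟨Z, hZP, hZ0, hZcard, fun a b c _ => ?_⟩
  simp only [meas2_eq_affMeas]
  exact hZ (a, b, c)
end
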